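/- Let Ω be a domain in ℂⁿ and let u be a plurisubharmonic function of class C^{1,1} on Ω with det(u_{i j̄}) = f almost everywhere, where f ≥ λ > 0 and f is α-Hölder continuous on Ω for some α ∈ (0,1). Then for every compact set K ⊂ Ω there is a constant C, depending only on n, α, λ, the α-Hölder norm of f on Ω, the C^{1,1} norm of u on Ω, and the distance from K to ∂Ω, such that the C^{2,α} norm of u on K (supremum of u, of its first and second derivatives, and the α-Hölder seminorm of its second derivatives over K) is at most C. -/

import Mathlib

open MeasureTheory Metric Set
open scoped ComplexOrder

noncomputable section

/-- `ℂⁿ` with its Euclidean (Hermitian) structure. -/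
abbrev Cn (n : ℕ) := EuclideanSpace ℂ (Fin n)

instance {n : ℕ} : MeasurableSpace (Cn n) := borel _
instance {n : ℕ} : BorelSpace (Cn n) := ⟨rfl⟩
/-- Lebesgue (Haar) measure on `ℂⁿ`. -/
instance {n : ℕ} : MeasureSpace (Cn n) := ⟨Measure.addHaar⟩

/-- Second derivative of `u` at `z` in the (real) directions `v, w`. -/
def D2 {n : ℕ} (u : Cn n → ℝ) (z v w : Cn n) : ℝ := fderiv ℝ (fderiv ℝ u) z v w

/-- The complex Hessian matrix `(u_{i j̄})` of a real valued function on `ℂⁿ`: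
`u_{i j̄} = (1/4)(u_{x_i x_j} + u_{y_i y_j}) + (i/4)(u_{x_i y_j} - u_{y_i x_j})`. -/
def complexHessian {n : ℕ} (u : Cn n → ℝ) (z : Cn n) : Matrix (Fin n) (Fin n) ℂ := fun i j =>
  (1/4 : ℂ) * ( ((D2 u z (EuclideanSpace.single i 1) (EuclideanSpace.single j 1)
      + D2 u z (EuclideanSpace.single i Complex.I) (EuclideanSpace.single j Complex.I) : ℝ) : ℂ)
    + Complex.I * ((D2 u z (EuclideanSpace.single i 1) (EuclideanSpace.single j Complex.I)
      - D2 u z (EuclideanSpace.single i Complex.I) (EuclideanSpace.single j 1) : ℝ) : ℂ) )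

/-- `u` is of class `C^{1,1}` on the open set `Ω`: continuously differentiable with
locally Lipschitz gradient. -/
def C11On {n : ℕ} (u : Cn n → ℝ) (Ω : Set (Cn n)) : Prop :=
  ContDiffOn ℝ 1 u Ω ∧
    ∀ z ∈ Ω, ∃ ε > 0, ∃ K : NNReal, ball z ε ⊆ Ω ∧ LipschitzOnWith K (fderiv ℝ u) (ball z ε)

/-- The second order derivatives of `u` exist almost everywhere in `Ω`
(automatic for `C^{1,1}` functions, by Rademacher's theorem). -/
def AESecondDiff {n : ℕ} (u : Cn n → ℝ) (Ω : Set (Cn n)) : Prop :=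
  ∀ᵐ z, z ∈ Ω → DifferentiableAt ℝ (fderiv ℝ u) z

/-- A `C^{1,1}` function is plurisubharmonic iff its complex Hessian is positive
semidefinite almost everywhere. -/
def PshAE {n : ℕ} (u : Cn n → ℝ) (Ω : Set (Cn n)) : Prop :=
  ∀ᵐ z, z ∈ Ω → (complexHessian u z).PosSemidef

section EvansKrylov

open Filter Topology Asymptotics

section Taylor

variable {E : Type*} [NormedAddCommGroup E] [NormedSpace ℝ E]

/-- Symmetric second difference. -/
def secDiff (u : E → ℝ) (x v : E) : ℝ := u (x + v) + u (x - v) - 2 * u x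

/-- `u` has a second order Taylor expansion at `x` with Hessian the symmetric form `B`. -/
def HasHessAt (u : E → ℝ) (x : E) (B : E →L[ℝ] E →L[ℝ] ℝ) : Prop :=
  (∀ v w, B v w = B w v) ∧ ∃ ℓ : E →L[ℝ] ℝ,
    (fun v => u (x + v) - u x - ℓ v - (1 / 2) * B v v) =o[𝓝 0] fun v => ‖v‖ ^ 2

theorem HasHessAt.add {u₁ u₂ : E → ℝ} {x : E} {B₁ B₂ : E →L[ℝ] E →L[ℝ] ℝ}
    (h₁ : HasHessAt u₁ x B₁) (h₂ : HasHessAt u₂ x B₂) :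
    HasHessAt (fun y => u₁ y + u₂ y) x (B₁ + B₂) := by
  obtain ⟨s₁, ℓ₁, h₁⟩ := h₁
  obtain ⟨s₂, ℓ₂, h₂⟩ := h₂
  refine ⟨fun v w => by simp [s₁ v w, s₂ v w], ℓ₁ + ℓ₂, ?_⟩
  refine (h₁.add h₂).congr_left fun v => ?_
  simp only [add_apply]
  ring

theorem HasHessAt.const_mul {u : E → ℝ} {x : E} {B : E →L[ℝ] E →L[ℝ] ℝ}
    (h : HasHessAt u x B) (c : ℝ) : HasHessAt (fun y => c * u y) x (c • B) := by
  obtain ⟨s, ℓ, h⟩ := h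
  refine ⟨fun v w => by simp [s v w], c • ℓ, ?_⟩
  refine (h.const_mul_left c).congr_left fun v => ?_
  simp only [smul_apply, smul_eq_mul]
  ring

theorem HasHessAt.sub {u₁ u₂ : E → ℝ} {x : E} {B₁ B₂ : E →L[ℝ] E →L[ℝ] ℝ}
    (h₁ : HasHessAt u₁ x B₁) (h₂ : HasHessAt u₂ x B₂) :
    HasHessAt (fun y => u₁ y - u₂ y) x (B₁ - B₂) := by
  have := h₁.add (h₂.const_mul (-1))
  convert this using 1
  · ext y; ring
  · ext v w; simp [sub_eq_add_neg]

/-- Hessian of `y ↦ c * u (a + s • y)`. -/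
theorem HasHessAt.comp_affine {u : E → ℝ} {a x : E} {s : ℝ}
    {B : E →L[ℝ] E →L[ℝ] ℝ} (h : HasHessAt u (a + s • x) B) :
    HasHessAt (fun y => u (a + s • y)) x (s ^ 2 • B) := by
  obtain ⟨sy, ℓ, h⟩ := h
  refine ⟨fun v w => by simp [sy v w], s • ℓ, ?_⟩
  have ht : Tendsto (fun v : E => s • v) (𝓝 0) (𝓝 0) := by
    have : Continuous fun v : E => s • v := continuous_const_smul s
    simpa using this.tendsto 0
  have h1 := h.comp_tendsto ht
  have h2 : ((fun v : E => ‖v‖ ^ 2) ∘ fun v : E => s • v) =O[𝓝 0] fun v : E => ‖v‖ ^ 2 := by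
    refine IsBigO.of_bound (|s| ^ 2) (Eventually.of_forall fun v => ?_)
    simp only [Function.comp, norm_smul, mul_pow, norm_mul, norm_pow, Real.norm_eq_abs, abs_abs]
    rfl
  refine (h1.trans_isBigO h2).congr_left fun v => ?_
  simp only [Function.comp, smul_apply, smul_eq_mul, map_smul, smul_add,
    add_assoc]
  ring

theorem HasHessAt.tendsto_secDiff {u : E → ℝ} {x : E} {B : E →L[ℝ] E →L[ℝ] ℝ}
    (h : HasHessAt u x B) (v : E) :
    Tendsto (fun t : ℝ => secDiff u x (t • v) / t ^ 2) (𝓝[≠] 0) (𝓝 (B v v)) := by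
  obtain ⟨-, ℓ, h⟩ := h
  have key : ∀ σ : ℝ, |σ| = 1 → Tendsto (fun t : ℝ => (u (x + (σ * t) • v) - u x - ℓ ((σ * t) • v)
      - (1 / 2) * B ((σ * t) • v) ((σ * t) • v)) / t ^ 2) (𝓝[≠] 0) (𝓝 0) := by
    intro σ hσ
    have ht : Tendsto (fun t : ℝ => (σ * t) • v) (𝓝[≠] 0) (𝓝 0) := by
      have : Continuous fun t : ℝ => (σ * t) • v := by fun_prop
      have := this.tendsto 0
      simp only [mul_zero, zero_smul] at this
      exact this.mono_left nhdsWithin_le_nhds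
    have h1 := h.comp_tendsto ht
    have h2 : ((fun v : E => ‖v‖ ^ 2) ∘ fun t : ℝ => (σ * t) • v) =O[𝓝[≠] 0]
        fun t : ℝ => t ^ 2 := by
      refine IsBigO.of_bound (‖v‖ ^ 2) (Eventually.of_forall fun t => ?_)
      simp only [Function.comp, norm_smul, mul_pow, norm_mul, norm_pow, Real.norm_eq_abs, hσ,
        abs_abs, abs_norm]
      apply le_of_eq; ring
    exact (h1.trans_isBigO h2).tendsto_div_nhds_zero
  have h3 := ((key 1 (by simp)).add (key (-1) (by simp))).add_const (B v v)
  simp only [add_zero, zero_add] at h3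
  refine h3.congr' ?_
  filter_upwards [self_mem_nhdsWithin] with t ht
  have ht : t ≠ 0 := ht
  simp only [secDiff, map_smul, smul_apply, smul_eq_mul, one_mul, neg_mul,
    neg_smul, sub_eq_add_neg, map_neg, neg_apply]
  field_simp
  ring

theorem HasHessAt.le_of_secDiff {u : E → ℝ} {x v : E} {B : E →L[ℝ] E →L[ℝ] ℝ} {c : ℝ}
    (h : HasHessAt u x B) (hc : ∀ᶠ t in 𝓝[≠] (0 : ℝ), secDiff u x (t • v) ≤ c * t ^ 2) :
    B v v ≤ c := by
  refine le_of_tendsto (h.tendsto_secDiff v) ?_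
  filter_upwards [hc, self_mem_nhdsWithin] with t ht ht0
  have : 0 < t ^ 2 := by have : t ≠ 0 := ht0; positivity
  rwa [div_le_iff₀ this]

theorem HasHessAt.eq_of_secDiff {u : E → ℝ} {x v : E} {B : E →L[ℝ] E →L[ℝ] ℝ} {c : ℝ}
    (h : HasHessAt u x B) (hc : ∀ t : ℝ, secDiff u x (t • v) = c * t ^ 2) :
    B v v = c := by
  refine tendsto_nhds_unique (h.tendsto_secDiff v) (tendsto_const_nhds.congr' ?_)
  filter_upwards [self_mem_nhdsWithin] with t ht0
  have : t ^ 2 ≠ 0 := by have : t ≠ 0 := ht0; positivity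
  rw [hc, mul_div_assoc, div_self this, mul_one]

theorem IsLocalMax.secDiff_nonpos {ψ : E → ℝ} {p : E →L[ℝ] ℝ} {x : E}
    (h : IsLocalMax (fun y => ψ y - p y) x) : ∀ᶠ v in 𝓝 (0 : E), secDiff ψ x v ≤ 0 := by
  have h1 : Tendsto (fun v : E => x + v) (𝓝 0) (𝓝 x) := by
    have : Continuous fun v : E => x + v := by fun_prop
    simpa using this.tendsto 0
  have h2 : Tendsto (fun v : E => x - v) (𝓝 0) (𝓝 x) := by
    have : Continuous fun v : E => x - v := by fun_prop
    simpa using this.tendsto 0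
  filter_upwards [h1.eventually h, h2.eventually h] with v hv1 hv2
  simp only [map_add, map_sub] at hv1 hv2
  unfold secDiff
  linarith

theorem HasHessAt.nonpos_of_isLocalMax {ψ : E → ℝ} {p : E →L[ℝ] ℝ} {x : E}
    {B : E →L[ℝ] E →L[ℝ] ℝ} (h : HasHessAt ψ x B)
    (hm : IsLocalMax (fun y => ψ y - p y) x) (v : E) : B v v ≤ 0 := by
  apply h.le_of_secDiff
  have : Tendsto (fun t : ℝ => t • v) (𝓝[≠] 0) (𝓝 0) := by
    have : Continuous fun t : ℝ => t • v := by fun_prop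
    have := this.tendsto 0
    simp only [zero_smul] at this
    exact this.mono_left nhdsWithin_le_nhds
  filter_upwards [this.eventually hm.secDiff_nonpos] with t ht
  simpa using ht

/-- Quadratic polynomial with centre `x₀`. -/
def quadPoly (x₀ : E) (a : ℝ) (ℓ : E →L[ℝ] ℝ) (B : E →L[ℝ] E →L[ℝ] ℝ) (y : E) : ℝ :=
  a + ℓ (y - x₀) + (1 / 2) * B (y - x₀) (y - x₀)

theorem hasHessAt_quadPoly (x₀ : E) (a : ℝ) (ℓ : E →L[ℝ] ℝ) {B : E →L[ℝ] E →L[ℝ] ℝ}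
    (hB : ∀ v w, B v w = B w v) (x : E) : HasHessAt (quadPoly x₀ a ℓ B) x B := by
  refine ⟨hB, ℓ + B (x - x₀), ?_⟩
  refine (isLittleO_zero _ _).congr_left fun v => ?_
  have : x + v - x₀ = (x - x₀) + v := by abel
  simp only [quadPoly, this, map_add, add_apply]
  rw [hB v (x - x₀)]
  ring

theorem contDiff_quadPoly (x₀ : E) (a : ℝ) (ℓ : E →L[ℝ] ℝ) (B : E →L[ℝ] E →L[ℝ] ℝ)
    {n : WithTop ℕ∞} : ContDiff ℝ n (quadPoly x₀ a ℓ B) := by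
  unfold quadPoly
  have h1 : ContDiff ℝ n fun y : E => y - x₀ := by fun_prop
  exact (contDiff_const.add (ℓ.contDiff.comp h1)).add
    (contDiff_const.mul ((B.contDiff.comp h1).clm_apply h1))

theorem hasHessAt_of_differentiableAt_fderiv {u : E → ℝ} {x : E}
    (h1 : ∀ᶠ y in 𝓝 x, DifferentiableAt ℝ u y) (h2 : DifferentiableAt ℝ (fderiv ℝ u) x) :
    HasHessAt u x (fderiv ℝ (fderiv ℝ u) x) := by
  set B := fderiv ℝ (fderiv ℝ u) x with hB
  have hsymm : ∀ v w, B v w = B w v := second_derivative_symmetric_of_eventually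
    (h1.mono fun y hy => hy.hasFDerivAt) h2.hasFDerivAt
  refine ⟨hsymm, fderiv ℝ u x, ?_⟩
  rw [isLittleO_iff]
  intro c hc
  have ho := h2.hasFDerivAt.isLittleO
  rw [isLittleO_iff] at ho
  obtain ⟨r, hr, hball⟩ := Metric.eventually_nhds_iff.1 (h1.and (ho hc))
  refine Metric.eventually_nhds_iff.2 ⟨r, hr, fun v hv => ?_⟩
  rw [dist_zero_right] at hv
  have hd : ∀ z ∈ closedBall x ‖v‖, HasFDerivWithinAt
      (quadPoly x (u x) (fderiv ℝ u x) B - u)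
      ((fderiv ℝ u x + B (z - x)) - fderiv ℝ u z) (closedBall x ‖v‖) z := by
    intro z hz
    have hz' := hball (lt_of_le_of_lt (mem_closedBall.1 hz) hv)
    have e1 : HasFDerivAt (fun y : E => y - x) (ContinuousLinearMap.id ℝ E) z :=
      (hasFDerivAt_id z).sub_const x
    have e2 : HasFDerivAt (quadPoly x (u x) (fderiv ℝ u x) B) (fderiv ℝ u x + B (z - x)) z := by
      have e3 := (((fderiv ℝ u x).hasFDerivAt.comp z e1).const_add (u x)).add
        (((B.hasFDerivAt.comp z e1).clm_apply e1).const_mul (1 / 2 : ℝ))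
      refine e3.congr_fderiv ?_
      ext w
      simp
      rw [hsymm w z, hsymm w x]
      ring
    exact (e2.sub hz'.1.hasFDerivAt).hasFDerivWithinAt
  have hbd : ∀ z ∈ closedBall x ‖v‖, ‖(fderiv ℝ u x + B (z - x)) - fderiv ℝ u z‖ ≤ c * ‖v‖ := by
    intro z hz
    have hz' := (hball (lt_of_le_of_lt (mem_closedBall.1 hz) hv)).2
    rw [norm_sub_rev, ← sub_sub]
    exact hz'.trans (by gcongr; simpa [dist_eq_norm] using hz)
  have := (convex_closedBall x ‖v‖).norm_image_sub_le_of_norm_hasFDerivWithin_le hd hbd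
    (mem_closedBall_self (norm_nonneg v)) (y := x + v) (by simp)
  simp only [Pi.sub_apply, quadPoly, sub_self, map_zero, add_sub_cancel_left, mul_zero,
    add_zero] at this
  rw [← norm_neg]
  simp only [norm_pow, norm_norm]
  calc _ = ‖u x + (fderiv ℝ u x) v + 1 / 2 * (B v) v - u (x + v)‖ := by congr 1; ring
    _ ≤ c * ‖v‖ * ‖v‖ := by simpa using this
    _ = _ := by ring

end Taylor

section LocallyC11

variable {E : Type*} [NormedAddCommGroup E] [NormedSpace ℝ E]

/-- `u` is differentiable near `x`, with Lipschitz derivative near `x`. -/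
def C11At (u : E → ℝ) (x : E) : Prop :=
  ∃ s ∈ 𝓝 x, (∀ y ∈ s, DifferentiableAt ℝ u y) ∧ ∃ C, LipschitzOnWith C (fderiv ℝ u) s

theorem C11At.continuousAt {u : E → ℝ} {x : E} (h : C11At u x) : ContinuousAt u x := by
  obtain ⟨s, hs, h, -⟩ := h
  exact (h x (mem_of_mem_nhds hs)).continuousAt

theorem C11At.add {u₁ u₂ : E → ℝ} {x : E} (h₁ : C11At u₁ x) (h₂ : C11At u₂ x) :
    C11At (fun y => u₁ y + u₂ y) x := by
  obtain ⟨s₁, hs₁, d₁, C₁, l₁⟩ := h₁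
  obtain ⟨s₂, hs₂, d₂, C₂, l₂⟩ := h₂
  refine ⟨s₁ ∩ s₂, inter_mem hs₁ hs₂, fun y hy => (d₁ y hy.1).add (d₂ y hy.2), C₁ + C₂, ?_⟩
  have := (l₁.mono (inter_subset_left (t := s₂))).add (l₂.mono (inter_subset_right (s := s₁)))
  intro y hy z hz
  rw [fderiv_fun_add (d₁ y hy.1) (d₂ y hy.2), fderiv_fun_add (d₁ z hz.1) (d₂ z hz.2)]
  exact this hy hz

theorem ContDiffAt.c11At {u : E → ℝ} {x : E} (h : ContDiffAt ℝ 2 u x) : C11At u x := by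
  have h1 : ContDiffAt ℝ 1 (fderiv ℝ u) x := h.fderiv_right (by norm_num)
  obtain ⟨K, t, ht, hK⟩ := h1.exists_lipschitzOnWith
  have h2 : ∀ᶠ y in 𝓝 x, DifferentiableAt ℝ u y := by
    filter_upwards [h.eventually (by simp)] with y hy
    exact hy.differentiableAt (by norm_num)
  exact ⟨t ∩ {y | DifferentiableAt ℝ u y}, inter_mem ht h2, fun y hy => hy.2, K,
    hK.mono inter_subset_left⟩

theorem C11At.const_mul {u : E → ℝ} {x : E} (h : C11At u x) (c : ℝ) :
    C11At (fun y => c * u y) x := by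
  obtain ⟨s, hs, d, C, l⟩ := h
  refine ⟨s, hs, fun y hy => (d y hy).const_mul c, ‖c‖₊ * C, ?_⟩
  have := (lipschitzWith_smul c).comp_lipschitzOnWith l (s := s)
  intro y hy z hz
  rw [fderiv_const_mul (d y hy) c, fderiv_const_mul (d z hz) c]
  exact this hy hz

theorem C11At.sub {u₁ u₂ : E → ℝ} {x : E} (h₁ : C11At u₁ x) (h₂ : C11At u₂ x) :
    C11At (fun y => u₁ y - u₂ y) x := by
  have := h₁.add (h₂.const_mul (-1))
  simpa [sub_eq_add_neg] using this

theorem C11At.comp_affine {G : Type*} [NormedAddCommGroup G] [NormedSpace ℝ G] {u : E → ℝ}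
    {A : G →L[ℝ] E} {a : E} {x : G} (h : C11At u (a + A x)) : C11At (fun y => u (a + A y)) x := by
  obtain ⟨s, hs, d, C, l⟩ := h
  have hc : Continuous fun y : G => a + A y := by fun_prop
  have hder : ∀ y, HasFDerivAt (fun y : G => a + A y) A y := fun y => A.hasFDerivAt.const_add a
  refine ⟨(fun y => a + A y) ⁻¹' s, hc.continuousAt hs,
    fun y hy => (d _ hy).comp y (hder y).differentiableAt, ‖A‖₊ * (C * ‖A‖₊), ?_⟩
  have h1 : ∀ y ∈ (fun y => a + A y) ⁻¹' s,
      fderiv ℝ (fun y => u (a + A y)) y = (fderiv ℝ u (a + A y)).comp A := fun y hy =>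
    ((d _ hy).hasFDerivAt.comp y (hder y)).fderiv
  refine LipschitzOnWith.of_dist_le_mul fun y hy z hz => ?_
  rw [h1 y hy, h1 z hz, dist_eq_norm, ← ContinuousLinearMap.sub_comp]
  have h2 := l.dist_le_mul _ hy _ hz
  rw [dist_eq_norm, dist_add_left, dist_eq_norm, ← map_sub] at h2
  calc _ ≤ ‖fderiv ℝ u (a + A y) - fderiv ℝ u (a + A z)‖ * ‖A‖ :=
        ContinuousLinearMap.opNorm_comp_le _ _
    _ ≤ (C * (‖A‖ * ‖y - z‖)) * ‖A‖ := by gcongr; exact h2.trans (by gcongr; exact A.le_opNorm _)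
    _ = _ := by rw [dist_eq_norm]; push_cast; ring

theorem C11At.ae_hasHessAt [MeasurableSpace E] [BorelSpace E] [FiniteDimensional ℝ E]
    (μ : Measure E) [μ.IsAddHaarMeasure] {u : E → ℝ} {U : Set E} (hU : IsOpen U)
    {C : NNReal} (hd : ∀ y ∈ U, DifferentiableAt ℝ u y) (hl : LipschitzOnWith C (fderiv ℝ u) U) :
    ∀ᵐ x ∂μ, x ∈ U → HasHessAt u x (fderiv ℝ (fderiv ℝ u) x) := by
  filter_upwards [hl.ae_differentiableWithinAt_of_mem (μ := μ)] with x hx hxU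
  exact hasHessAt_of_differentiableAt_fderiv (eventually_of_mem (hU.mem_nhds hxU) hd)
    ((hx hxU).differentiableAt (hU.mem_nhds hxU))

/-- Jensen's lemma: if `φ` has a strict interior maximum, then touching points of `φ` by affine
functions from above are not negligible. -/
theorem exists_isLocalMax_sub_linear [MeasurableSpace E] [BorelSpace E] [FiniteDimensional ℝ E]
    (μ : Measure E) [μ.IsAddHaarMeasure] {φ : E → ℝ} {K : Set E} (hK : IsCompact K)
    (hφ : ∀ x ∈ K, C11At φ x) {x₀ : E} (hx₀ : x₀ ∈ K)
    (hlt : ∀ x ∈ K, x ∉ interior K → φ x < φ x₀) {Q : E → Prop} (hQ : ∀ᵐ x ∂μ, x ∈ K → Q x) :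
    ∃ x ∈ interior K, Q x ∧ ∃ p : E →L[ℝ] ℝ, IsLocalMax (fun y => φ y - p y) x := by
  have hcont : ContinuousOn φ K := fun x hx => (hφ x hx).continuousAt.continuousWithinAt
  obtain ⟨γ, hγ, hγ'⟩ : ∃ γ > 0, ∀ x ∈ K, x ∉ interior K → φ x ≤ φ x₀ - γ := by
    have hc : IsCompact (K \ interior K) := hK.diff isOpen_interior
    rcases (K \ interior K).eq_empty_or_nonempty with he | hne
    · exact ⟨1, one_pos, fun x hx hx' => absurd (show x ∈ K \ interior K from ⟨hx, hx'⟩)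
        (by simp [he])⟩
    · obtain ⟨z, hz, hmax⟩ := hc.exists_isMaxOn hne (hcont.mono sdiff_subset)
      refine ⟨φ x₀ - φ z, sub_pos.2 (hlt z hz.1 hz.2), fun x hx hx' => ?_⟩
      have : φ x ≤ φ z := hmax ⟨hx, hx'⟩
      linarith
  obtain ⟨D, hD⟩ := hK.isBounded.subset_closedBall x₀
  have hD0 : 0 ≤ D := by simpa using hD hx₀
  by_contra! hcon
  let _ : MeasurableSpace (E →L[ℝ] ℝ) := borel _
  have _ : BorelSpace (E →L[ℝ] ℝ) := ⟨rfl⟩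
  have hsub : ball (0 : E →L[ℝ] ℝ) (γ / (D + 1)) ⊆ fderiv ℝ φ '' {x ∈ K | ¬ Q x} := by
    intro p hp
    obtain ⟨z, hz, hmax⟩ := hK.exists_isMaxOn ⟨x₀, hx₀⟩ (hcont.sub p.continuous.continuousOn)
    have hzint : z ∈ interior K := by
      by_contra hz'
      have h1 := hγ' z hz hz'
      have h2 : φ x₀ - p x₀ ≤ φ z - p z := hmax hx₀
      have h3 : p x₀ - p z ≤ ‖p‖ * D := by
        rw [← map_sub]
        refine (le_abs_self _).trans ((p.le_opNorm _).trans ?_)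
        gcongr
        rw [norm_sub_rev, ← dist_eq_norm]
        exact hD hz
      have h4 : ‖p‖ * (D + 1) < γ := by
        rw [mem_ball_zero_iff, lt_div_iff₀ (by linarith)] at hp
        exact hp
      nlinarith [norm_nonneg p]
    have hloc : IsLocalMax (fun y => φ y - p y) z :=
      hmax.isLocalMax (mem_interior_iff_mem_nhds.1 hzint)
    have hnQ : ¬ Q z := fun hq => hcon z hzint hq p hloc
    refine ⟨z, ⟨hz, hnQ⟩, ?_⟩
    obtain ⟨s, hs, hd, -⟩ := hφ z hz
    have := hloc.fderiv_eq_zero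
    rw [fderiv_fun_sub (hd z (mem_of_mem_nhds hs)) p.differentiableAt, p.fderiv] at this
    exact sub_eq_zero.1 this
  have hnull : μ {x ∈ K | ¬ Q x} = 0 := by
    have h0 := ae_iff.1 hQ
    convert h0 using 2
    ext x; simp
  have hnull' : μH[Module.finrank ℝ E] {x ∈ K | ¬ Q x} = 0 :=
    Measure.absolutelyContinuous_isAddHaarMeasure _ μ hnull
  have hfin : Module.finrank ℝ (E →L[ℝ] ℝ) = Module.finrank ℝ E := by
    rw [← (LinearMap.toContinuousLinearMap (𝕜 := ℝ) (E := E) (F' := ℝ)).finrank_eq]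
    exact Subspace.dual_finrank_eq
  have himg : μH[Module.finrank ℝ E] (fderiv ℝ φ '' {x ∈ K | ¬ Q x}) = 0 := by
    choose! s hs hd C hC using hφ
    obtain ⟨t, ht, hcov⟩ := hK.elim_nhds_subcover s hs
    have : fderiv ℝ φ '' {x ∈ K | ¬ Q x} ⊆
        ⋃ x ∈ t, fderiv ℝ φ '' ({x ∈ K | ¬ Q x} ∩ s x) := by
      rintro _ ⟨y, hy, rfl⟩
      obtain ⟨x, hx, hyx⟩ := mem_iUnion₂.1 (hcov hy.1)
      exact mem_iUnion₂.2 ⟨x, hx, y, ⟨hy, hyx⟩, rfl⟩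
    refine measure_mono_null this ((measure_biUnion_null_iff t.countable_toSet).2 fun x hx => ?_)
    have h1 := ((hC x (ht x hx)).mono (inter_subset_right (s := {x ∈ K | ¬ Q x}))
      ).hausdorffMeasure_image_le (d := Module.finrank ℝ E) (by positivity)
    rw [measure_mono_null inter_subset_left hnull', mul_zero] at h1
    exact le_antisymm h1 zero_le
  have hpos : 0 < μH[Module.finrank ℝ (E →L[ℝ] ℝ)] (ball (0 : E →L[ℝ] ℝ) (γ / (D + 1))) :=
    measure_ball_pos _ _ (by positivity)
  rw [hfin] at hpos
  exact hpos.ne' (measure_mono_null hsub himg)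

end LocallyC11

theorem ae_comp_affine {E : Type*} [NormedAddCommGroup E] [NormedSpace ℝ E] [MeasurableSpace E]
    [BorelSpace E] [FiniteDimensional ℝ E] (μ : Measure E) [μ.IsAddHaarMeasure] {P : E → Prop}
    (h : ∀ᵐ x ∂μ, P x) (a : E) {s : ℝ} (hs : s ≠ 0) : ∀ᵐ y ∂μ, P (a + s • y) := by
  rw [ae_iff] at h ⊢
  have h1 : μ ((fun y => a + y) ⁻¹' {x | ¬ P x}) = 0 := by rwa [measure_preimage_add]
  have h2 := Measure.addHaar_preimage_smul μ hs ((fun y => a + y) ⁻¹' {x | ¬ P x})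
  rw [h1, mul_zero] at h2
  exact h2

theorem secDiff_neg {E : Type*} [NormedAddCommGroup E] (u : E → ℝ) (x v : E) :
    secDiff u x (-v) = secDiff u x v := by
  unfold secDiff
  rw [sub_neg_eq_add, ← sub_eq_add_neg]
  ring

theorem functional_sub {E : Type*} [NormedAddCommGroup E] [NormedSpace ℝ E]
    (l : (E →L[ℝ] E →L[ℝ] ℝ) →L[ℝ] ℝ) (X Y : E →L[ℝ] E →L[ℝ] ℝ) : l (X - Y) = l X - l Y :=
  map_sub l X Y

theorem functional_neg {E : Type*} [NormedAddCommGroup E] [NormedSpace ℝ E]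
    (l : (E →L[ℝ] E →L[ℝ] ℝ) →L[ℝ] ℝ) (X : E →L[ℝ] E →L[ℝ] ℝ) : l (-X) = -l X :=
  map_neg l X

section Doubling

variable {E : Type*} [NormedAddCommGroup E] [InnerProductSpace ℝ E]

/-- The inner product, as a bilinear form. -/
def idForm : E →L[ℝ] E →L[ℝ] ℝ := innerSL ℝ

/-- The linear functional `l` on bilinear forms is elliptic, with constants `θ` and `Θ`. -/
structure IsElliptic (θ Θ : ℝ) (l : (E →L[ℝ] E →L[ℝ] ℝ) →L[ℝ] ℝ) : Prop where
  lower : ∀ X : E →L[ℝ] E →L[ℝ] ℝ, (∀ v w, X v w = X w v) → (∀ v, 0 ≤ X v v) →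
    ∀ e, ‖e‖ ≤ 1 → θ * X e e ≤ l X
  upper : l idForm ≤ Θ

theorem IsElliptic.nonneg {θ Θ : ℝ} {l : (E →L[ℝ] E →L[ℝ] ℝ) →L[ℝ] ℝ} (h : IsElliptic θ Θ l)
    {X : E →L[ℝ] E →L[ℝ] ℝ} (hX : ∀ v w, X v w = X w v) (hX' : ∀ v, 0 ≤ X v v) : 0 ≤ l X := by
  simpa using h.lower X hX hX' 0 (by simp)

theorem idForm_symm (v w : E) : idForm v w = idForm w v :=
  (real_inner_comm v w).symm

theorem idForm_self (v : E) : idForm v v = ‖v‖ ^ 2 :=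
  real_inner_self_eq_norm_sq v

theorem bilin_le_norm (X : E →L[ℝ] E →L[ℝ] ℝ) (v : E) : |X v v| ≤ ‖X‖ * ‖v‖ ^ 2 := by
  have := X.le_opNorm₂ v v
  rw [Real.norm_eq_abs] at this
  linarith [mul_assoc ‖X‖ ‖v‖ ‖v‖, sq ‖v‖]

theorem secDiff_norm_sq (a x v : E) : secDiff (fun y => ‖y - a‖ ^ 2) x v = 2 * ‖v‖ ^ 2 := by
  have h1 : x + v - a = (x - a) + v := by abel
  have h2 : x - v - a = (x - a) - v := by abel
  simp only [secDiff, h1, h2]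
  have := parallelogram_law_with_norm ℝ (x - a) v
  linarith [sq ‖x - a + v‖, sq ‖x - a - v‖, sq ‖x - a‖, sq ‖v‖]

variable [FiniteDimensional ℝ E] [MeasurableSpace E] [BorelSpace E]
  (μ : Measure E) [μ.IsAddHaarMeasure]

/-- The doubled functional of Ishii and Lions. -/
private def doubled (w : E → ℝ) (L : ℝ) (a : E) (z : E × E) : ℝ :=
  w z.1 - w z.2 - L * (‖z.1 - z.2‖ - ‖z.1 - z.2‖ ^ 2 / 4)
    - 64 * (‖z.1 - a‖ ^ 2 + ‖z.2 - a‖ ^ 2)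

include μ in
private theorem doubled_nonpos {θ Θ L : ℝ} (hL0 : 0 ≤ L) (hL : 256 * Θ + 1 < 2 * θ * L)
    (w : E → ℝ) (hw : ∀ x ∈ ball (0 : E) 1, C11At w x) (hb : ∀ x ∈ ball (0 : E) 1, |w x| ≤ 1)
    (Q : E → Prop) (hQ : ∀ᵐ x ∂μ, x ∈ ball (0 : E) 1 → Q x)
    (hQ' : ∀ x ∈ ball (0 : E) 1, ∀ y ∈ ball (0 : E) 1, Q x → Q y → ∃ X Y l, HasHessAt w x X ∧
      HasHessAt w y Y ∧ IsElliptic θ Θ l ∧ -1 ≤ l (X - Y))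
    (a : E) (ha : a ∈ ball (0 : E) (1 / 2)) (z₀ : E × E) (hz₀ : z₀ ∈ closedBall (a, a) (1 / 4)) :
    doubled w L a z₀ ≤ 0 := by
  by_contra! hm
  set Φ := doubled w L a with hΦ
  have hsub : ∀ z ∈ closedBall (a, a) (1 / 4 : ℝ), z.1 ∈ ball (0 : E) 1 ∧ z.2 ∈ ball (0 : E) 1 := by
    intro z hz
    rw [mem_closedBall, Prod.dist_eq, max_le_iff] at hz
    rw [mem_ball] at ha
    exact ⟨by rw [mem_ball]; linarith [dist_triangle z.1 a 0, hz.1],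
      by rw [mem_ball]; linarith [dist_triangle z.2 a 0, hz.2]⟩
  have hcd : ∀ z ∈ closedBall (a, a) (1 / 4 : ℝ), ContinuousAt Φ z := by
    intro z hz
    have h1 : ContinuousAt (fun z : E × E => w z.1) z :=
      ContinuousAt.comp (f := Prod.fst) (hw _ (hsub z hz).1).continuousAt continuousAt_fst
    have h2 : ContinuousAt (fun z : E × E => w z.2) z :=
      ContinuousAt.comp (f := Prod.snd) (hw _ (hsub z hz).2).continuousAt continuousAt_snd
    have h3 : ContinuousAt (fun z : E × E => L * (‖z.1 - z.2‖ - ‖z.1 - z.2‖ ^ 2 / 4)) z := by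
      fun_prop
    have h4 : ContinuousAt (fun z : E × E => 64 * (‖z.1 - a‖ ^ 2 + ‖z.2 - a‖ ^ 2)) z := by
      fun_prop
    exact ((h1.sub h2).sub h3).sub h4
  set K := closedBall (a, a) (1 / 4 : ℝ) ∩ Φ ⁻¹' (Ici (Φ z₀ / 2)) with hKdef
  have hK : IsCompact K := by
    refine (isCompact_closedBall _ _).of_isClosed_subset ?_ inter_subset_left
    exact ContinuousOn.preimage_isClosed_of_isClosed
      (fun z hz => (hcd z hz).continuousWithinAt) isClosed_closedBall isClosed_Ici
  have hr0 : ∀ z ∈ closedBall (a, a) (1 / 4 : ℝ), ‖z.1 - z.2‖ ≤ 1 / 2 := by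
    intro z hz
    rw [mem_closedBall, Prod.dist_eq, max_le_iff] at hz
    rw [← dist_eq_norm]
    linarith [dist_triangle_right z.1 z.2 a, hz.1, hz.2]
  have hpen : ∀ z ∈ closedBall (a, a) (1 / 4 : ℝ), 0 ≤ L * (‖z.1 - z.2‖ - ‖z.1 - z.2‖ ^ 2 / 4) := by
    intro z hz
    have := hr0 z hz
    apply mul_nonneg hL0
    nlinarith [norm_nonneg (z.1 - z.2)]
  have hKball : ∀ z ∈ K, z ∈ ball (a, a) (1 / 4 : ℝ) := by
    rintro z ⟨hz, hzΦ⟩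
    have h1 : 0 < Φ z := lt_of_lt_of_le (by linarith) hzΦ
    have h2 := hpen z hz
    have h3 := (abs_le.1 (hb _ (hsub z hz).1)).2
    have h4 := (abs_le.1 (hb _ (hsub z hz).2)).1
    have h5 : ‖z.1 - a‖ ^ 2 + ‖z.2 - a‖ ^ 2 < (1 / 4) ^ 2 := by
      simp only [hΦ, doubled] at h1
      linarith
    rw [mem_ball, Prod.dist_eq, max_lt_iff, dist_eq_norm, dist_eq_norm]
    exact ⟨lt_of_pow_lt_pow_left₀ 2 (by norm_num) (by nlinarith [sq_nonneg ‖z.2 - a‖]),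
      lt_of_pow_lt_pow_left₀ 2 (by norm_num) (by nlinarith [sq_nonneg ‖z.1 - a‖])⟩
  have hne : ∀ z ∈ K, z.1 - z.2 ≠ 0 := by
    rintro z ⟨hz, hzΦ⟩ h0
    have h1 : 0 < Φ z := lt_of_lt_of_le (by linarith) hzΦ
    have h2 : z.1 = z.2 := sub_eq_zero.1 h0
    simp only [hΦ, doubled, h2, sub_self, norm_zero] at h1
    nlinarith [sq_nonneg ‖z.2 - a‖]
  have hC11 : ∀ z ∈ K, C11At Φ z := by
    intro z hz
    have h1 : C11At (fun z : E × E => w z.1) z := by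
      have := C11At.comp_affine (u := w) (A := ContinuousLinearMap.fst ℝ E E) (a := 0) (x := z)
        (by simpa using hw _ (hsub z hz.1).1)
      simpa using this
    have h2 : C11At (fun z : E × E => w z.2) z := by
      have := C11At.comp_affine (u := w) (A := ContinuousLinearMap.snd ℝ E E) (a := 0) (x := z)
        (by simpa using hw _ (hsub z hz.1).2)
      simpa using this
    have hn : ContDiffAt ℝ 2 (fun z : E × E => ‖z.1 - z.2‖) z :=
      ContDiffAt.norm ℝ (contDiffAt_fst.sub contDiffAt_snd) (hne z hz)
    have h3 : C11At (fun z : E × E => L * (‖z.1 - z.2‖ - ‖z.1 - z.2‖ ^ 2 / 4)) z :=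
      ContDiffAt.c11At (contDiffAt_const.mul (hn.sub ((hn.pow 2).div_const 4)))
    have h4 : C11At (fun z : E × E => 64 * (‖z.1 - a‖ ^ 2 + ‖z.2 - a‖ ^ 2)) z := by
      apply ContDiffAt.c11At
      exact contDiffAt_const.mul (((contDiffAt_fst.sub contDiffAt_const).norm_sq ℝ).add
        ((contDiffAt_snd.sub contDiffAt_const).norm_sq ℝ))
    exact ((h1.sub h2).sub h3).sub h4
  have hlt : ∀ z ∈ K, z ∉ interior K → Φ z < Φ z₀ := by
    intro z hz hzi
    by_contra! hge
    apply hzi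
    rw [mem_interior_iff_mem_nhds]
    have h1 : ∀ᶠ y in 𝓝 z, y ∈ closedBall (a, a) (1 / 4 : ℝ) :=
      mem_of_superset (isOpen_ball.mem_nhds (hKball z hz)) ball_subset_closedBall
    have h2 : ∀ᶠ y in 𝓝 z, Φ z₀ / 2 < Φ y :=
      (hcd z hz.1).eventually_const_lt (by linarith)
    filter_upwards [h1, h2] with y hy1 hy2
    exact ⟨hy1, hy2.le⟩
  have hQK : ∀ᵐ z ∂μ.prod μ, z ∈ K → Q z.1 ∧ Q z.2 := by
    filter_upwards [Measure.quasiMeasurePreserving_fst.ae hQ,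
      Measure.quasiMeasurePreserving_snd.ae hQ] with z h1 h2 hz
    exact ⟨h1 (hsub z hz.1).1, h2 (hsub z hz.1).2⟩
  obtain ⟨z, hzK, ⟨hq1, hq2⟩, p, hmax⟩ := exists_isLocalMax_sub_linear (μ.prod μ) hK hC11
    (x₀ := z₀) ⟨hz₀, by simp only [mem_preimage, mem_Ici]; linarith⟩ hlt hQK
  have hzK' := interior_subset hzK
  obtain ⟨X, Y, l, hX, hY, hl, hXY⟩ := hQ' _ (hsub z hzK'.1).1 _ (hsub z hzK'.1).2 hq1 hq2
  have hsd := hmax.secDiff_nonpos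
  have hcomp : ∀ b c : E, ∀ᶠ t in 𝓝[≠] (0 : ℝ), secDiff Φ z (t • b, t • c) ≤ 0 := by
    intro b c
    have h0 : Continuous fun t : ℝ => ((t • b, t • c) : E × E) := by fun_prop
    have h1 := h0.tendsto 0
    simp only [zero_smul] at h1
    exact (h1.mono_left nhdsWithin_le_nhds).eventually hsd
  have key : ∀ v : E, ∀ c : ℝ, (∀ᶠ t in 𝓝[≠] (0 : ℝ),
      secDiff w z.1 (t • v) - secDiff w z.2 (t • v) ≤ c * t ^ 2) → X v v - Y v v ≤ c := by
    intro v c h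
    refine le_of_tendsto ((hX.tendsto_secDiff v).sub (hY.tendsto_secDiff v)) ?_
    filter_upwards [h, self_mem_nhdsWithin] with t ht ht0
    have : 0 < t ^ 2 := by have : t ≠ 0 := ht0; positivity
    rwa [← sub_div, div_le_iff₀ this]
  have hdir1 : ∀ v : E, X v v - Y v v ≤ 256 * ‖v‖ ^ 2 := by
    intro v
    apply key
    filter_upwards [hcomp v v] with t ht
    have e1 := secDiff_norm_sq a z.1 (t • v)
    have e2 := secDiff_norm_sq a z.2 (t • v)
    simp only [secDiff, hΦ, doubled, Prod.fst_add, Prod.snd_add, Prod.fst_sub, Prod.snd_sub,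
      add_sub_add_right_eq_sub, sub_sub_sub_cancel_right] at ht e1 e2 ⊢
    have e3 : ‖t • v‖ ^ 2 = t ^ 2 * ‖v‖ ^ 2 := by rw [norm_smul, mul_pow, Real.norm_eq_abs, sq_abs]
    rw [e3] at e1 e2
    linarith
  set r := ‖z.1 - z.2‖ with hr
  have hrpos : 0 < r := norm_pos_iff.2 (hne z hzK')
  set e : E := r⁻¹ • (z.1 - z.2) with he
  have hee : ‖e‖ = 1 := by rw [he, norm_smul, norm_inv, Real.norm_eq_abs, abs_of_pos hrpos,
    ← hr, inv_mul_cancel₀ hrpos.ne']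
  have hre : r • e = z.1 - z.2 := by rw [he, smul_smul, mul_inv_cancel₀ hrpos.ne', one_smul]
  have hdir2 : X e e - Y e e ≤ 256 - 2 * L := by
    apply key
    have hsmall : ∀ᶠ t in 𝓝[≠] (0 : ℝ), |t| < r / 2 := by
      apply nhdsWithin_le_nhds
      have : ContinuousAt (fun t : ℝ => |t|) 0 := by fun_prop
      exact this.eventually_lt_const (by simpa using by positivity)
    filter_upwards [hcomp e (-e), hsmall] with t ht hts
    rw [abs_lt] at hts
    have e1 := secDiff_norm_sq a z.1 (t • e)
    have e2 := secDiff_norm_sq a z.2 (t • -e)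
    have e3 := secDiff_neg w z.2 (t • e)
    have n1 : ‖z.1 + t • e - (z.2 + t • -e)‖ = r + 2 * t := by
      have : z.1 + t • e - (z.2 + t • -e) = (r + 2 * t) • e := by
        rw [add_smul, hre]; module
      rw [this, norm_smul, hee, mul_one, Real.norm_eq_abs, abs_of_pos (by linarith)]
    have n2 : ‖z.1 - t • e - (z.2 - t • -e)‖ = r - 2 * t := by
      have : z.1 - t • e - (z.2 - t • -e) = (r - 2 * t) • e := by
        rw [sub_smul, hre]; module
      rw [this, norm_smul, hee, mul_one, Real.norm_eq_abs, abs_of_pos (by linarith)]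
    have n3 : ‖t • e‖ ^ 2 = t ^ 2 := by
      rw [norm_smul, mul_pow, Real.norm_eq_abs, sq_abs, hee]; ring
    have n4 : ‖t • -e‖ ^ 2 = t ^ 2 := by rw [smul_neg, norm_neg, n3]
    rw [n3] at e1
    rw [n4] at e2
    rw [← smul_neg] at e3
    simp only [secDiff, hΦ, doubled, Prod.fst_add, Prod.snd_add, Prod.fst_sub, Prod.snd_sub, n1, n2,
      ← hr] at ht e1 e2 e3 ⊢
    nlinarith
  have hsym : ∀ v w, ((256 : ℝ) • (idForm : E →L[ℝ] E →L[ℝ] ℝ) - (X - Y)) v w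
      = ((256 : ℝ) • (idForm : E →L[ℝ] E →L[ℝ] ℝ) - (X - Y)) w v := fun v w => by
    simp only [sub_apply, smul_apply, hX.1 v w, hY.1 v w, idForm_symm v w]
  have h1 := hl.lower ((256 : ℝ) • (idForm : E →L[ℝ] E →L[ℝ] ℝ) - (X - Y)) hsym (fun v => by
    simp only [sub_apply, smul_apply, idForm_self, smul_eq_mul]; linarith [hdir1 v]) e hee.le
  have h2 := hl.upper
  have h3 : 0 ≤ θ := by
    by_contra! h
    have := hl.nonneg (X := idForm) idForm_symm (fun v => by rw [idForm_self]; positivity)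
    nlinarith
  simp only [sub_apply, smul_apply, idForm_self, smul_eq_mul, functional_sub, map_smul, hee] at h1 hXY
  have h4 : θ * (2 * L) ≤ θ * (256 * 1 ^ 2 - (X e e - Y e e)) :=
    mul_le_mul_of_nonneg_left (by linarith) h3
  linarith

/-- Lipschitz estimate by doubling of variables. -/
theorem exists_lipschitz_const {θ Θ : ℝ} (hθ : 0 < θ) (hΘ : 0 ≤ Θ) : ∃ L : ℝ, 0 < L ∧
    ∀ (a : E) (R m κ : ℝ), 0 < R → 0 < m → κ * R ^ 2 ≤ m →
    ∀ w : E → ℝ, (∀ x ∈ ball a R, C11At w x) → (∀ x ∈ ball a R, |w x| ≤ m) →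
    ∀ Q : E → Prop, (∀ᵐ x ∂μ, x ∈ ball a R → Q x) →
    (∀ x ∈ ball a R, ∀ y ∈ ball a R, Q x → Q y → ∃ X Y l, HasHessAt w x X ∧
      HasHessAt w y Y ∧ IsElliptic θ Θ l ∧ -κ ≤ l (X - Y)) →
    ∀ x ∈ ball a (R / 2), ∀ y ∈ ball a (R / 2), |w x - w y| ≤ L * m / R * ‖x - y‖ := by
  set L := (256 * Θ + 2) / (2 * θ) with hLdef
  have hL0 : 0 < L := by positivity
  have hL : 256 * Θ + 1 < 2 * θ * L := by
    rw [hLdef, mul_div_cancel₀ _ (by positivity)]; linarith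
  refine ⟨L + 16, by positivity, ?_⟩
  intro a R m κ hR hm hκ w hw hb Q hQ hQ'
  set w' : E → ℝ := fun y => m⁻¹ * w (a + R • y) with hw'
  have hmem : ∀ y : E, ∀ s, y ∈ ball (0 : E) s → a + R • y ∈ ball a (R * s) := by
    intro y s hy
    rw [mem_ball, dist_eq_norm, add_sub_cancel_left, norm_smul, Real.norm_eq_abs, abs_of_pos hR]
    rw [mem_ball_zero_iff] at hy
    gcongr
  have hmem1 : ∀ y ∈ ball (0 : E) 1, a + R • y ∈ ball a R := fun y hy => by
    simpa using hmem y 1 hy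
  have main : ∀ x ∈ ball (0 : E) (1 / 2), ∀ y ∈ ball (0 : E) (1 / 2),
      w' x - w' y ≤ (L + 16) * ‖x - y‖ := by
    have hw1 : ∀ x ∈ ball (0 : E) 1, |w' x| ≤ 1 := by
      intro x hx
      rw [hw', abs_mul, abs_of_pos (inv_pos.2 hm), inv_mul_le_iff₀ hm, mul_one]
      exact hb _ (hmem1 x hx)
    intro x hx y hy
    rcases le_or_gt ‖x - y‖ (1 / 4) with hxy | hxy
    · have := doubled_nonpos μ hL0.le hL w' (fun x hx => by
          refine C11At.const_mul ?_ _
          exact C11At.comp_affine (A := R • ContinuousLinearMap.id ℝ E)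
            (by simpa using hw _ (hmem1 x hx)))
        hw1 (fun y => Q (a + R • y))
        (by
          filter_upwards [ae_comp_affine μ hQ a hR.ne'] with y hy hy'
          exact hy (hmem1 y hy'))
        (by
          intro x hx y hy hqx hqy
          obtain ⟨X, Y, l, hX, hY, hl, hXY⟩ := hQ' _ (hmem1 x hx) _ (hmem1 y hy) hqx hqy
          refine ⟨_, _, l, hX.comp_affine.const_mul m⁻¹, hY.comp_affine.const_mul m⁻¹, hl, ?_⟩
          have h0 : l (m⁻¹ • R ^ 2 • X - m⁻¹ • R ^ 2 • Y) = m⁻¹ * (R ^ 2 * l (X - Y)) := by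
            simp only [functional_sub, map_smul, smul_eq_mul]; ring
          rw [h0]
          have h1 : -m ≤ R ^ 2 * l (X - Y) := by
            nlinarith [mul_le_mul_of_nonneg_left hXY (sq_nonneg R)]
          calc (-1 : ℝ) = m⁻¹ * (-m) := by field_simp
            _ ≤ _ := by gcongr)
        x hx (x, y) (by
          rw [mem_closedBall, Prod.dist_eq]
          simp only [dist_self]
          rw [dist_comm, dist_eq_norm]
          exact max_le (by norm_num) hxy)
      simp only [doubled, sub_self, norm_zero] at this
      rw [norm_sub_rev y x] at this
      nlinarith [norm_nonneg (x - y), mul_nonneg hL0.le (sq_nonneg ‖x - y‖)]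
    · have h1 := (abs_le.1 (hw1 x (ball_subset_ball (by norm_num) hx))).2
      have h2 := (abs_le.1 (hw1 y (ball_subset_ball (by norm_num) hy))).1
      nlinarith
  have main' : ∀ x ∈ ball a (R / 2), ∀ y ∈ ball a (R / 2),
      w x - w y ≤ (L + 16) * m / R * ‖x - y‖ := by
    have hpre : ∀ x ∈ ball a (R / 2), R⁻¹ • (x - a) ∈ ball (0 : E) (1 / 2) := by
      intro x hx
      rw [mem_ball_zero_iff, norm_smul, norm_inv, Real.norm_eq_abs, abs_of_pos hR,
        inv_mul_lt_iff₀ hR]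
      rw [mem_ball, dist_eq_norm] at hx
      linarith
    have hback : ∀ x : E, a + R • R⁻¹ • (x - a) = x := by
      intro x
      rw [smul_smul, mul_inv_cancel₀ hR.ne', one_smul]; abel
    intro x hx y hy
    have := main _ (hpre x hx) _ (hpre y hy)
    simp only [hw', hback] at this
    rw [← smul_sub, norm_smul, norm_inv, Real.norm_eq_abs, abs_of_pos hR, ← mul_sub,
      inv_mul_le_iff₀ hm] at this
    have e : x - a - (y - a) = x - y := by abel
    rw [e] at this
    calc _ ≤ _ := this
      _ = _ := by field_simp
  intro x hx y hy
  refine abs_le.2 ⟨?_, main' x hx y hy⟩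
  have := main' y hy x hx
  rw [norm_sub_rev] at this
  linarith

end Doubling

theorem hasFDerivAt_functional_comp {E G : Type*} [NormedAddCommGroup E] [NormedSpace ℝ E]
    [NormedAddCommGroup G] [NormedSpace ℝ G] (l : G →L[ℝ] ℝ) (F : E → G) (F' : E →L[ℝ] G) (x : E)
    (h : HasFDerivAt F F' x) : HasFDerivAt (fun x => l (F x)) (l ∘L F') x :=
  l.hasFDerivAt.comp x h

section Smooth

variable {E : Type*} [NormedAddCommGroup E] [NormedSpace ℝ E]

theorem hasHessAt_of_contDiff {f : E → ℝ} (hf : ContDiff ℝ 2 f) (x : E) :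
    HasHessAt f x (fderiv ℝ (fderiv ℝ f) x) :=
  hasHessAt_of_differentiableAt_fderiv
    (Eventually.of_forall fun _ => hf.differentiable (by norm_num) _)
    ((hf.fderiv_right (m := 1) (by norm_num)).differentiable (by norm_num) _)

theorem fderiv_fderiv_apply {f : E → ℝ} (hf : ContDiff ℝ 2 f) (v x w : E) :
    fderiv ℝ (fun y => fderiv ℝ f y v) x w = fderiv ℝ (fderiv ℝ f) x w v := by
  have h := ((hf.fderiv_right (m := 1) (by norm_num)).differentiable (by norm_num) x).hasFDerivAt
  have h2 := (h.clm_apply (hasFDerivAt_const v x)).fderiv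
  rw [h2]
  simp

theorem contDiff_fderiv_apply {n m : WithTop ℕ∞} {f : E → ℝ} (hf : ContDiff ℝ n f)
    (hmn : m + 1 ≤ n) (v : E) : ContDiff ℝ m fun y => fderiv ℝ f y v :=
  (hf.fderiv_right hmn).clm_apply contDiff_const

theorem fderiv_fderiv_fderiv_apply {f : E → ℝ} (hf : ContDiff ℝ 3 f) (v x : E) :
    fderiv ℝ (fderiv ℝ (fun y => fderiv ℝ f y v)) x = fderiv ℝ (fderiv ℝ (fderiv ℝ f)) x v := by
  have hf2 : ContDiff ℝ 2 f := hf.of_le (by norm_num)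
  have e1 : fderiv ℝ (fun y => fderiv ℝ f y v) = fun y => fderiv ℝ (fderiv ℝ f) y v := by
    ext y w
    rw [fderiv_fderiv_apply hf2, (hasHessAt_of_contDiff hf2 y).1]
  have h1 : ContDiff ℝ 2 (fderiv ℝ f) := hf.fderiv_right (by norm_num)
  have h2 : ContDiff ℝ 1 (fderiv ℝ (fderiv ℝ f)) := h1.fderiv_right (by norm_num)
  have hs : ∀ a b, fderiv ℝ (fderiv ℝ (fderiv ℝ f)) x a b = fderiv ℝ (fderiv ℝ (fderiv ℝ f)) x b a :=
    second_derivative_symmetric (fun y => (h1.differentiable (by norm_num) y).hasFDerivAt)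
      (h2.differentiable (by norm_num) x).hasFDerivAt
  rw [e1]
  have h3 := ((h2.differentiable (by norm_num) x).hasFDerivAt.clm_apply
    (hasFDerivAt_const v x)).fderiv
  rw [h3]
  ext a b
  simp [hs a v]

end Smooth

section Polynomial

variable {E : Type*} [NormedAddCommGroup E] [InnerProductSpace ℝ E]

/-- The space of affine functions. -/
def affineFun (E : Type*) [NormedAddCommGroup E] [InnerProductSpace ℝ E] : Submodule ℝ (E → ℝ) :=
  LinearMap.range ({ toFun := fun p x => p.1 + p.2 x
                     map_add' := fun p q => by ext x; simp; ring
                     map_smul' := fun c p => by ext x; simp; ring } :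
    (ℝ × (E →L[ℝ] ℝ)) →ₗ[ℝ] (E → ℝ))

theorem mem_affineFun {f : E → ℝ} :
    f ∈ affineFun E ↔ ∃ (a : ℝ) (ℓ : E →L[ℝ] ℝ), f = fun x => a + ℓ x := by
  constructor
  · rintro ⟨⟨a, ℓ⟩, rfl⟩; exact ⟨a, ℓ, rfl⟩
  · rintro ⟨a, ℓ, rfl⟩; exact ⟨⟨a, ℓ⟩, rfl⟩

theorem const_mem_affineFun (c : ℝ) : (fun _ => c : E → ℝ) ∈ affineFun E :=
  mem_affineFun.2 ⟨c, 0, by simp⟩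

theorem affineFun_pow_mono {k j : ℕ} (h : k ≤ j) : affineFun E ^ k ≤ affineFun E ^ j :=
  pow_le_pow_right₀ (Submodule.one_le.2 (const_mem_affineFun 1)) h

theorem const_mem_affineFun_pow (c : ℝ) (k : ℕ) : (fun _ => c : E → ℝ) ∈ affineFun E ^ k := by
  refine affineFun_pow_mono (Nat.zero_le k) ?_
  rw [pow_zero]
  exact ⟨c, by ext; simp⟩

theorem analyticOnNhd_of_mem {k : ℕ} {f : E → ℝ} (hf : f ∈ affineFun E ^ k) :
    AnalyticOnNhd ℝ f univ := by
  induction k generalizing f with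
  | zero =>
    rw [pow_zero] at hf
    obtain ⟨c, rfl⟩ := hf
    have e : ((LinearMap.toSpanSingleton ℝ (E → ℝ) 1) c) = fun _ : E => c := by ext; simp
    rw [e]
    exact fun x _ => analyticAt_const
  | succ k ih =>
    rw [pow_succ] at hf
    induction hf using Submodule.mul_induction_on' with
    | mem_mul_mem m hm n hn =>
      obtain ⟨a, ℓ, rfl⟩ := mem_affineFun.1 hn
      exact (ih hm).mul (analyticOnNhd_const.add (ℓ.analyticOnNhd univ))
    | add x hx y hy hx' hy' => exact hx'.add hy'

theorem contDiff_of_mem {k : ℕ} {f : E → ℝ} (hf : f ∈ affineFun E ^ k) {n : WithTop ℕ∞} :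
    ContDiff ℝ n f := by
  rw [contDiff_iff_contDiffAt]
  exact fun x => (analyticOnNhd_of_mem hf x (mem_univ x)).contDiffAt

theorem fderiv_apply_mem {k : ℕ} {f : E → ℝ} (hf : f ∈ affineFun E ^ (k + 1)) (v : E) :
    (fun x => fderiv ℝ f x v) ∈ affineFun E ^ k := by
  have haff : ∀ n ∈ affineFun E, ∃ c : ℝ, (fun x => fderiv ℝ n x v) = fun _ => c := by
    intro n hn
    obtain ⟨a, ℓ, rfl⟩ := mem_affineFun.1 hn
    refine ⟨ℓ v, ?_⟩
    ext x
    rw [(ℓ.hasFDerivAt.const_add a).fderiv]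
  induction k generalizing f with
  | zero =>
    rw [zero_add, pow_one] at hf
    obtain ⟨c, hc⟩ := haff f hf
    rw [hc]
    exact const_mem_affineFun_pow c 0
  | succ k ih =>
    rw [pow_succ] at hf
    induction hf using Submodule.mul_induction_on' with
    | mem_mul_mem m hm n hn =>
      obtain ⟨c, hc⟩ := haff n hn
      have e : (fun x => fderiv ℝ (m * n) x v) = (fun x => fderiv ℝ m x v) * n + c • m := by
        ext x
        have h1 := ((contDiff_of_mem hm (n := 1)).differentiable (by norm_num) x).hasFDerivAt
        have h2 := ((contDiff_of_mem (k := 1) (by simpa using hn) (n := 1)).differentiable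
          (by norm_num) x).hasFDerivAt
        rw [(h1.mul h2).fderiv]
        have := congrFun hc x
        simp only [add_apply, smul_apply, smul_eq_mul, Pi.add_apply, Pi.mul_apply, Pi.smul_apply]
        rw [this]
        ring
      rw [e]
      refine add_mem ?_ (Submodule.smul_mem _ _ hm)
      rw [pow_succ]
      exact Submodule.mul_mem_mul (ih hm) hn
    | add x hx y hy hx' hy' =>
      have e : (fun z => fderiv ℝ (x + y) z v) = (fun z => fderiv ℝ x z v) + fun z => fderiv ℝ y z v := by
        ext z
        rw [fderiv_add ((contDiff_of_mem (k := k + 2) (by rwa [pow_succ]) (n := 1)).differentiable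
          (by norm_num) z) ((contDiff_of_mem (k := k + 2) (by rwa [pow_succ])
          (n := 1)).differentiable (by norm_num) z)]
        rfl
      rw [e]
      exact add_mem hx' hy'

variable [FiniteDimensional ℝ E]

theorem affineFun_pow_finite (k : ℕ) : Module.Finite ℝ (affineFun E ^ k : Submodule ℝ (E → ℝ)) := by
  have h : (affineFun E).FG := by
    unfold affineFun
    exact Module.Finite.iff_fg.1 inferInstance
  exact Module.Finite.iff_fg.2 (h.pow k)

theorem functional_eq_sum (l : (E →L[ℝ] E →L[ℝ] ℝ) →L[ℝ] ℝ) : ∃ (ι : Type) (_ : Fintype ι)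
    (b : ι → E) (c : ι → ι → ℝ), ∀ B : E →L[ℝ] E →L[ℝ] ℝ, l B = ∑ i, ∑ j, c i j * B (b i) (b j) := by
  let b := stdOrthonormalBasis ℝ E
  refine ⟨_, inferInstance, b, fun i j => l ((innerSL ℝ (b i)).smulRight (innerSL ℝ (b j))), ?_⟩
  intro B
  have h : B = ∑ i, ∑ j, (B (b i) (b j)) • (innerSL ℝ (b i)).smulRight (innerSL ℝ (b j)) := by
    ext v w
    conv_lhs => rw [← b.sum_repr v, ← b.sum_repr w]
    simp only [map_sum, sum_apply, map_smul, smul_apply, smul_eq_mul,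
      ContinuousLinearMap.smulRight_apply, innerSL_apply_apply, b.repr_apply_apply]
    simp only [Finset.mul_sum]
    rw [Finset.sum_comm]
    refine Finset.sum_congr rfl fun i _ => Finset.sum_congr rfl fun j _ => ?_
    ring
  conv_lhs => rw [h]
  simp only [map_sum, map_smul, smul_eq_mul]
  refine Finset.sum_congr rfl fun i _ => Finset.sum_congr rfl fun j _ => ?_
  ring

theorem functional_hessian_mem (l : (E →L[ℝ] E →L[ℝ] ℝ) →L[ℝ] ℝ) {k : ℕ} {f : E → ℝ}
    (hf : f ∈ affineFun E ^ (k + 2)) : (fun x => l (fderiv ℝ (fderiv ℝ f) x)) ∈ affineFun E ^ k := by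
  obtain ⟨ι, _, b, c, hl⟩ := functional_eq_sum l
  have : (fun x => l (fderiv ℝ (fderiv ℝ f) x)) =
      ∑ i, ∑ j, c i j • fun x => fderiv ℝ (fun y => fderiv ℝ f y (b j)) x (b i) := by
    ext x
    simp only [hl, Finset.sum_apply, Pi.smul_apply, smul_eq_mul,
      fderiv_fderiv_apply (contDiff_of_mem hf)]
  rw [this]
  refine sum_mem fun i _ => sum_mem fun j _ => Submodule.smul_mem _ _ ?_
  exact fderiv_apply_mem (fderiv_apply_mem hf (b j)) (b i)

omit [FiniteDimensional ℝ E] in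
theorem IsElliptic.theta_le [Nontrivial E] {θ Θ : ℝ} {l : (E →L[ℝ] E →L[ℝ] ℝ) →L[ℝ] ℝ}
    (hl : IsElliptic θ Θ l) : θ ≤ l idForm := by
  obtain ⟨e, he⟩ := exists_norm_eq E (zero_le_one' ℝ)
  have := hl.lower idForm idForm_symm (fun v => by rw [idForm_self]; positivity) e he.le
  simpa [idForm_self, he] using this

omit [FiniteDimensional ℝ E] in
theorem hasHessAt_norm_sq (a : E) (c : ℝ) (x : E) :
    HasHessAt (fun y => c * ‖y - a‖ ^ 2) x ((2 * c) • idForm) := by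
  have h := hasHessAt_quadPoly a 0 0 (B := (2 * c) • idForm)
    (fun v w => by simp only [smul_apply, idForm_symm v w]) x
  have e : quadPoly a 0 0 ((2 * c) • idForm) = fun y : E => c * ‖y - a‖ ^ 2 := by
    ext y
    simp only [quadPoly, smul_apply, idForm_self, smul_eq_mul, zero_apply]
    ring
  rwa [e] at h

/-- Maximum principle for linear elliptic operators with constant coefficients. -/
theorem nonpos_of_sphere [Nontrivial E] {θ Θ : ℝ} (hθ : 0 < θ)
    {l : (E →L[ℝ] E →L[ℝ] ℝ) →L[ℝ] ℝ} (hl : IsElliptic θ Θ l) {f : E → ℝ} (hf : ContDiff ℝ 2 f)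
    {R : ℝ} (hlf : ∀ x ∈ ball 0 R, 0 ≤ l (fderiv ℝ (fderiv ℝ f) x))
    (hs : ∀ x ∈ sphere (0 : E) R, f x ≤ 0) : ∀ x ∈ closedBall (0 : E) R, f x ≤ 0 := by
  have main : ∀ ε > 0, ∀ x ∈ closedBall (0 : E) R, f x + ε * ‖x‖ ^ 2 ≤ ε * R ^ 2 := by
    intro ε hε x hx
    obtain ⟨z, hz, hmax⟩ := (isCompact_closedBall (0 : E) R).exists_isMaxOn ⟨x, hx⟩
      (f := fun y => f y + ε * ‖y - 0‖ ^ 2) (by have := hf.continuous; fun_prop)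
    have hxz := hmax hx
    simp only [mem_ofPred_eq, sub_zero] at hxz
    refine hxz.trans ?_
    rcases (mem_closedBall_zero_iff.1 hz).lt_or_eq with hlt | heq
    · exfalso
      have hz' : z ∈ ball (0 : E) R := mem_ball_zero_iff.2 hlt
      have hm : IsLocalMax (fun y => f y + ε * ‖y - 0‖ ^ 2) z :=
        hmax.isLocalMax (mem_of_superset (isOpen_ball.mem_nhds hz') ball_subset_closedBall)
      have h1 := (hasHessAt_of_contDiff hf z).add (hasHessAt_norm_sq 0 ε z)
      have h2 := h1.nonpos_of_isLocalMax (p := 0) (by simpa using hm)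
      have h3 := hl.nonneg (X := -(fderiv ℝ (fderiv ℝ f) z + (2 * ε) • idForm))
        (fun v w => by rw [neg_apply, neg_apply, neg_apply, neg_apply, h1.1 v w])
        (fun v => by rw [neg_apply, neg_apply]; linarith [h2 v])
      rw [functional_neg, map_add, map_smul, smul_eq_mul] at h3
      have := hlf z hz'
      have := hl.theta_le
      nlinarith
    · have := hs z (mem_sphere_zero_iff_norm.2 heq)
      rw [heq]; linarith
  intro x hx
  refine le_of_forall_pos_le_add fun ε hε => ?_
  have h := main (ε / (R ^ 2 + 1)) (by positivity) x hx
  have h1 : ε / (R ^ 2 + 1) * R ^ 2 ≤ ε := by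
    rw [div_mul_eq_mul_div, div_le_iff₀ (by positivity)]; nlinarith [sq_nonneg R]
  have h2 : 0 ≤ ε / (R ^ 2 + 1) * ‖x‖ ^ 2 := by positivity
  linarith

theorem norm_sq_mem (R : ℝ) : (fun x : E => R ^ 2 - ‖x‖ ^ 2) ∈ affineFun E ^ 2 := by
  let b := stdOrthonormalBasis ℝ E
  have e : (fun x : E => R ^ 2 - ‖x‖ ^ 2) = (fun _ => R ^ 2) - ∑ i, (fun x => inner ℝ (b i) x) ^ 2 := by
    ext x
    simp only [Pi.sub_apply, Finset.sum_apply, Pi.pow_apply]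
    rw [b.sum_sq_inner_right]
  rw [e]
  refine sub_mem (const_mem_affineFun_pow _ _) (sum_mem fun i _ => Submodule.pow_mem_pow _ ?_ 2)
  exact mem_affineFun.2 ⟨0, innerSL ℝ (b i), by ext; simp⟩

/-- The Dirichlet problem with polynomial data. -/
theorem exists_poly_dirichlet [Nontrivial E] {θ Θ : ℝ} (hθ : 0 < θ)
    {l : (E →L[ℝ] E →L[ℝ] ℝ) →L[ℝ] ℝ} (hl : IsElliptic θ Θ l) {R : ℝ} (hR : 0 < R) {k : ℕ}
    {p : E → ℝ} (hp : p ∈ affineFun E ^ k) (c : ℝ) :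
    ∃ h : E → ℝ, ContDiff ℝ 4 h ∧ (∀ x, l (fderiv ℝ (fderiv ℝ h) x) = c) ∧
      ∀ x ∈ sphere (0 : E) R, h x = p x := by
  set g : E → ℝ := fun x => R ^ 2 - ‖x‖ ^ 2 with hg
  have hgq : ∀ q ∈ affineFun E ^ k, g * q ∈ affineFun E ^ (k + 2) := fun q hq => by
    rw [add_comm, pow_add]
    exact Submodule.mul_mem_mul (norm_sq_mem R) hq
  have hdd : ∀ {f : E → ℝ} {j : ℕ}, f ∈ affineFun E ^ j → Differentiable ℝ f ∧
      Differentiable ℝ (fderiv ℝ f) := fun hf =>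
    ⟨(contDiff_of_mem hf (n := 1)).differentiable (by norm_num),
      ((contDiff_of_mem hf (n := 2)).fderiv_right (m := 1) (by norm_num)).differentiable
        (by norm_num)⟩
  have hadd : ∀ {f₁ f₂ : E → ℝ} {j : ℕ}, f₁ ∈ affineFun E ^ j → f₂ ∈ affineFun E ^ j → ∀ x,
      l (fderiv ℝ (fderiv ℝ (f₁ + f₂)) x) =
        l (fderiv ℝ (fderiv ℝ f₁) x) + l (fderiv ℝ (fderiv ℝ f₂) x) := by
    intro f₁ f₂ j h₁ h₂ x
    have : fderiv ℝ (f₁ + f₂) = fderiv ℝ f₁ + fderiv ℝ f₂ := by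
      ext1 y; exact fderiv_add ((hdd h₁).1 y) ((hdd h₂).1 y)
    rw [this, fderiv_add ((hdd h₁).2 x) ((hdd h₂).2 x), map_add]
  have hsmul : ∀ (a : ℝ) {f : E → ℝ} {j : ℕ}, f ∈ affineFun E ^ j → ∀ x,
      l (fderiv ℝ (fderiv ℝ (a • f)) x) = a * l (fderiv ℝ (fderiv ℝ f) x) := by
    intro a f j hf x
    have : fderiv ℝ (a • f) = a • fderiv ℝ f := by
      ext1 y; exact fderiv_const_smul ((hdd hf).1 y) a
    rw [this, fderiv_const_smul ((hdd hf).2 x), map_smul, smul_eq_mul]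
  have := affineFun_pow_finite (E := E) k
  let T : (affineFun E ^ k : Submodule ℝ (E → ℝ)) →ₗ[ℝ] (affineFun E ^ k : Submodule ℝ (E → ℝ)) :=
    { toFun := fun q => ⟨fun x => l (fderiv ℝ (fderiv ℝ (g * q)) x),
        functional_hessian_mem l (hgq q q.2)⟩
      map_add' := fun q₁ q₂ => by
        ext x
        simp only [Submodule.coe_add, mul_add, Pi.add_apply]
        exact hadd (hgq _ q₁.2) (hgq _ q₂.2) x
      map_smul' := fun a q => by
        ext x
        simp only [Submodule.coe_smul, mul_smul_comm, RingHom.id_apply, Pi.smul_apply, smul_eq_mul]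
        exact hsmul a (hgq _ q.2) x }
  have hinj : Function.Injective T := by
    rw [injective_iff_map_eq_zero]
    intro q hq
    have hT : ∀ x, l (fderiv ℝ (fderiv ℝ (g * q)) x) = 0 := fun x =>
      congrFun (congrArg Subtype.val hq) x
    have hcd : ContDiff ℝ 2 (g * q : E → ℝ) := contDiff_of_mem (hgq q q.2)
    have hz : ∀ x ∈ sphere (0 : E) R, g x = 0 := by
      intro x hx
      rw [mem_sphere_zero_iff_norm] at hx
      simp [hg, hx]
    have h1 := nonpos_of_sphere hθ hl hcd (R := R) (fun x _ => (hT x).ge)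
      (fun x hx => by simp [hz x hx])
    have h2 := nonpos_of_sphere hθ hl (f := (-1 : ℝ) • (g * q : E → ℝ)) (contDiff_const.smul hcd) (R := R)
      (fun x _ => by rw [hsmul _ (hgq q q.2), hT]; simp) (fun x hx => by simp [hz x hx])
    have h3 : ∀ x ∈ ball (0 : E) R, (q : E → ℝ) x = 0 := by
      intro x hx
      have a1 := h1 x (ball_subset_closedBall hx)
      have a2 := h2 x (ball_subset_closedBall hx)
      simp only [Pi.smul_apply, Pi.mul_apply, smul_eq_mul] at a1 a2
      rw [mem_ball_zero_iff] at hx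
      have : 0 < g x := by
        have := pow_lt_pow_left₀ hx (norm_nonneg x) (n := 2) (by norm_num)
        simp only [hg]; linarith
      have : g x * (q : E → ℝ) x = 0 := by linarith
      rcases mul_eq_zero.1 this with h | h
      · linarith
      · exact h
    ext x
    refine congrFun ((analyticOnNhd_of_mem q.2).eq_of_eventuallyEq (z₀ := 0)
      (analyticOnNhd_const (v := (0 : ℝ))) ?_) x
    exact eventually_of_mem (ball_mem_nhds _ hR) h3
  obtain ⟨q, hq⟩ := (LinearMap.injective_iff_surjective.1 hinj)
    (⟨fun x => l (fderiv ℝ (fderiv ℝ p) x), functional_hessian_mem l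
      (affineFun_pow_mono (by omega) hp)⟩ - ⟨fun _ => c, const_mem_affineFun_pow c k⟩)
  have hq' : ∀ x, l (fderiv ℝ (fderiv ℝ (g * q)) x) = l (fderiv ℝ (fderiv ℝ p) x) - c := fun x =>
    congrFun (congrArg Subtype.val hq) x
  have hp2 : p ∈ affineFun E ^ (k + 2) := affineFun_pow_mono (by omega) hp
  refine ⟨p + (-1 : ℝ) • (g * q), ?_, ?_, ?_⟩
  · exact contDiff_of_mem (add_mem hp2 (Submodule.smul_mem _ _ (hgq q q.2)))
  · intro x
    rw [hadd hp2 (Submodule.smul_mem _ _ (hgq q q.2)), hsmul _ (hgq q q.2), hq']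
    ring
  · intro x hx
    rw [mem_sphere_zero_iff_norm] at hx
    simp [hg, hx]

/-- Polynomials are dense in the continuous functions on a sphere. -/
theorem exists_poly_near (R : ℝ) {w : E → ℝ} (hw : ContinuousOn w (sphere 0 R)) {η : ℝ}
    (hη : 0 < η) : ∃ (k : ℕ) (p : E → ℝ), p ∈ affineFun E ^ k ∧
      ∀ x ∈ sphere (0 : E) R, |p x - w x| ≤ η := by
  let A : Subalgebra ℝ C(sphere (0 : E) R, ℝ) :=
    { carrier := {f | ∃ (k : ℕ) (p : E → ℝ), p ∈ affineFun E ^ k ∧ ∀ x, f x = p x}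
      mul_mem' := by
        rintro f g ⟨k, p, hp, hfp⟩ ⟨j, q, hq, hgq⟩
        exact ⟨k + j, p * q, by rw [pow_add]; exact Submodule.mul_mem_mul hp hq,
          fun x => by simp [hfp, hgq]⟩
      add_mem' := by
        rintro f g ⟨k, p, hp, hfp⟩ ⟨j, q, hq, hgq⟩
        exact ⟨max k j, p + q, add_mem (affineFun_pow_mono (le_max_left _ _) hp)
          (affineFun_pow_mono (le_max_right _ _) hq), fun x => by simp [hfp, hgq]⟩
      algebraMap_mem' := fun r => ⟨0, _, const_mem_affineFun_pow r 0, fun x => rfl⟩ }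
  have hA : A.SeparatesPoints := by
    intro x y hxy
    refine ⟨_, ⟨⟨fun z => inner ℝ (x - y : E) z, by fun_prop⟩, ⟨1, fun z => inner ℝ (x - y : E) z,
      ?_, fun _ => rfl⟩, rfl⟩, ?_⟩
    · rw [pow_one]
      exact mem_affineFun.2 ⟨0, innerSL ℝ (x - y : E), by ext; simp [inner_sub_left]⟩
    · intro h
      apply hxy
      have h' : inner ℝ (x - y : E) (x - y : E) = (0 : ℝ) := by
        rw [inner_sub_right]; exact sub_eq_zero.2 h
      exact Subtype.ext (sub_eq_zero.1 (inner_self_eq_zero.1 h'))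
  obtain ⟨⟨g, k, p, hp, hgp⟩, hg⟩ :=
    ContinuousMap.exists_mem_subalgebra_near_continuous_of_separatesPoints A hA
      (fun x => w x) (continuousOn_iff_continuous_domRestrict.1 hw) η hη
  refine ⟨k, p, hp, fun x hx => ?_⟩
  have := hg ⟨x, hx⟩
  rw [← hgp ⟨x, hx⟩]
  exact this.le

end Polynomial

section Interior

variable {E : Type*} [NormedAddCommGroup E] [InnerProductSpace ℝ E]
  [FiniteDimensional ℝ E] [MeasurableSpace E] [BorelSpace E]
  (μ : Measure E) [μ.IsAddHaarMeasure]

omit [FiniteDimensional ℝ E] [MeasurableSpace E] [BorelSpace E] in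
theorem fderiv_apply_le {f : E → ℝ} {U : Set E} (hU : IsOpen U)
    (hf : Differentiable ℝ f) {C : ℝ} (hC : 0 ≤ C) (h : ∀ x ∈ U, ∀ y ∈ U, |f x - f y| ≤ C * ‖x - y‖)
    {x v : E} (hx : x ∈ U) (hv : ‖v‖ ≤ 1) : |fderiv ℝ f x v| ≤ C := by
  have h1 : ‖fderiv ℝ f x‖ ≤ C := by
    refine (hf x).hasFDerivAt.le_of_lip' hC ?_
    filter_upwards [hU.mem_nhds hx] with y hy
    exact h y hy x hx
  calc |fderiv ℝ f x v| ≤ ‖fderiv ℝ f x‖ * ‖v‖ := (fderiv ℝ f x).le_opNorm v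
    _ ≤ C * 1 := by gcongr
    _ = C := mul_one C

omit [FiniteDimensional ℝ E] [MeasurableSpace E] [BorelSpace E] in
/-- Taylor's formula for functions with a Lipschitz second derivative. -/
theorem taylor_of_hessian_le {h : E → ℝ} (hd1 : Differentiable ℝ h)
    (hd2 : Differentiable ℝ (fderiv ℝ h)) {C r : ℝ} (hC : 0 ≤ C)
    (hs : ∀ v w, fderiv ℝ (fderiv ℝ h) 0 v w = fderiv ℝ (fderiv ℝ h) 0 w v)
    (hb : ∀ x ∈ ball (0 : E) r, ‖fderiv ℝ (fderiv ℝ h) x - fderiv ℝ (fderiv ℝ h) 0‖ ≤ C * ‖x‖) :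
    ∀ x ∈ ball (0 : E) r,
      |h x - quadPoly 0 (h 0) (fderiv ℝ h 0) (fderiv ℝ (fderiv ℝ h) 0) x| ≤ C * ‖x‖ ^ 3 := by
  set B := fderiv ℝ (fderiv ℝ h) 0 with hB
  have h1 : ∀ x ∈ ball (0 : E) r, ‖fderiv ℝ h x - fderiv ℝ h 0 - B x‖ ≤ C * ‖x‖ ^ 2 := by
    intro x hx
    have hsub : closedBall (0 : E) ‖x‖ ⊆ ball 0 r := by
      intro y hy
      rw [mem_closedBall_zero_iff] at hy
      rw [mem_ball_zero_iff] at hx ⊢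
      exact hy.trans_lt hx
    have := (convex_closedBall (0 : E) ‖x‖).norm_image_sub_le_of_norm_hasFDerivWithin_le
      (f := fun y => fderiv ℝ h y - fderiv ℝ h 0 - B y)
      (f' := fun y => fderiv ℝ (fderiv ℝ h) y - B) (C := C * ‖x‖) (x := 0) (y := x)
      (fun y _ => (((hd2 y).hasFDerivAt.sub_const _).sub B.hasFDerivAt).hasFDerivWithinAt)
      (fun y hy => (hb y (hsub hy)).trans (by
        rw [mem_closedBall_zero_iff] at hy; gcongr)) (by simp) (by simp)
    simp only [map_zero, sub_self, sub_zero] at this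
    linarith [mul_assoc C ‖x‖ ‖x‖, sq ‖x‖]
  intro x hx
  have hsub : closedBall (0 : E) ‖x‖ ⊆ ball 0 r := by
    intro y hy
    rw [mem_closedBall_zero_iff] at hy
    rw [mem_ball_zero_iff] at hx ⊢
    exact hy.trans_lt hx
  have hq : ∀ y, HasFDerivAt (quadPoly 0 (h 0) (fderiv ℝ h 0) B) (fderiv ℝ h 0 + B y) y := by
    intro y
    have e1 : HasFDerivAt (fun y : E => y - 0) (ContinuousLinearMap.id ℝ E) y :=
      (hasFDerivAt_id y).sub_const 0
    have e3 := (((fderiv ℝ h 0).hasFDerivAt.comp y e1).const_add (h 0)).add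
      (((B.hasFDerivAt.comp y e1).clm_apply e1).const_mul (1 / 2 : ℝ))
    refine e3.congr_fderiv ?_
    ext w
    simp
    rw [hs w y]
    ring
  have := (convex_closedBall (0 : E) ‖x‖).norm_image_sub_le_of_norm_hasFDerivWithin_le
    (f := fun y => h y - quadPoly 0 (h 0) (fderiv ℝ h 0) B y)
    (f' := fun y => fderiv ℝ h y - (fderiv ℝ h 0 + B y)) (C := C * ‖x‖ ^ 2) (x := 0) (y := x)
    (fun y _ => ((hd1 y).hasFDerivAt.sub (hq y)).hasFDerivWithinAt)
    (fun y hy => by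
      rw [← sub_sub]
      refine (h1 y (hsub hy)).trans ?_
      rw [mem_closedBall_zero_iff] at hy; gcongr) (by simp) (by simp)
  have h0 : h 0 - quadPoly 0 (h 0) (fderiv ℝ h 0) B 0 = 0 := by simp [quadPoly]
  rw [h0, sub_zero, sub_zero, Real.norm_eq_abs] at this
  linarith [mul_assoc C (‖x‖ ^ 2) ‖x‖, pow_succ ‖x‖ 2]

include μ in
/-- The third order Taylor estimate for solutions of linear equations with constant
coefficients. -/
theorem exists_taylor_const {θ Θ : ℝ} (hθ : 0 < θ) (hΘ : 0 ≤ Θ) {R : ℝ} (hR : 0 < R) :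
    ∃ C : ℝ, 0 < C ∧ ∀ l : (E →L[ℝ] E →L[ℝ] ℝ) →L[ℝ] ℝ, IsElliptic θ Θ l → ∀ (h : E → ℝ) (c : ℝ),
      ContDiff ℝ 4 h → (∀ x, l (fderiv ℝ (fderiv ℝ h) x) = c) → (∀ x ∈ ball (0 : E) R, |h x| ≤ 2) →
      ∀ x ∈ ball (0 : E) (R / 8),
        |h x - quadPoly 0 (h 0) (fderiv ℝ h 0) (fderiv ℝ (fderiv ℝ h) 0) x| ≤ C * ‖x‖ ^ 3 := by
  obtain ⟨L, hL, hlip⟩ := exists_lipschitz_const μ hθ hΘ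
  set m₁ := L * 2 / R with hm₁
  set m₂ := L * m₁ / (R / 2) with hm₂
  set C := L * m₂ / (R / 2 / 2) with hC
  have hm₁0 : 0 < m₁ := by positivity
  have hm₂0 : 0 < m₂ := by positivity
  have hC0 : 0 < C := by positivity
  refine ⟨C, hC0, ?_⟩
  intro l hl h c hh hlh hb
  have hstep : ∀ (f : E → ℝ) (c r m : ℝ), ContDiff ℝ 2 f → 0 < r → 0 < m →
      (∀ x, l (fderiv ℝ (fderiv ℝ f) x) = c) → (∀ x ∈ ball (0 : E) r, |f x| ≤ m) →
      ∀ x ∈ ball (0 : E) (r / 2), ∀ y ∈ ball (0 : E) (r / 2), |f x - f y| ≤ L * m / r * ‖x - y‖ := by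
    intro f c r m hf hr hm hlf hfb
    refine hlip 0 r m 0 hr hm (by simpa using hm.le) f (fun x _ => hf.contDiffAt.c11At) hfb
      (fun _ => True) (by simp) ?_
    intro x _ y _ _ _
    refine ⟨_, _, l, hasHessAt_of_contDiff hf x, hasHessAt_of_contDiff hf y, hl, ?_⟩
    rw [functional_sub, hlf, hlf]; simp
  have h2 : ContDiff ℝ 2 h := hh.of_le (by norm_num)
  have hd1 : Differentiable ℝ h := h2.differentiable (by norm_num)
  have h3 : ContDiff ℝ 3 h := hh.of_le (by norm_num)
  have hd2 : Differentiable ℝ (fderiv ℝ h) :=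
    (h2.fderiv_right (m := 1) (by norm_num)).differentiable (by norm_num)
  have s1 := hstep h c R 2 h2 hR (by norm_num) hlh hb
  have hlD : ∀ (f : E → ℝ) (c : ℝ), ContDiff ℝ 3 f → (∀ x, l (fderiv ℝ (fderiv ℝ f) x) = c) →
      ∀ v x, l (fderiv ℝ (fderiv ℝ (fun y => fderiv ℝ f y v)) x) = 0 := by
    intro f c hf hlf v x
    rw [fderiv_fderiv_fderiv_apply hf]
    have hd3 : Differentiable ℝ (fderiv ℝ (fderiv ℝ f)) :=
      ((hf.fderiv_right (m := 2) (by norm_num)).fderiv_right (m := 1) (by norm_num)).differentiable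
        (by norm_num)
    have e1 : HasFDerivAt (fun x => l (fderiv ℝ (fderiv ℝ f) x))
        (l.comp (fderiv ℝ (fderiv ℝ (fderiv ℝ f)) x)) x := by
      have := hasFDerivAt_functional_comp (G := E →L[ℝ] E →L[ℝ] ℝ) l (fderiv ℝ (fderiv ℝ f))
        (fderiv ℝ (fderiv ℝ (fderiv ℝ f)) x) x (hd3 x).hasFDerivAt
      exact this
    have e2 : (fun x => l (fderiv ℝ (fderiv ℝ f) x)) = fun _ => c := funext hlf
    rw [e2] at e1
    have := e1.unique (hasFDerivAt_const c x)
    exact DFunLike.congr_fun this v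
  have s2 : ∀ v : E, ‖v‖ ≤ 1 → ∀ x ∈ ball (0 : E) (R / 2 / 2), ∀ y ∈ ball (0 : E) (R / 2 / 2),
      |fderiv ℝ h x v - fderiv ℝ h y v| ≤ m₂ * ‖x - y‖ := by
    intro v hv
    refine hstep (fun y => fderiv ℝ h y v) 0 (R / 2) m₁ (contDiff_fderiv_apply h3 (by norm_num) v)
      (by positivity) hm₁0 (hlD h c h3 hlh v) ?_
    exact fun x hx => fderiv_apply_le isOpen_ball hd1 hm₁0.le s1 hx hv
  have s3 : ∀ v : E, ‖v‖ ≤ 1 → ∀ w : E, ‖w‖ ≤ 1 → ∀ x ∈ ball (0 : E) (R / 8),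
      |fderiv ℝ (fderiv ℝ h) x w v - fderiv ℝ (fderiv ℝ h) 0 w v| ≤ C * ‖x‖ := by
    intro v hv w hw x hx
    have hv3 : ContDiff ℝ 3 (fun y => fderiv ℝ h y v) := contDiff_fderiv_apply hh (by norm_num) v
    have := hstep (fun y => fderiv ℝ (fun z => fderiv ℝ h z v) y w) 0 (R / 2 / 2) m₂
      (contDiff_fderiv_apply hv3 (by norm_num) w) (by positivity) hm₂0
      (hlD _ 0 hv3 (hlD h c h3 hlh v) w)
      (fun x hx => fderiv_apply_le isOpen_ball (hv3.differentiable (by norm_num)) hm₂0.le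
        (s2 v hv) hx hw) x
      (by rw [show R / 2 / 2 / 2 = R / 8 by ring]; exact hx) 0 (by simp; positivity)
    simpa only [fderiv_fderiv_apply h2, sub_zero] using this
  refine taylor_of_hessian_le hd1 hd2 hC0.le (hasHessAt_of_contDiff h2 0).1 fun x hx => ?_
  have s4 : ∀ v w : E, |(fderiv ℝ (fderiv ℝ h) x - fderiv ℝ (fderiv ℝ h) 0) w v|
      ≤ C * ‖x‖ * ‖w‖ * ‖v‖ := by
    intro v w
    rcases eq_or_ne v 0 with rfl | hv
    · simp
    rcases eq_or_ne w 0 with rfl | hw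
    · simp
    have hv' := norm_pos_iff.2 hv
    have hw' := norm_pos_iff.2 hw
    have := s3 (‖v‖⁻¹ • v) (by rw [norm_smul, norm_inv, norm_norm, inv_mul_cancel₀ hv'.ne'])
      (‖w‖⁻¹ • w) (by rw [norm_smul, norm_inv, norm_norm, inv_mul_cancel₀ hw'.ne']) x hx
    simp only [map_smul, smul_apply, smul_eq_mul] at this
    rw [← mul_sub, ← mul_sub, abs_mul, abs_mul, abs_inv, abs_inv, abs_norm, abs_norm,
      inv_mul_le_iff₀ hv', inv_mul_le_iff₀ hw'] at this
    simp only [sub_apply]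
    linarith [mul_comm (‖w‖) (‖v‖ * (C * ‖x‖)), mul_comm ‖v‖ (C * ‖x‖),
      mul_assoc (C * ‖x‖) ‖w‖ ‖v‖, mul_assoc (C * ‖x‖) ‖v‖ ‖w‖, mul_comm ‖v‖ ‖w‖]
  exact ContinuousLinearMap.opNorm_le_bound₂ _ (by positivity) fun w v => s4 v w

end Interior

section Contact

variable {E : Type*} [NormedAddCommGroup E] [InnerProductSpace ℝ E]

theorem norm_le_of_diag {A : E →L[ℝ] E →L[ℝ] ℝ} (hA : ∀ v w, A v w = A w v) {c : ℝ} (hc : 0 ≤ c)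
    (h : ∀ v, |A v v| ≤ c * ‖v‖ ^ 2) : ‖A‖ ≤ c := by
  have key : ∀ v w : E, ‖v‖ = 1 → ‖w‖ = 1 → |A v w| ≤ c := by
    intro v w hv hw
    have h1 := abs_le.1 (h (v + w))
    have h2 := abs_le.1 (h (v - w))
    have h3 := parallelogram_law_with_norm ℝ v w
    simp only [map_add, add_apply, map_sub, sub_apply, hv, hw] at h1 h2 h3
    rw [hA w v] at h1 h2
    have h4 : ‖v + w‖ ^ 2 + ‖v - w‖ ^ 2 = 4 := by nlinarith
    rw [abs_le]
    constructor <;> nlinarith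
  refine ContinuousLinearMap.opNorm_le_bound₂ _ hc fun v w => ?_
  rcases eq_or_ne v 0 with rfl | hv
  · simp
  rcases eq_or_ne w 0 with rfl | hw
  · simp
  have hv' := norm_pos_iff.2 hv
  have hw' := norm_pos_iff.2 hw
  have := key (‖v‖⁻¹ • v) (‖w‖⁻¹ • w)
    (by rw [norm_smul, norm_inv, norm_norm, inv_mul_cancel₀ hv'.ne'])
    (by rw [norm_smul, norm_inv, norm_norm, inv_mul_cancel₀ hw'.ne'])
  simp only [map_smul, smul_apply, smul_eq_mul] at this
  rw [abs_mul, abs_mul, abs_inv, abs_inv, abs_norm, abs_norm, inv_mul_le_iff₀ hw',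
    inv_mul_le_iff₀ hv'] at this
  rw [Real.norm_eq_abs]
  linarith [mul_comm ‖v‖ (‖w‖ * c), mul_comm ‖w‖ c, mul_right_comm c ‖v‖ ‖w‖]

omit [InnerProductSpace ℝ E] in
theorem tendstoUniformly_of_lipschitz {ι : Type*} {𝓕 : Filter ι} {K : Set E} (hK : IsCompact K)
    {w : ι → E → ℝ} {w' : E → ℝ} {L : ℝ} (hL : 0 ≤ L)
    (hw : ∀ k, ∀ x ∈ K, ∀ y ∈ K, |w k x - w k y| ≤ L * ‖x - y‖)
    (hw' : ∀ x ∈ K, ∀ y ∈ K, |w' x - w' y| ≤ L * ‖x - y‖)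
    (h : ∀ x ∈ K, Tendsto (fun k => w k x) 𝓕 (𝓝 (w' x))) {η : ℝ} (hη : 0 < η) :
    ∀ᶠ k in 𝓕, ∀ x ∈ K, |w k x - w' x| < η := by
  have hr : 0 < η / (3 * (L + 1)) := by positivity
  obtain ⟨t, htK, htf, hcov⟩ := hK.finite_cover_balls hr
  have : ∀ᶠ k in 𝓕, ∀ z ∈ t, |w k z - w' z| < η / 3 := by
    refine (eventually_all_finite htf).2 fun z hz => ?_
    have := (h z (htK hz)).eventually (ball_mem_nhds _ (show (0 : ℝ) < η / 3 by positivity))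
    filter_upwards [this] with k hk
    rwa [Real.dist_eq] at hk
  filter_upwards [this] with k hk x hx
  obtain ⟨z, hz, hxz⟩ := mem_iUnion₂.1 (hcov hx)
  rw [mem_ball, dist_eq_norm] at hxz
  have h1 := abs_le.1 (hw k x hx z (htK hz))
  have h2 := abs_le.1 (hw' x hx z (htK hz))
  have h3 := abs_lt.1 (hk z hz)
  have h4 : L * ‖x - z‖ ≤ η / 3 := by
    calc L * ‖x - z‖ ≤ (L + 1) * (η / (3 * (L + 1))) := by gcongr; linarith
      _ = η / 3 := by field_simp
  rw [abs_lt]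
  constructor <;> linarith [h1.1, h1.2, h2.1, h2.2, h3.1, h3.2]

variable [FiniteDimensional ℝ E] [MeasurableSpace E] [BorelSpace E]
variable (μ : Measure E) [μ.IsAddHaarMeasure]

include μ in
theorem exists_contact {w ψ : E → ℝ} {a : E} {s : ℝ} (hs : s ≠ 0)
    (hw : ∀ y ∈ closedBall a s, C11At w y) (hψ : ∀ y ∈ closedBall a s, C11At ψ y)
    {x₁ : E} (hx₁ : x₁ ∈ closedBall a s)
    (hlt : ∀ y ∈ sphere a s, w y - ψ y < w x₁ - ψ x₁) {Q : E → Prop}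
    (hQ : ∀ᵐ y ∂μ, y ∈ closedBall a s → Q y) :
    ∃ y ∈ ball a s, Q y ∧ ∀ X Y, HasHessAt w y X → HasHessAt ψ y Y → ∀ v, X v v ≤ Y v v := by
  obtain ⟨y, hy, hQy, p, hp⟩ := exists_isLocalMax_sub_linear μ (isCompact_closedBall a s)
    (φ := fun y => w y - ψ y) (fun y hy => (hw y hy).sub (hψ y hy)) hx₁ (fun y hy hy' => by
      refine hlt y ?_
      rw [interior_closedBall _ hs] at hy'
      rw [mem_closedBall] at hy
      rw [mem_ball, not_lt] at hy'
      exact le_antisymm hy hy') hQ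
  rw [interior_closedBall _ hs] at hy
  refine ⟨y, hy, hQy, fun X Y hX hY v => ?_⟩
  have := (hX.sub hY).nonpos_of_isLocalMax hp v
  simpa using this

end Contact

theorem exists_linearize {G : Type*} [NormedAddCommGroup G] [NormedSpace ℝ G]
    {F : G → ℝ} {F' : G →L[ℝ] ℝ} {A : G} (h : HasStrictFDerivAt F F' A) {P : G → Prop}
    (hP : ∀ᶠ y in 𝓝 A, P y) (M : ℝ) {ε : ℝ} (hε : 0 < ε) :
    ∃ r > 0, ∀ A' : G, ‖A' - A‖ < r → ∀ δ : ℝ, 0 < δ → δ < r → ∀ H : G, ‖H‖ ≤ M →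
      |F (A' + δ • H) - F A' - δ * F' H| ≤ ε * δ ∧ P (A' + δ • H) := by
  have hM : 0 < |M| + 1 := by positivity
  obtain ⟨r₁, hr₁, h1⟩ :=
    Metric.eventually_nhds_iff.1 (h.isLittleO.def (show 0 < ε / (|M| + 1) by positivity))
  obtain ⟨r₂, hr₂, h2⟩ := Metric.eventually_nhds_iff.1 hP
  set r := min r₁ r₂ / (|M| + 2) with hr
  have hM2 : 0 < |M| + 2 := by positivity
  have hr0 : 0 < r := by positivity
  have hr3 : r * (|M| + 2) = min r₁ r₂ := by rw [hr]; field_simp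
  refine ⟨r, hr0, ?_⟩
  intro A' hA'r δ hδ hδr H hHM
  have hδH : ‖δ • H‖ ≤ r * |M| := by
    rw [norm_smul, Real.norm_eq_abs, abs_of_pos hδ]
    exact mul_le_mul hδr.le (hHM.trans (le_abs_self M)) (norm_nonneg H) hr0.le
  have hd1 : dist A' A < min r₁ r₂ := by
    rw [dist_eq_norm]
    have := mul_nonneg hr0.le (abs_nonneg M)
    linarith
  have hd2 : dist (A' + δ • H) A < min r₁ r₂ := by
    rw [dist_eq_norm, add_sub_right_comm]
    have := norm_add_le (A' - A) (δ • H)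
    linarith
  refine ⟨?_, h2 (hd2.trans_le (min_le_right _ _))⟩
  have := @h1 (A' + δ • H, A') (by
    rw [Prod.dist_eq]
    exact (max_lt hd2 hd1).trans_le (min_le_left _ _))
  simp only [add_sub_cancel_left, map_smul, smul_eq_mul] at this
  refine this.trans ?_
  rw [norm_smul, Real.norm_eq_abs, abs_of_pos hδ]
  calc ε / (|M| + 1) * (δ * ‖H‖) ≤ ε / (|M| + 1) * (δ * (|M| + 1)) := by
        gcongr; linarith [le_abs_self M]
    _ = ε * δ := by field_simp

section Operator

variable {E : Type*} [NormedAddCommGroup E] [InnerProductSpace ℝ E]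

/-- A uniformly elliptic concave operator `F`, on a compact set of admissible Hessians. -/
structure ConcaveOperator (F : (E →L[ℝ] E →L[ℝ] ℝ) → ℝ) (Adm : Set (E →L[ℝ] E →L[ℝ] ℝ))
    (l : (E →L[ℝ] E →L[ℝ] ℝ) → (E →L[ℝ] E →L[ℝ] ℝ) →L[ℝ] ℝ) (θ Θ Λ : ℝ) : Prop where
  theta_pos : 0 < θ
  Theta_nonneg : 0 ≤ Θ
  Lambda_nonneg : 0 ≤ Λ
  isCompact : IsCompact Adm
  symm : ∀ A ∈ Adm, ∀ v w, A v w = A w v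
  norm_le : ∀ A ∈ Adm, ‖A‖ ≤ Λ
  hasStrictFDerivAt : ∀ A ∈ Adm, HasStrictFDerivAt F (l A) A
  concave : ∀ A ∈ Adm, ∀ B ∈ Adm, F B - F A ≤ l A (B - A)
  elliptic : ∀ A ∈ Adm, IsElliptic θ Θ (l A)
  mono : ∀ A ∈ Adm, ∀ᶠ B in 𝓝 A, (∀ v w, B v w = B w v) → ∀ C ∈ Adm,
    ((∀ v, C v v ≤ B v v) → F C ≤ F B) ∧ ((∀ v, B v v ≤ C v v) → F B ≤ F C)
  mem_of_between : ∀ B₁ ∈ Adm, ∀ B₂ ∈ Adm, F B₁ = F B₂ → ∀ B : E →L[ℝ] E →L[ℝ] ℝ,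
    (∀ v w, B v w = B w v) → (∀ v, B₁ v v ≤ B v v) → (∀ v, B v v ≤ B₂ v v) →
    B ∈ Adm ∧ F B = F B₁

variable [MeasurableSpace E]

/-- `u` is a `C^{1,1}` function on `ball x r` solving `F (D² u) = φ` almost everywhere. -/
structure Sol (F : (E →L[ℝ] E →L[ℝ] ℝ) → ℝ) (Adm : Set (E →L[ℝ] E →L[ℝ] ℝ)) (Λ : ℝ)
    (μ : Measure E) (u φ : E → ℝ) (x : E) (r : ℝ) : Prop where
  diff : ∀ y ∈ ball x r, DifferentiableAt ℝ u y
  lip : ∀ y ∈ ball x r, ∀ z ∈ ball x r, ‖fderiv ℝ u y - fderiv ℝ u z‖ ≤ Λ * ‖y - z‖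
  ae : ∀ᵐ y ∂μ, y ∈ ball x r → ∃ B ∈ Adm, HasHessAt u y B ∧ F B = φ y

variable {F : (E →L[ℝ] E →L[ℝ] ℝ) → ℝ} {Adm : Set (E →L[ℝ] E →L[ℝ] ℝ)}
  {l : (E →L[ℝ] E →L[ℝ] ℝ) → (E →L[ℝ] E →L[ℝ] ℝ) →L[ℝ] ℝ} {θ Θ Λ : ℝ} {μ : Measure E}

theorem Sol.c11At {u φ : E → ℝ} {x : E} {r : ℝ} (h : Sol F Adm Λ μ u φ x r) {y : E}
    (hy : y ∈ ball x r) : C11At u y := by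
  refine ⟨ball x r, isOpen_ball.mem_nhds hy, h.diff, Real.toNNReal Λ, ?_⟩
  refine LipschitzOnWith.of_dist_le_mul fun y hy z hz => ?_
  rw [dist_eq_norm, dist_eq_norm]
  refine (h.lip y hy z hz).trans ?_
  gcongr
  exact Real.le_coe_toNNReal Λ

theorem Sol.mono {u φ : E → ℝ} {x y : E} {r s : ℝ} (h : Sol F Adm Λ μ u φ x r)
    (hs : ball y s ⊆ ball x r) : Sol F Adm Λ μ u φ y s :=
  ⟨fun z hz => h.diff z (hs hz), fun z hz z' hz' => h.lip z (hs hz) z' (hs hz'),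
    h.ae.mono fun _ H hz => H (hs hz)⟩

omit [MeasurableSpace E] in
theorem ConcaveOperator.linearize (O : ConcaveOperator F Adm l θ Θ Λ)
    {A : E →L[ℝ] E →L[ℝ] ℝ} (hA : A ∈ Adm) (M : ℝ) {ε : ℝ} (hε : 0 < ε) :
    ∃ r > 0, ∀ A' : E →L[ℝ] E →L[ℝ] ℝ, (∀ v w, A' v w = A' w v) → ‖A' - A‖ < r →
      ∀ δ, 0 < δ → δ < r → ∀ H : E →L[ℝ] E →L[ℝ] ℝ, (∀ v w, H v w = H w v) → ‖H‖ ≤ M →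
      ∀ C ∈ Adm, ((∀ v, C v v ≤ (A' + δ • H) v v) → F C ≤ F A' + δ * l A H + ε * δ) ∧
        ((∀ v, (A' + δ • H) v v ≤ C v v) → F A' + δ * l A H - ε * δ ≤ F C) := by
  obtain ⟨r, hr, h⟩ := exists_linearize (G := E →L[ℝ] E →L[ℝ] ℝ)
    (O.hasStrictFDerivAt A hA) (O.mono A hA) M hε
  refine ⟨r, hr, ?_⟩
  intro A' hA' hA'r δ hδ hδr H hH hHM C hC
  obtain ⟨h3, h4⟩ := h A' hA'r δ hδ hδr H hHM
  have h4 := h4 (fun v w => by simp [hA' v w, hH v w]) C hC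
  have h5 := abs_le.1 h3
  exact ⟨fun h => by linarith [h4.1 h, h5.1, h5.2], fun h => by linarith [h4.2 h, h5.1, h5.2]⟩

end Operator

section Improvement

variable {E : Type*} [NormedAddCommGroup E] [InnerProductSpace ℝ E]
variable [FiniteDimensional ℝ E] [MeasurableSpace E] [BorelSpace E]
variable {F : (E →L[ℝ] E →L[ℝ] ℝ) → ℝ} {Adm : Set (E →L[ℝ] E →L[ℝ] ℝ)}
  {l : (E →L[ℝ] E →L[ℝ] ℝ) → (E →L[ℝ] E →L[ℝ] ℝ) →L[ℝ] ℝ} {θ Θ Λ : ℝ} {μ : Measure E}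
  [μ.IsAddHaarMeasure]

theorem Sol.exists_contact_above {u φ ψ : E → ℝ} {x a x₁ : E} {r s : ℝ}
    (h : Sol F Adm Λ μ u φ x r) (hs : s ≠ 0) (hsub : closedBall a s ⊆ ball x r)
    (hψ : ∀ y ∈ closedBall a s, C11At ψ y) (hx₁ : x₁ ∈ closedBall a s)
    (hlt : ∀ y ∈ sphere a s, u y - ψ y < u x₁ - ψ x₁) :
    ∃ y ∈ ball a s, ∃ B ∈ Adm, HasHessAt u y B ∧ F B = φ y ∧
      ∀ Y, HasHessAt ψ y Y → ∀ v, B v v ≤ Y v v := by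
  obtain ⟨y, hy, ⟨B, hB, hBu, hBφ⟩, H⟩ := exists_contact μ hs (fun y hy => h.c11At (hsub hy)) hψ hx₁
    hlt (h.ae.mono fun y hy hy' => hy (hsub hy'))
  exact ⟨y, hy, B, hB, hBu, hBφ, fun Y hY => H B Y hBu hY⟩

theorem Sol.exists_contact_below {u φ ψ : E → ℝ} {x a x₁ : E} {r s : ℝ}
    (h : Sol F Adm Λ μ u φ x r) (hs : s ≠ 0) (hsub : closedBall a s ⊆ ball x r)
    (hψ : ∀ y ∈ closedBall a s, C11At ψ y) (hx₁ : x₁ ∈ closedBall a s)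
    (hlt : ∀ y ∈ sphere a s, ψ y - u y < ψ x₁ - u x₁) :
    ∃ y ∈ ball a s, ∃ B ∈ Adm, HasHessAt u y B ∧ F B = φ y ∧
      ∀ Y, HasHessAt ψ y Y → ∀ v, Y v v ≤ B v v := by
  obtain ⟨y, hy, ⟨B, hB, hBu, hBφ⟩, H⟩ := exists_contact μ hs hψ (fun y hy => h.c11At (hsub hy)) hx₁
    hlt (h.ae.mono fun y hy hy' => hy (hsub hy'))
  exact ⟨y, hy, B, hB, hBu, hBφ, fun Y hY => H Y B hY hBu⟩

omit [FiniteDimensional ℝ E] [MeasurableSpace E] [BorelSpace E] in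
theorem contDiff_const_mul_norm_sq (c : ℝ) (a : E) {n : WithTop ℕ∞} :
    ContDiff ℝ n fun y : E => c * ‖y - a‖ ^ 2 :=
  contDiff_const.mul ((contDiff_id.sub contDiff_const).norm_sq ℝ)

theorem Sol.exists_near_quadPoly {u φ : E → ℝ} {x : E} {r : ℝ} (h : Sol F Adm Λ μ u φ x r) (hr : 0 < r)
    {a : ℝ} {ℓ : E →L[ℝ] ℝ} {A : E →L[ℝ] E →L[ℝ] ℝ} (hA : ∀ v w, A v w = A w v) {δ : ℝ} (hδ : 0 < δ)
    (hu : ∀ y ∈ ball x r, |u y - quadPoly x a ℓ A y| ≤ δ * r ^ 2) :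
    (∃ y ∈ ball x r, ∃ B ∈ Adm, F B = φ y ∧ ∀ v, B v v ≤ A v v + 18 * δ * ‖v‖ ^ 2) ∧
    ∃ y ∈ ball x r, ∃ B ∈ Adm, F B = φ y ∧ ∀ v, A v v - 18 * δ * ‖v‖ ^ 2 ≤ B v v := by
  have hsub : closedBall x (r / 2) ⊆ ball x r := closedBall_subset_ball (by linarith)
  have hx : x ∈ closedBall x (r / 2) := mem_closedBall_self (by linarith)
  have hC : ∀ c : ℝ, ∀ y ∈ closedBall x (r / 2),
      C11At (fun y => quadPoly x a ℓ A y + c * ‖y - x‖ ^ 2) y := fun c y _ =>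
    ((contDiff_quadPoly x a ℓ A).add (contDiff_const_mul_norm_sq c x)).contDiffAt.c11At
  have hH : ∀ (c : ℝ) (y : E), HasHessAt (fun y => quadPoly x a ℓ A y + c * ‖y - x‖ ^ 2) y
      (A + (2 * c) • idForm) := fun c y =>
    (hasHessAt_quadPoly x a ℓ hA y).add (hasHessAt_norm_sq x c y)
  have h0 := abs_le.1 (hu x (hsub hx))
  have hrδ : 0 < δ * r ^ 2 := by positivity
  constructor
  · obtain ⟨y, hy, B, hB, -, hF, H⟩ := h.exists_contact_above (by positivity) hsub (hC (9 * δ)) hx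
      (fun y hy => by
        have h1 := abs_le.1 (hu y (hsub (sphere_subset_closedBall hy)))
        rw [mem_sphere, dist_eq_norm] at hy
        rw [hy, sub_self, norm_zero]
        nlinarith)
    refine ⟨y, hsub (ball_subset_closedBall hy), B, hB, hF, fun v => ?_⟩
    have := H _ (hH _ y) v
    simp only [add_apply, smul_apply, smul_eq_mul, idForm_self] at this
    linarith
  · obtain ⟨y, hy, B, hB, -, hF, H⟩ := h.exists_contact_below (by positivity) hsub (hC (-(9 * δ))) hx
      (fun y hy => by
        have h1 := abs_le.1 (hu y (hsub (sphere_subset_closedBall hy)))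
        rw [mem_sphere, dist_eq_norm] at hy
        rw [hy, sub_self, norm_zero]
        nlinarith)
    refine ⟨y, hsub (ball_subset_closedBall hy), B, hB, hF, fun v => ?_⟩
    have := H _ (hH _ y) v
    simp only [add_apply, smul_apply, smul_eq_mul, idForm_self] at this
    linarith

theorem Sol.norm_hessian_le (O : ConcaveOperator F Adm l θ Θ Λ) {u φ : E → ℝ} {x : E} {r : ℝ}
    (h : Sol F Adm Λ μ u φ x r) (hr : 0 < r)
    {a : ℝ} {ℓ : E →L[ℝ] ℝ} {A : E →L[ℝ] E →L[ℝ] ℝ} (hA : ∀ v w, A v w = A w v) {δ : ℝ} (hδ : 0 < δ)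
    (hu : ∀ y ∈ ball x r, |u y - quadPoly x a ℓ A y| ≤ δ * r ^ 2) : ‖A‖ ≤ Λ + 18 * δ := by
  obtain ⟨⟨y, -, B, hB, -, H⟩, y', -, B', hB', -, H'⟩ := h.exists_near_quadPoly hr hA hδ hu
  refine norm_le_of_diag hA (by linarith [O.Lambda_nonneg]) fun v => ?_
  have h1 := abs_le.1 (bilin_le_norm B v)
  have h2 := abs_le.1 (bilin_le_norm B' v)
  have h3 := mul_le_mul_of_nonneg_right (O.norm_le B hB) (sq_nonneg ‖v‖)
  have h4 := mul_le_mul_of_nonneg_right (O.norm_le B' hB') (sq_nonneg ‖v‖)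
  rw [abs_le]
  constructor <;> linarith [H v, H' v]

variable (μ) in
theorem Sol.lipschitz (O : ConcaveOperator F Adm l θ Θ Λ) : ∃ L : ℝ, 0 < L ∧
    ∀ (u φ : E → ℝ) (φ₀ : ℝ), Sol F Adm Λ μ u φ 0 1 → ∀ (a : ℝ) (ℓ : E →L[ℝ] ℝ)
    (A : E →L[ℝ] E →L[ℝ] ℝ), (∀ v w, A v w = A w v) → ∀ δ, 0 < δ →
    (∀ y ∈ ball 0 1, |φ y - φ₀| ≤ δ) → (∀ y ∈ ball 0 1, |u y - quadPoly 0 a ℓ A y| ≤ δ) →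
    ∀ x ∈ ball (0 : E) (1 / 2), ∀ y ∈ ball (0 : E) (1 / 2),
      |δ⁻¹ * (u x - quadPoly 0 a ℓ A x) - δ⁻¹ * (u y - quadPoly 0 a ℓ A y)| ≤ L * ‖x - y‖ := by
  obtain ⟨L, hL, H⟩ := exists_lipschitz_const μ O.theta_pos O.Theta_nonneg
  refine ⟨L * 2 / 1, by positivity, ?_⟩
  intro u φ φ₀ hu a ℓ A hA δ hδ hφ hq
  refine H 0 1 2 2 one_pos two_pos (by norm_num) (fun x => δ⁻¹ * (u x - quadPoly 0 a ℓ A x))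
    (fun x hx => ((hu.c11At hx).sub (contDiff_quadPoly 0 a ℓ A).contDiffAt.c11At).const_mul _)
    (fun x hx => ?_) _ hu.ae ?_
  · rw [abs_mul, abs_inv, abs_of_pos hδ, inv_mul_le_iff₀ hδ]
    linarith [hq x hx]
  · rintro x hx y hy ⟨B, hB, hBu, hBφ⟩ ⟨B', hB', hBu', hBφ'⟩
    refine ⟨_, _, l B', (hBu.sub (hasHessAt_quadPoly 0 a ℓ hA x)).const_mul δ⁻¹,
      (hBu'.sub (hasHessAt_quadPoly 0 a ℓ hA y)).const_mul δ⁻¹, O.elliptic B' hB', ?_⟩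
    have e : δ⁻¹ • (B - A) - δ⁻¹ • (B' - A) = δ⁻¹ • (B - B') := by
      ext v w
      simp only [sub_apply, smul_apply, smul_eq_mul]
      ring
    rw [e, map_smul, smul_eq_mul]
    have h1 := O.concave B' hB' B hB
    have h2 := abs_le.1 (hφ x hx)
    have h3 := abs_le.1 (hφ y hy)
    have h4 : -(2 * δ) ≤ l B' (B - B') := by linarith
    have h5 : δ⁻¹ * (-(2 * δ)) = -2 := by field_simp
    rw [← h5]
    exact mul_le_mul_of_nonneg_left h4 (by positivity)

end Improvement

theorem exists_ultralimit {ι G : Type*} [TopologicalSpace G] {K : Set G} (hK : IsCompact K)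
    (𝒰 : Ultrafilter ι) {f : ι → G} (hf : ∀ k, f k ∈ K) : ∃ x ∈ K, Tendsto f 𝒰 (𝓝 x) := by
  obtain ⟨x, hx, h⟩ := hK.ultrafilter_le_nhds (𝒰.map f) (by
    rw [le_principal_iff, Ultrafilter.mem_coe, Ultrafilter.mem_map]
    exact univ_mem' hf)
  exact ⟨x, hx, h⟩

theorem exists_ultralimit_of_norm_le {ι G : Type*} [NormedAddCommGroup G] [NormedSpace ℝ G]
    [FiniteDimensional ℝ G] (𝒰 : Ultrafilter ι) {f : ι → G} {M : ℝ} (hf : ∀ k, ‖f k‖ ≤ M) :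
    ∃ x, ‖x‖ ≤ M ∧ Tendsto f 𝒰 (𝓝 x) := by
  have : ProperSpace G := FiniteDimensional.proper ℝ G
  obtain ⟨x, hx, h⟩ := exists_ultralimit (isCompact_closedBall (0 : G) M) 𝒰 (f := f)
    (fun k => by simpa using hf k)
  exact ⟨x, by simpa using hx, h⟩

theorem tendsto_bilin_apply {E : Type*} [NormedAddCommGroup E] [NormedSpace ℝ E] {ι : Type*}
    {𝓕 : Filter ι} {f : ι → E →L[ℝ] E →L[ℝ] ℝ}
    {A : E →L[ℝ] E →L[ℝ] ℝ} (h : Tendsto f 𝓕 (𝓝 A)) (v w : E) :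
    Tendsto (fun k => f k v w) 𝓕 (𝓝 (A v w)) := by
  have h1 : Continuous fun B : E →L[ℝ] E →L[ℝ] ℝ => B v w := by fun_prop
  exact (h1.tendsto A).comp h

theorem exists_hessian_bound {E : Type*} [NormedAddCommGroup E] [NormedSpace ℝ E] {h : E → ℝ}
    (hh : ContDiff ℝ 2 h) {K : Set E} (hK : IsCompact K) :
    ∃ M, ∀ x ∈ K, ‖fderiv ℝ (fderiv ℝ h) x‖ ≤ M :=
  hK.exists_bound_of_continuousOn
    ((hh.fderiv_right (m := 1) (by norm_num)).continuous_fderiv (by norm_num)).continuousOn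

theorem norm_add_smul_le {G : Type*} [NormedAddCommGroup G] [NormedSpace ℝ G] {A B : G} {s M N : ℝ}
    (hA : ‖A‖ ≤ M) (hB : ‖B‖ ≤ N) : ‖A + s • B‖ ≤ M + |s| * N := by
  refine (norm_add_le _ _).trans (add_le_add hA ?_)
  rw [norm_smul, Real.norm_eq_abs]
  gcongr

section Improvement

variable {E : Type*} [NormedAddCommGroup E] [InnerProductSpace ℝ E]

variable [FiniteDimensional ℝ E] [MeasurableSpace E] [BorelSpace E]
variable {F : (E →L[ℝ] E →L[ℝ] ℝ) → ℝ} {Adm : Set (E →L[ℝ] E →L[ℝ] ℝ)}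
  {l : (E →L[ℝ] E →L[ℝ] ℝ) → (E →L[ℝ] E →L[ℝ] ℝ) →L[ℝ] ℝ} {θ Θ Λ : ℝ} (μ : Measure E)
  [μ.IsAddHaarMeasure]

omit [FiniteDimensional ℝ E] [MeasurableSpace E] [BorelSpace E] in
theorem ConcaveOperator.tendsto (O : ConcaveOperator F Adm l θ Θ Λ) {ι : Type*} {𝓕 : Filter ι}
    {f : ι → E →L[ℝ] E →L[ℝ] ℝ} {A : E →L[ℝ] E →L[ℝ] ℝ} (hA : A ∈ Adm)
    (h : Tendsto f 𝓕 (𝓝 A)) : Tendsto (fun k => F (f k)) 𝓕 (𝓝 (F A)) :=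
  (O.hasStrictFDerivAt A hA).continuousAt.tendsto.comp h

theorem ConcaveOperator.exists_abs_sub_le (O : ConcaveOperator F Adm l θ Θ Λ)
    {A₀ : E →L[ℝ] E →L[ℝ] ℝ} (hA₀ : A₀ ∈ Adm) :
    ∃ r > 0, ∀ (u φ : E → ℝ) (φ₀ a : ℝ) (ℓ : E →L[ℝ] ℝ) (A : E →L[ℝ] E →L[ℝ] ℝ) (δ : ℝ),
      (∀ v w, A v w = A w v) → ‖A - A₀‖ < r → 0 < δ → δ < r → Sol F Adm Λ μ u φ 0 1 →
      (∀ y ∈ ball 0 1, |φ y - φ₀| ≤ δ) → (∀ y ∈ ball 0 1, |u y - quadPoly 0 a ℓ A y| ≤ δ) →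
      |φ₀ - F A| ≤ (18 * Θ + 2) * δ := by
  obtain ⟨r₁, hr₁, h₁⟩ := O.linearize hA₀ ‖(18 : ℝ) • (idForm : E →L[ℝ] E →L[ℝ] ℝ)‖ one_pos
  obtain ⟨r₂, hr₂, h₂⟩ := O.linearize hA₀ ‖(-18 : ℝ) • (idForm : E →L[ℝ] E →L[ℝ] ℝ)‖ one_pos
  refine ⟨min r₁ r₂, lt_min hr₁ hr₂, ?_⟩
  intro u φ φ₀ a ℓ A δ hA hAr hδ hδr hu hφ hq
  obtain ⟨⟨y, hy, B, hB, hBφ, H⟩, y', hy', B', hB', hBφ', H'⟩ := hu.exists_near_quadPoly one_pos hA hδ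
    (a := a) (ℓ := ℓ) (by simpa using hq)
  have hup := (O.elliptic A₀ hA₀).upper
  have e₁ := (h₁ A hA (hAr.trans_le (min_le_left _ _)) δ hδ (hδr.trans_le (min_le_left _ _))
    _ (fun v w => by simp [idForm_symm v w]) le_rfl B hB).1 (fun v => by
      have := H v
      simp only [add_apply, smul_apply, smul_eq_mul, idForm_self]
      linarith)
  have e₂ := (h₂ A hA (hAr.trans_le (min_le_right _ _)) δ hδ (hδr.trans_le (min_le_right _ _))
    _ (fun v w => by simp [idForm_symm v w]) le_rfl B' hB').2 (fun v => by
      have := H' v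
      simp only [add_apply, smul_apply, smul_eq_mul, idForm_self]
      linarith)
  have f₁ := abs_le.1 (hφ y hy)
  have f₂ := abs_le.1 (hφ y' hy')
  have f₃ := mul_le_mul_of_nonneg_left hup hδ.le
  rw [map_smul, smul_eq_mul] at e₁ e₂
  rw [abs_le]
  constructor <;> linarith

theorem ConcaveOperator.exists_close_to_linear [Nontrivial E] (O : ConcaveOperator F Adm l θ Θ Λ)
    {A₀ : E →L[ℝ] E →L[ℝ] ℝ} (hA₀ : A₀ ∈ Adm) {h : E → ℝ} (hh : ContDiff ℝ 4 h) {c : ℝ}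
    (hhc : ∀ x, l A₀ (fderiv ℝ (fderiv ℝ h) x) = c) {η : ℝ} (hη : 0 < η) {R : ℝ} (hR : 0 < R)
    (hR1 : R < 1) :
    ∃ r > 0, ∀ (u φ : E → ℝ) (φ₀ a : ℝ) (ℓ : E →L[ℝ] ℝ) (A : E →L[ℝ] E →L[ℝ] ℝ) (δ : ℝ),
      (∀ v w, A v w = A w v) → ‖A - A₀‖ < r → 0 < δ → δ < r → Sol F Adm Λ μ u φ 0 1 →
      (∀ y ∈ ball 0 1, |φ y - φ₀| ≤ r * δ) → |φ₀ - F A - δ * c| ≤ r * δ →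
      (∀ y ∈ sphere 0 R, |δ⁻¹ * (u y - quadPoly 0 a ℓ A y) - h y| ≤ 2 * η) →
      ∀ y ∈ closedBall 0 R, |δ⁻¹ * (u y - quadPoly 0 a ℓ A y) - h y| ≤ 3 * η := by
  have hh2 : ContDiff ℝ 2 h := hh.of_le (by norm_num)
  obtain ⟨M, hM⟩ := exists_hessian_bound hh2 (isCompact_closedBall (0 : E) R)
  have hθ := O.theta_pos
  set M' := M + |2 * η| * ‖(idForm : E →L[ℝ] E →L[ℝ] ℝ)‖ with hM'
  obtain ⟨r, hr, H⟩ := O.linearize hA₀ M' (show 0 < η * θ / 2 by positivity)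
  refine ⟨min r (η * θ / 4), lt_min hr (by positivity), ?_⟩
  intro u φ φ₀ a ℓ A δ hA hAr hδ hδr hu hφ hc hs
  have hsub : closedBall (0 : E) R ⊆ ball 0 1 := closedBall_subset_ball hR1
  have hl := (O.elliptic A₀ hA₀).theta_le
  have hrη := min_le_right r (η * θ / 4)
  have hAr' := hAr.trans_le (min_le_left _ _)
  have hδr' := hδr.trans_le (min_le_left _ _)
  have hc' := abs_le.1 hc
  have hlη := mul_le_mul_of_nonneg_left hl hη.le
  have hηθδ : 0 < η * θ * δ := by positivity
  have hmin : min r (η * θ / 4) * δ ≤ η * θ / 4 * δ := by gcongr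
  have hlδ := mul_le_mul_of_nonneg_left hlη hδ.le
  have hψ : ∀ (s : ℝ) (y : E), C11At
      (fun y => quadPoly 0 a ℓ A y + δ * (h y + s * ‖y - 0‖ ^ 2)) y := fun s y =>
    ((contDiff_quadPoly 0 a ℓ A).add (contDiff_const.mul
      (hh2.add (contDiff_const_mul_norm_sq s 0)))).contDiffAt.c11At
  have hψH : ∀ (s : ℝ) (y : E), HasHessAt
      (fun y => quadPoly 0 a ℓ A y + δ * (h y + s * ‖y - 0‖ ^ 2)) y
      (A + δ • (fderiv ℝ (fderiv ℝ h) y + (2 * s) • idForm)) := fun s y =>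
    (hasHessAt_quadPoly 0 a ℓ hA y).add
      (((hasHessAt_of_contDiff hh2 y).add (hasHessAt_norm_sq 0 s y)).const_mul δ)
  have hsym : ∀ (s : ℝ) (y v w : E), (fderiv ℝ (fderiv ℝ h) y + (2 * s) • idForm : E →L[ℝ] E →L[ℝ] ℝ) v w =
      (fderiv ℝ (fderiv ℝ h) y + (2 * s) • idForm : E →L[ℝ] E →L[ℝ] ℝ) w v := fun s y v w => by
    simp [idForm_symm v w, (hasHessAt_of_contDiff hh2 y).1 v w]
  have hsq : ∀ y : E, u y - quadPoly 0 a ℓ A y = δ * (δ⁻¹ * (u y - quadPoly 0 a ℓ A y)) := fun y => by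
    field_simp
  intro x₁ hx₁
  have hx₁R : ‖x₁ - 0‖ ^ 2 ≤ R ^ 2 := by
    rw [mem_closedBall, dist_eq_norm] at hx₁
    gcongr
  have hR2 : R ^ 2 < 1 := by nlinarith
  rw [abs_le]
  constructor
  · by_contra! hcon
    obtain ⟨y, hy, B, hB, -, hBφ, HB⟩ := hu.exists_contact_below hR.ne' hsub (fun y _ => hψ η y)
      hx₁ (fun y hy => by
        have h1 := abs_le.1 (hs y hy)
        rw [mem_sphere, dist_eq_norm] at hy
        have e1 := hsq y
        have e2 := hsq x₁
        rw [hy]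
        have : 0 < δ * ((h x₁ + η * ‖x₁ - 0‖ ^ 2 - δ⁻¹ * (u x₁ - quadPoly 0 a ℓ A x₁)) -
            (h y + η * R ^ 2 - δ⁻¹ * (u y - quadPoly 0 a ℓ A y))) := by
          refine mul_pos hδ ?_
          nlinarith [mul_le_mul_of_nonneg_left hx₁R hη.le]
        linarith)
    have hy' := ball_subset_closedBall hy
    have e := (H A hA hAr' δ hδ hδr' _ (hsym η y) 
      (norm_add_smul_le (G := E →L[ℝ] E →L[ℝ] ℝ) (hM y hy') le_rfl) B hB).2 (HB _ (hψH η y))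
    rw [map_add, hhc, map_smul, smul_eq_mul] at e
    have h2 := abs_le.1 (hφ y (hsub hy'))
    nlinarith
  · by_contra! hcon
    obtain ⟨y, hy, B, hB, -, hBφ, HB⟩ := hu.exists_contact_above hR.ne' hsub (fun y _ => hψ (-η) y)
      hx₁ (fun y hy => by
        have h1 := abs_le.1 (hs y hy)
        rw [mem_sphere, dist_eq_norm] at hy
        have e1 := hsq y
        have e2 := hsq x₁
        rw [hy]
        have : 0 < δ * ((δ⁻¹ * (u x₁ - quadPoly 0 a ℓ A x₁) - (h x₁ + -η * ‖x₁ - 0‖ ^ 2)) -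
            (δ⁻¹ * (u y - quadPoly 0 a ℓ A y) - (h y + -η * R ^ 2))) := by
          refine mul_pos hδ ?_
          nlinarith [mul_le_mul_of_nonneg_left hx₁R hη.le]
        linarith)
    have hy' := ball_subset_closedBall hy
    have e := (H A hA hAr' δ hδ hδr' _ (hsym (-η) y) (by
      have := norm_add_smul_le (G := E →L[ℝ] E →L[ℝ] ℝ) (s := 2 * -η) (B := idForm) (hM y hy') le_rfl
      rwa [mul_neg, abs_neg, ← mul_neg] at this) B hB).1 (HB _ (hψH (-η) y))
    rw [map_add, hhc, map_smul, smul_eq_mul] at e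
    have h2 := abs_le.1 (hφ y (hsub hy'))
    nlinarith

end Improvement

section Improvement

variable {E : Type*} [NormedAddCommGroup E] [InnerProductSpace ℝ E]
variable [FiniteDimensional ℝ E] [MeasurableSpace E] [BorelSpace E]
variable {F : (E →L[ℝ] E →L[ℝ] ℝ) → ℝ} {Adm : Set (E →L[ℝ] E →L[ℝ] ℝ)}
  {l : (E →L[ℝ] E →L[ℝ] ℝ) → (E →L[ℝ] E →L[ℝ] ℝ) →L[ℝ] ℝ} {θ Θ Λ : ℝ} (μ : Measure E)
  [μ.IsAddHaarMeasure]

omit [MeasurableSpace E] [BorelSpace E] in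
/-- Limits of approximating quadratic polynomials of almost solutions are admissible. -/
theorem ConcaveOperator.exists_tendsto_of_near (O : ConcaveOperator F Adm l θ Θ Λ)
    (𝒰 : Ultrafilter ℕ) (h𝒰 : (𝒰 : Filter ℕ) ≤ atTop) {A B B' : ℕ → E →L[ℝ] E →L[ℝ] ℝ} {δ : ℕ → ℝ}
    (hδ : Tendsto δ atTop (𝓝 0)) (hA : ∀ k v w, A k v w = A k w v)
    (hB : ∀ k, B k ∈ Adm) (hB' : ∀ k, B' k ∈ Adm)
    (h : ∀ k v, B k v v ≤ A k v v + 18 * δ k * ‖v‖ ^ 2)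
    (h' : ∀ k v, A k v v - 18 * δ k * ‖v‖ ^ 2 ≤ B' k v v)
    (hF : Tendsto (fun k => F (B k) - F (B' k)) 𝒰 (𝓝 0)) {M : ℝ} (hM : ∀ k, ‖A k‖ ≤ M) :
    ∃ A₀ ∈ Adm, Tendsto A 𝒰 (𝓝 A₀) ∧ Tendsto (fun k => F (B k)) 𝒰 (𝓝 (F A₀)) := by
  obtain ⟨A₀, -, hA₀⟩ := exists_ultralimit_of_norm_le (G := E →L[ℝ] E →L[ℝ] ℝ) 𝒰 hM
  obtain ⟨B₀, hB₀, hBt⟩ := exists_ultralimit O.isCompact 𝒰 hB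
  obtain ⟨B₁, hB₁, hBt'⟩ := exists_ultralimit O.isCompact 𝒰 hB'
  have hA₀s : ∀ v w, A₀ v w = A₀ w v := fun v w =>
    tendsto_nhds_unique (tendsto_bilin_apply hA₀ v w)
      ((tendsto_bilin_apply hA₀ w v).congr fun k => (hA k v w).symm)
  have hF1 := O.tendsto hB₀ hBt
  have hF2 := O.tendsto hB₁ hBt'
  have hF3 : F B₀ = F B₁ := sub_eq_zero.1 (tendsto_nhds_unique (hF1.sub hF2) hF)
  have hδ𝒰 := hδ.mono_left h𝒰
  have hv : ∀ v : E, Tendsto (fun k => 18 * δ k * ‖v‖ ^ 2) 𝒰 (𝓝 0) := fun v => by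
    simpa using (hδ𝒰.const_mul 18).mul_const (‖v‖ ^ 2)
  have := O.mem_of_between B₀ hB₀ B₁ hB₁ hF3 A₀ hA₀s
    (fun v => le_of_tendsto_of_tendsto' (tendsto_bilin_apply hBt v v)
      (by simpa using (tendsto_bilin_apply hA₀ v v).add (hv v)) fun k => h k v)
    (fun v => le_of_tendsto_of_tendsto' (by simpa using (tendsto_bilin_apply hA₀ v v).sub (hv v))
      (tendsto_bilin_apply hBt' v v) fun k => h' k v)
  exact ⟨A₀, this.1, hA₀, by rw [this.2]; exact hF1⟩

omit [FiniteDimensional ℝ E] [MeasurableSpace E] [BorelSpace E] in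
theorem quadPoly_zero_add (a a' δ : ℝ) (ℓ ℓ' : E →L[ℝ] ℝ) (A A' : E →L[ℝ] E →L[ℝ] ℝ) (x : E) :
    quadPoly 0 (a + δ * a') (ℓ + δ • ℓ') (A + δ • A') x =
      quadPoly 0 a ℓ A x + δ * quadPoly 0 a' ℓ' A' x := by
  simp only [quadPoly, add_apply, smul_apply, smul_eq_mul]
  ring

theorem Sol.exists_improvement [Nontrivial E] (O : ConcaveOperator F Adm l θ Θ Λ) {α : ℝ}
    (hα : 0 < α) (hα1 : α < 1) {ρ₀ : ℝ} (hρ₀ : 0 < ρ₀) : ∃ ρ, 0 < ρ ∧ ρ < ρ₀ ∧ ∃ ε, 0 < ε ∧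
      ∀ (u φ : E → ℝ) (φ₀ a : ℝ) (ℓ : E →L[ℝ] ℝ) (A : E →L[ℝ] E →L[ℝ] ℝ) (δ : ℝ),
      (∀ v w, A v w = A w v) → 0 < δ → δ ≤ ε → Sol F Adm Λ μ u φ 0 1 →
      (∀ y ∈ ball 0 1, |φ y - φ₀| ≤ ε * δ) → (∀ y ∈ ball 0 1, |u y - quadPoly 0 a ℓ A y| ≤ δ) →
      ∃ (a' : ℝ) (ℓ' : E →L[ℝ] ℝ) (A' : E →L[ℝ] E →L[ℝ] ℝ), (∀ v w, A' v w = A' w v) ∧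
        ∀ y ∈ closedBall 0 ρ, |u y - quadPoly 0 a' ℓ' A' y| ≤ ρ ^ (2 + α) * δ := by
  obtain ⟨C, hC, hTaylor⟩ := exists_taylor_const μ (E := E) O.theta_pos O.Theta_nonneg
    (show (0 : ℝ) < 1 / 4 by norm_num)
  obtain ⟨L, hL, hLip⟩ := Sol.lipschitz μ O
  obtain ⟨ρ, hρ, hρ1, hρ2, hρC⟩ : ∃ ρ : ℝ, 0 < ρ ∧ ρ < 1 / 64 ∧ ρ < ρ₀ ∧ C * ρ ^ (1 - α) ≤ 1 / 2 := by
    have h1 : Tendsto (fun ρ : ℝ => C * ρ ^ (1 - α)) (𝓝[>] 0) (𝓝 0) := by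
      have : Tendsto (fun ρ : ℝ => C * ρ ^ (1 - α)) (𝓝 0) (𝓝 (C * 0 ^ (1 - α))) :=
        ((Real.continuous_rpow_const (by linarith)).tendsto 0).const_mul C
      rw [Real.zero_rpow (by linarith), mul_zero] at this
      exact this.mono_left nhdsWithin_le_nhds
    have h2 := (h1.eventually (ge_mem_nhds (show (0 : ℝ) < 1 / 2 by norm_num))).and
      (Ioo_mem_nhdsGT (show (0 : ℝ) < min (1 / 64) ρ₀ by positivity))
    obtain ⟨ρ, h, h'⟩ := h2.exists
    exact ⟨ρ, h'.1, h'.2.trans_le (min_le_left _ _), h'.2.trans_le (min_le_right _ _), h⟩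
  refine ⟨ρ, hρ, hρ2, ?_⟩
  have hρα : 0 < ρ ^ (2 + α) := Real.rpow_pos_of_pos hρ _
  set η := ρ ^ (2 + α) / 6 with hη
  have hη0 : 0 < η := by positivity
  have hρ3 : C * ρ ^ 3 ≤ ρ ^ (2 + α) / 2 := by
    have : ρ ^ 3 = ρ ^ (2 + α) * ρ ^ (1 - α) := by
      rw [← Real.rpow_add hρ, ← Real.rpow_natCast]; congr 1; push_cast; ring
    rw [this]
    nlinarith
  by_contra hcon
  push Not at hcon
  have hk0 : ∀ k : ℕ, 0 < 1 / ((k : ℝ) + 1) := fun k => by positivity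
  choose u φ φ₀ a ℓ A δ hA hδ hδk hu hφ hq hbad using fun k : ℕ => hcon (1 / ((k : ℝ) + 1)) (hk0 k)
  have hlim : Tendsto (fun k : ℕ => 1 / ((k : ℝ) + 1)) atTop (𝓝 0) :=
    tendsto_one_div_add_atTop_nhds_zero_nat
  have hk1 : ∀ k : ℕ, 1 / ((k : ℝ) + 1) ≤ 1 := fun k => by
    rw [div_le_one (by positivity)]; linarith [Nat.cast_nonneg (α := ℝ) k]
  have hδlim : Tendsto δ atTop (𝓝 0) := squeeze_zero (fun k => (hδ k).le) hδk hlim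
  have hφ1 : ∀ k, ∀ y ∈ ball (0 : E) 1, |φ k y - φ₀ k| ≤ δ k := fun k y hy =>
    (hφ k y hy).trans (mul_le_of_le_one_left (hδ k).le (hk1 k))
  set 𝒰 : Ultrafilter ℕ := hyperfilter ℕ with h𝒰
  have h𝒰top : (𝒰 : Filter ℕ) ≤ atTop := by
    rw [← Nat.cofinite_eq_atTop]; exact hyperfilter_le_cofinite
  -- limit of the quadratic parts
  have hnear := fun k => (hu k).exists_near_quadPoly one_pos (hA k) (hδ k) (a := a k) (ℓ := ℓ k)
    (by simpa using hq k)
  choose hn1 hn2 using hnear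
  choose y hy B hB hBφ hBA using hn1
  choose y' hy' B' hB' hBφ' hBA' using hn2
  have hFF : Tendsto (fun k => F (B k) - F (B' k)) 𝒰 (𝓝 0) := by
    have : Tendsto (fun k => 2 * δ k) 𝒰 (𝓝 0) := by
      simpa using (hδlim.mono_left h𝒰top).const_mul 2
    refine squeeze_zero_norm (fun k => ?_) this
    have h1 := abs_le.1 (hφ1 k _ (hy k))
    have h2 := abs_le.1 (hφ1 k _ (hy' k))
    rw [Real.norm_eq_abs, abs_le, hBφ, hBφ']
    constructor <;> linarith
  obtain ⟨A₀, hA₀, hAlim, -⟩ := O.exists_tendsto_of_near 𝒰 h𝒰top hδlim hA hB hB' hBA hBA' hFF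
    (M := Λ + 18) fun k => ((hu k).norm_hessian_le O one_pos (hA k) (hδ k) (a := a k) (ℓ := ℓ k)
      (by simpa using hq k)).trans (by linarith [hδk k, hk1 k])
  have hAev : ∀ r > 0, ∀ᶠ k in (𝒰 : Filter ℕ), ‖A k - A₀‖ < r := by
    intro r hr
    have := eventually_norm_sub_lt (E := E →L[ℝ] E →L[ℝ] ℝ) A₀ hr
    exact hAlim.eventually this
  have hδev : ∀ r > 0, ∀ᶠ k in (𝒰 : Filter ℕ), δ k < r := fun r hr =>
    (hδlim.mono_left h𝒰top).eventually (gt_mem_nhds hr)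
  -- limit of the right-hand sides
  obtain ⟨r₁, hr₁, H₁⟩ := O.exists_abs_sub_le μ hA₀
  have hcb : ∀ᶠ k in (𝒰 : Filter ℕ), (φ₀ k - F (A k)) / δ k ∈ Icc (-(18 * Θ + 2)) (18 * Θ + 2) := by
    filter_upwards [hAev r₁ hr₁, hδev r₁ hr₁] with k h1 h2
    have := abs_le.1 (H₁ _ _ _ _ _ _ _ (hA k) h1 (hδ k) h2 (hu k) (hφ1 k) (hq k))
    refine ⟨?_, ?_⟩
    · rw [le_div_iff₀ (hδ k)]; linarith [this.1]
    · rw [div_le_iff₀ (hδ k)]; linarith [this.2]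
  obtain ⟨c, -, hc⟩ := isCompact_Icc.ultrafilter_le_nhds
    (𝒰.map fun k => (φ₀ k - F (A k)) / δ k) (le_principal_iff.2 hcb)
  replace hc : Tendsto (fun k => (φ₀ k - F (A k)) / δ k) 𝒰 (𝓝 c) := hc
  -- limit of the rescaled solutions
  set w : ℕ → E → ℝ := fun k x => (δ k)⁻¹ * (u k x - quadPoly 0 (a k) (ℓ k) (A k) x) with hw
  have hw1 : ∀ k, ∀ x ∈ ball (0 : E) 1, |w k x| ≤ 1 := fun k x hx => by
    rw [hw]
    simp only
    rw [abs_mul, abs_inv, abs_of_pos (hδ k), inv_mul_le_iff₀ (hδ k)]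
    linarith [hq k x hx]
  have hsub : closedBall (0 : E) (1 / 4) ⊆ ball 0 1 := closedBall_subset_ball (by norm_num)
  have hsub' : closedBall (0 : E) (1 / 4) ⊆ ball 0 (1 / 2) := closedBall_subset_ball (by norm_num)
  have hwlim : ∀ x : E, ∃ b, x ∈ ball (0 : E) 1 → Tendsto (fun k => w k x) 𝒰 (𝓝 b) := by
    intro x
    by_cases hx : x ∈ ball (0 : E) 1
    · obtain ⟨b, -, hb⟩ := exists_ultralimit (isCompact_Icc (a := (-1 : ℝ)) (b := 1)) 𝒰
        (f := fun k => w k x) (fun k => abs_le.1 (hw1 k x hx))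
      exact ⟨b, fun _ => hb⟩
    · exact ⟨0, fun h => absurd h hx⟩
  choose w' hw' using hwlim
  have hwL : ∀ k, ∀ x ∈ closedBall (0 : E) (1 / 4), ∀ y ∈ closedBall (0 : E) (1 / 4),
      |w k x - w k y| ≤ L * ‖x - y‖ := fun k x hx y hy =>
    hLip _ _ _ (hu k) _ _ _ (hA k) _ (hδ k) (hφ1 k) (hq k) x (hsub' hx) y (hsub' hy)
  have hwL' : ∀ x ∈ closedBall (0 : E) (1 / 4), ∀ y ∈ closedBall (0 : E) (1 / 4),
      |w' x - w' y| ≤ L * ‖x - y‖ := fun x hx y hy =>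
    le_of_tendsto (((hw' x (hsub hx)).sub (hw' y (hsub hy))).abs)
      (Eventually.of_forall fun k => hwL k x hx y hy)
  have hunif := tendstoUniformly_of_lipschitz (isCompact_closedBall (0 : E) (1 / 4)) hL.le hwL hwL'
    (fun x hx => hw' x (hsub hx)) hη0
  have hwc : ContinuousOn w' (sphere (0 : E) (1 / 4)) := by
    have : LipschitzOnWith (Real.toNNReal L) w' (sphere (0 : E) (1 / 4)) := by
      refine LipschitzOnWith.of_dist_le_mul fun x hx y hy => ?_
      rw [Real.dist_eq, dist_eq_norm, Real.coe_toNNReal _ hL.le]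
      exact hwL' x (sphere_subset_closedBall hx) y (sphere_subset_closedBall hy)
    exact this.continuousOn
  obtain ⟨j, p, hp, hpw⟩ := exists_poly_near (1 / 4) hwc hη0
  obtain ⟨h, hh, hhc, hhp⟩ := exists_poly_dirichlet O.theta_pos (O.elliptic A₀ hA₀)
    (show (0 : ℝ) < 1 / 4 by norm_num) hp c
  obtain ⟨r₂, hr₂, H₂⟩ := O.exists_close_to_linear μ hA₀ hh hhc hη0
    (show (0 : ℝ) < 1 / 4 by norm_num) (by norm_num)
  have hfin : ∀ᶠ k in (𝒰 : Filter ℕ), ∀ y ∈ closedBall (0 : E) (1 / 4), |w k y - h y| ≤ 3 * η := by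
    have hc2 := hc.eventually (ball_mem_nhds c hr₂)
    have hk2 := (hlim.mono_left h𝒰top).eventually (gt_mem_nhds hr₂)
    filter_upwards [hAev r₂ hr₂, hδev r₂ hr₂, hc2, hk2, hunif] with k h1 h2 h3 h4 h5
    refine H₂ _ _ _ _ _ _ _ (hA k) h1 (hδ k) h2 (hu k) (fun y hy => (hφ k y hy).trans
      (mul_le_mul_of_nonneg_right h4.le (hδ k).le)) ?_ ?_
    · rw [Real.dist_eq] at h3
      have : φ₀ k - F (A k) - δ k * c = δ k * ((φ₀ k - F (A k)) / δ k - c) := by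
        field_simp [(hδ k).ne']
      rw [this, abs_mul, abs_of_pos (hδ k), mul_comm]
      exact mul_le_mul_of_nonneg_right h3.le (hδ k).le
    · intro y hy
      have e1 := abs_lt.1 (h5 y (sphere_subset_closedBall hy))
      have e2 := abs_le.1 (hpw y hy)
      rw [hhp y hy, abs_le]
      constructor <;> linarith [e1.1, e1.2, e2.1, e2.2]
  obtain ⟨k, hk⟩ := hfin.exists
  have hη1 : 3 * η ≤ 1 := by
    have : ρ ^ (2 + α) ≤ 1 := Real.rpow_le_one hρ.le (by linarith) (by linarith)
    rw [hη]; linarith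
  have hh2 : ∀ x ∈ ball (0 : E) (1 / 4), |h x| ≤ 2 := fun x hx => by
    have h1 := abs_le.1 (hk x (ball_subset_closedBall hx))
    have h2 := abs_le.1 (hw1 k x (hsub (ball_subset_closedBall hx)))
    rw [abs_le]
    constructor <;> linarith [h1.1, h1.2, h2.1, h2.2]
  obtain ⟨x, hx, hxbad⟩ := hbad k (a k + δ k * h 0) (ℓ k + δ k • fderiv ℝ h 0)
    (A k + δ k • fderiv ℝ (fderiv ℝ h) 0) (fun v w => by
      simp [hA k v w, (hasHessAt_of_contDiff (hh.of_le (by norm_num) : ContDiff ℝ 2 h) 0).1 v w])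
  refine absurd hxbad (not_lt.2 ?_)
  have hxρ : ‖x‖ ≤ ρ := by simpa using hx
  have h1 := hTaylor _ (O.elliptic A₀ hA₀) h c hh hhc hh2 x (by
    rw [mem_ball, dist_zero_right]; linarith)
  have h2 := hk x (by rw [mem_closedBall, dist_zero_right]; linarith)
  have h3 : C * ‖x‖ ^ 3 ≤ C * ρ ^ 3 := by gcongr
  rw [quadPoly_zero_add]
  have h4 : u k x - (quadPoly 0 (a k) (ℓ k) (A k) x +
      δ k * quadPoly 0 (h 0) (fderiv ℝ h 0) (fderiv ℝ (fderiv ℝ h) 0) x) = δ k * ((w k x - h x) +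
      (h x - quadPoly 0 (h 0) (fderiv ℝ h 0) (fderiv ℝ (fderiv ℝ h) 0) x)) := by
    have : δ k * w k x = u k x - quadPoly 0 (a k) (ℓ k) (A k) x := by
      rw [hw]; field_simp [(hδ k).ne']
    linear_combination this.symm
  rw [h4, abs_mul, abs_of_pos (hδ k), mul_comm]
  refine mul_le_mul_of_nonneg_right ((abs_add_le _ _).trans ?_) (hδ k).le
  linarith

end Improvement

section Quadratic

variable {E : Type*} [NormedAddCommGroup E] [NormedSpace ℝ E]

theorem quadPoly_sub (a a' : ℝ) {x : E} (ℓ ℓ' : E →L[ℝ] ℝ) (A A' : E →L[ℝ] E →L[ℝ] ℝ) (y : E) :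
    quadPoly x (a - a') (ℓ - ℓ') (A - A') y = quadPoly x a ℓ A y - quadPoly x a' ℓ' A' y := by
  simp only [quadPoly, sub_apply]
  ring

theorem quadPoly_rescale (x : E) (a s : ℝ) (ℓ : E →L[ℝ] ℝ)
    (A : E →L[ℝ] E →L[ℝ] ℝ) (z : E) : quadPoly x (s ^ 2 * a) (s • ℓ) A (x + s • z) =
      s ^ 2 * quadPoly 0 a ℓ A z := by
  simp only [quadPoly, smul_apply, smul_eq_mul, add_sub_cancel_left, map_smul, sub_zero]
  ring

end Quadratic

section Coefficients

variable {E : Type*} [NormedAddCommGroup E] [InnerProductSpace ℝ E]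

theorem norm_le_of_quadPoly_le {a : ℝ} {ℓ : E →L[ℝ] ℝ} {A : E →L[ℝ] E →L[ℝ] ℝ}
    (hA : ∀ v w, A v w = A w v) {κ r : ℝ} (hr : 0 < r)
    (h : ∀ y ∈ closedBall (0 : E) r, |quadPoly 0 a ℓ A y| ≤ κ) :
    |a| ≤ κ ∧ ‖ℓ‖ ≤ κ / r ∧ ‖A‖ ≤ 4 * κ / r ^ 2 := by
  have h0 : |a| ≤ κ := by simpa [quadPoly] using h 0 (mem_closedBall_self hr.le)
  have hκ : 0 ≤ κ := (abs_nonneg _).trans h0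
  have h0' := abs_le.1 h0
  have hy : ∀ v : E, v ≠ 0 → |a + r / ‖v‖ * ℓ v + 1 / 2 * ((r / ‖v‖) ^ 2 * A v v)| ≤ κ ∧
      |a - r / ‖v‖ * ℓ v + 1 / 2 * ((r / ‖v‖) ^ 2 * A v v)| ≤ κ := by
    intro v hv
    have hv' := norm_pos_iff.2 hv
    have hn : ‖(r / ‖v‖) • v‖ = r := by
      rw [norm_smul, Real.norm_eq_abs, abs_of_pos (by positivity)]; field_simp
    constructor
    · have := h ((r / ‖v‖) • v) (by simp [hn])
      simp only [quadPoly, sub_zero, map_smul, smul_apply, smul_eq_mul] at this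
      rwa [← mul_assoc (r / ‖v‖) (r / ‖v‖), ← sq] at this
    · have := h (-((r / ‖v‖) • v)) (by simp [hn])
      simp only [quadPoly, sub_zero, map_neg, map_smul, smul_apply, smul_eq_mul, neg_apply] at this
      convert this using 2
      ring
  refine ⟨h0, ?_, ?_⟩
  · refine ContinuousLinearMap.opNorm_le_bound _ (by positivity) fun v => ?_
    rcases eq_or_ne v 0 with rfl | hv
    · simp
    have hv' := norm_pos_iff.2 hv
    obtain ⟨h1, h2⟩ := hy v hv
    rw [abs_le] at h1 h2
    have h3 : |r / ‖v‖ * ℓ v| ≤ κ := by rw [abs_le]; constructor <;> linarith [h1.1, h1.2, h2.1, h2.2]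
    rw [abs_mul, abs_of_pos (by positivity)] at h3
    rw [Real.norm_eq_abs]
    calc |ℓ v| = (r / ‖v‖ * |ℓ v|) * (‖v‖ / r) := by field_simp
      _ ≤ κ * (‖v‖ / r) := by gcongr
      _ = κ / r * ‖v‖ := by ring
  · refine norm_le_of_diag hA (by positivity) fun v => ?_
    rcases eq_or_ne v 0 with rfl | hv
    · simp
    have hv' := norm_pos_iff.2 hv
    obtain ⟨h1, h2⟩ := hy v hv
    rw [abs_le] at h1 h2
    have h3 : |(r / ‖v‖) ^ 2 * A v v| ≤ 4 * κ := by
      rw [abs_le]; constructor <;> linarith [h1.1, h1.2, h2.1, h2.2]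
    rw [abs_mul, abs_of_pos (by positivity)] at h3
    calc |A v v| = ((r / ‖v‖) ^ 2 * |A v v|) * (‖v‖ / r) ^ 2 := by field_simp
      _ ≤ (4 * κ) * (‖v‖ / r) ^ 2 := by gcongr
      _ = 4 * κ / r ^ 2 * ‖v‖ ^ 2 := by ring

variable [FiniteDimensional ℝ E] [MeasurableSpace E] [BorelSpace E]
variable {F : (E →L[ℝ] E →L[ℝ] ℝ) → ℝ} {Adm : Set (E →L[ℝ] E →L[ℝ] ℝ)}
  {l : (E →L[ℝ] E →L[ℝ] ℝ) → (E →L[ℝ] E →L[ℝ] ℝ) →L[ℝ] ℝ} {θ Θ Λ : ℝ} {μ : Measure E}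
  [μ.IsAddHaarMeasure]

theorem Sol.rescale {u φ : E → ℝ} {x : E} {r s : ℝ} (hs : 0 < s)
    (h : Sol F Adm Λ μ u φ x (s * r)) :
    Sol F Adm Λ μ (fun z => (s ^ 2)⁻¹ * u (x + s • z)) (fun z => φ (x + s • z)) 0 r := by
  have hmem : ∀ z ∈ ball (0 : E) r, x + s • z ∈ ball x (s * r) := fun z hz => by
    rw [mem_ball, dist_zero_right] at hz
    rw [mem_ball, dist_eq_norm, add_sub_cancel_left, norm_smul, Real.norm_eq_abs, abs_of_pos hs]
    gcongr
  have hd : ∀ z ∈ ball (0 : E) r, HasFDerivAt (fun z => (s ^ 2)⁻¹ * u (x + s • z))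
      (s⁻¹ • fderiv ℝ u (x + s • z)) z := by
    intro z hz
    have h1 : HasFDerivAt (fun z : E => x + s • z) (s • ContinuousLinearMap.id ℝ E) z :=
      ((hasFDerivAt_id z).const_smul s).const_add x
    have h2 := ((h.diff _ (hmem z hz)).hasFDerivAt.comp z h1).const_mul (s ^ 2)⁻¹
    refine h2.congr_fderiv ?_
    ext v
    simp only [smul_apply, smul_eq_mul, ContinuousLinearMap.comp_apply, ContinuousLinearMap.id_apply,
      map_smul]
    field_simp
  refine ⟨fun z hz => (hd z hz).differentiableAt, fun y hy z hz => ?_, ?_⟩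
  · rw [(hd y hy).fderiv, (hd z hz).fderiv, ← smul_sub, norm_smul, Real.norm_eq_abs,
      abs_of_pos (inv_pos.2 hs), inv_mul_le_iff₀ hs]
    refine (h.lip _ (hmem y hy) _ (hmem z hz)).trans (le_of_eq ?_)
    rw [add_sub_add_left_eq_sub, ← smul_sub, norm_smul, Real.norm_eq_abs, abs_of_pos hs]
    ring
  · filter_upwards [ae_comp_affine μ h.ae x hs.ne'] with z hz hzr
    obtain ⟨B, hB, hBu, hBφ⟩ := hz (hmem z hzr)
    refine ⟨B, hB, ?_, hBφ⟩
    have := hBu.comp_affine.const_mul (s ^ 2)⁻¹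
    rwa [inv_smul_smul₀ (by positivity)] at this

omit [FiniteDimensional ℝ E] [BorelSpace E] [μ.IsAddHaarMeasure] in
theorem Sol.sub_affine {u φ : E → ℝ} {x : E} {r : ℝ} (h : Sol F Adm Λ μ u φ x r) (p : ℝ)
    (ℓ : E →L[ℝ] ℝ) : Sol F Adm Λ μ (fun z => u z - (p + ℓ z)) φ x r := by
  have hd : ∀ z ∈ ball x r, HasFDerivAt (fun z => u z - (p + ℓ z)) (fderiv ℝ u z - ℓ) z :=
    fun z hz => (h.diff z hz).hasFDerivAt.sub (ℓ.hasFDerivAt.const_add p)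
  refine ⟨fun z hz => (hd z hz).differentiableAt, fun y hy z hz => ?_, ?_⟩
  · rw [(hd y hy).fderiv, (hd z hz).fderiv, sub_sub_sub_cancel_right]
    exact h.lip y hy z hz
  · filter_upwards [h.ae] with z hz hzr
    obtain ⟨B, hB, ⟨hs, ℓ', hBu⟩, hBφ⟩ := hz hzr
    refine ⟨B, hB, ⟨hs, ℓ' - ℓ, hBu.congr_left fun v => ?_⟩, hBφ⟩
    simp only [map_add, sub_apply]
    ring

end Coefficients

theorem exists_limit_of_geometric {G : Type*} [NormedAddCommGroup G] [CompleteSpace G] {x : ℕ → G}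
    {K q : ℝ} (hq : q < 1) (h : ∀ j, ‖x j - x (j + 1)‖ ≤ K * q ^ j) :
    ∃ x' : G, Tendsto x atTop (𝓝 x') ∧ ∀ j, ‖x j - x'‖ ≤ K * q ^ j / (1 - q) := by
  have h' : ∀ j, dist (x j) (x (j + 1)) ≤ K * q ^ j := fun j => by
    rw [dist_eq_norm]; exact h j
  obtain ⟨x', hx'⟩ := cauchySeq_tendsto_of_complete (cauchySeq_of_le_geometric q K hq h')
  refine ⟨x', hx', fun j => ?_⟩
  rw [← dist_eq_norm]
  exact dist_le_of_le_geometric_of_tendsto q K hq h' hx' j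

section Iteration

variable {E : Type*} [NormedAddCommGroup E] [InnerProductSpace ℝ E]
variable [FiniteDimensional ℝ E] [MeasurableSpace E] [BorelSpace E]
variable {F : (E →L[ℝ] E →L[ℝ] ℝ) → ℝ} {Adm : Set (E →L[ℝ] E →L[ℝ] ℝ)}
  {l : (E →L[ℝ] E →L[ℝ] ℝ) → (E →L[ℝ] E →L[ℝ] ℝ) →L[ℝ] ℝ} {θ Θ Λ : ℝ} (μ : Measure E)
  [μ.IsAddHaarMeasure]

theorem exists_improved_sequence [Nontrivial E] (O : ConcaveOperator F Adm l θ Θ Λ) {α : ℝ}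
    (hα : 0 < α) (hα1 : α < 1) : ∃ ρ : ℝ, 0 < ρ ∧ ρ < 1 ∧ ∃ ε : ℝ, 0 < ε ∧
      ∀ (u φ : E → ℝ) (a : ℝ) (ℓ : E →L[ℝ] ℝ) (A : E →L[ℝ] E →L[ℝ] ℝ) (δ : ℝ),
        (∀ v w, A v w = A w v) → 0 < δ → δ ≤ ε → Sol F Adm Λ μ u φ 0 1 →
        (∀ y ∈ ball (0 : E) 1, |φ y - φ 0| ≤ ε * δ * ‖y‖ ^ α) →
        (∀ y ∈ ball (0 : E) 1, |u y - quadPoly 0 a ℓ A y| ≤ δ) →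
        ∃ (as : ℕ → ℝ) (ls : ℕ → E →L[ℝ] ℝ) (As : ℕ → E →L[ℝ] E →L[ℝ] ℝ),
          as 0 = a ∧ ls 0 = ℓ ∧ As 0 = A ∧ (∀ j v w, As j v w = As j w v) ∧
          ∀ j, ∀ y ∈ ball (0 : E) (ρ ^ j),
            |u y - quadPoly 0 (as j) (ls j) (As j) y| ≤ δ * (ρ ^ j) ^ (2 + α) := by
  obtain ⟨ρ, hρ, hρ1, ε, hε, H⟩ := Sol.exists_improvement μ O hα hα1 one_pos
  refine ⟨ρ, hρ, hρ1, ε, hε, fun u φ a ℓ A δ hA hδ hδε hu hφ hP => ?_⟩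
  have step : ∀ (j : ℕ) (p : ℝ × (E →L[ℝ] ℝ) × (E →L[ℝ] E →L[ℝ] ℝ)),
      ((∀ v w, p.2.2 v w = p.2.2 w v) ∧ ∀ y ∈ ball (0 : E) (ρ ^ j),
        |u y - quadPoly 0 p.1 p.2.1 p.2.2 y| ≤ δ * (ρ ^ j) ^ (2 + α)) →
      ∃ p' : ℝ × (E →L[ℝ] ℝ) × (E →L[ℝ] E →L[ℝ] ℝ),
      ((∀ v w, p'.2.2 v w = p'.2.2 w v) ∧ ∀ y ∈ ball (0 : E) (ρ ^ (j + 1)),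
        |u y - quadPoly 0 p'.1 p'.2.1 p'.2.2 y| ≤ δ * (ρ ^ (j + 1)) ^ (2 + α)) := by
    rintro j ⟨b, m, B⟩ ⟨hB, hb⟩
    simp only at hB hb
    have hs : 0 < ρ ^ j := by positivity
    have hs1 : ρ ^ j ≤ 1 := pow_le_one₀ hρ.le hρ1.le
    set s := ρ ^ j with hsdef
    have hsα : 0 < s ^ α := Real.rpow_pos_of_pos hs α
    have hsα1 : s ^ α ≤ 1 := Real.rpow_le_one hs.le hs1 hα.le
    have hs2α : s ^ (2 + α) = s ^ 2 * s ^ α := by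
      rw [Real.rpow_add hs]; norm_num
    have hmem : ∀ z ∈ ball (0 : E) 1, s • z ∈ ball (0 : E) s := fun z hz => by
      rw [mem_ball, dist_zero_right] at hz ⊢
      rw [norm_smul, Real.norm_eq_abs, abs_of_pos hs]
      exact (mul_lt_iff_lt_one_right hs).2 hz
    have hsub : ball (0 : E) s ⊆ ball 0 1 := ball_subset_ball hs1
    have hq : ∀ (c : ℝ) (m' : E →L[ℝ] ℝ) (B' : E →L[ℝ] E →L[ℝ] ℝ) (z : E),
        quadPoly 0 c m' B' (s • z) = s ^ 2 * quadPoly 0 ((s ^ 2)⁻¹ * c) (s⁻¹ • m') B' z := by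
      intro c m' B' z
      have := quadPoly_rescale (0 : E) ((s ^ 2)⁻¹ * c) s (s⁻¹ • m') B' z
      rwa [mul_inv_cancel_left₀ (by positivity), smul_inv_smul₀ hs.ne', zero_add] at this
    have hsol := Sol.rescale (r := 1) hs (x := (0 : E)) (hu.mono (by rw [mul_one]; exact hsub))
    simp only [zero_add] at hsol
    obtain ⟨b', m', B', hB', hb'⟩ := H _ _ (φ 0) ((s ^ 2)⁻¹ * b) (s⁻¹ • m) B (δ * s ^ α) hB
      (by positivity) ((mul_le_of_le_one_right hδ.le hsα1).trans hδε) hsol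
      (fun y hy => (hφ _ (hsub (hmem y hy))).trans (by
        rw [mul_assoc]
        gcongr
        rw [← dist_zero_right]; exact (hmem y hy).le))
      (fun y hy => by
        have h1 := hb _ (hmem y hy)
        rw [hq, hs2α] at h1
        have h2 : (s ^ 2)⁻¹ * u (s • y) - quadPoly 0 ((s ^ 2)⁻¹ * b) (s⁻¹ • m) B y =
          (s ^ 2)⁻¹ * (u (s • y) - s ^ 2 * quadPoly 0 ((s ^ 2)⁻¹ * b) (s⁻¹ • m) B y) := by
          field_simp
        rw [h2, abs_mul, abs_of_pos (by positivity), inv_mul_le_iff₀ (by positivity)]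
        linarith)
    refine ⟨(s ^ 2 * b', s • m', B'), hB', fun y hy => ?_⟩
    have hy' : s⁻¹ • y ∈ closedBall (0 : E) ρ := by
      rw [mem_ball, dist_zero_right, pow_succ, ← hsdef] at hy
      rw [mem_closedBall, dist_zero_right, norm_smul, Real.norm_eq_abs,
        abs_of_pos (inv_pos.2 hs), inv_mul_le_iff₀ hs]
      exact hy.le
    have h1 := hb' _ hy'
    have h3 := quadPoly_rescale (0 : E) b' s m' B' (s⁻¹ • y)
    rw [zero_add, smul_inv_smul₀ hs.ne'] at h3
    simp only
    rw [h3, pow_succ ρ j, ← hsdef, Real.mul_rpow hs.le hρ.le, hs2α]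
    rw [smul_inv_smul₀ hs.ne'] at h1
    have h2 : u y - s ^ 2 * quadPoly 0 b' m' B' (s⁻¹ • y) =
        s ^ 2 * ((s ^ 2)⁻¹ * u y - quadPoly 0 b' m' B' (s⁻¹ • y)) := by
      field_simp
    rw [h2, abs_mul, abs_of_pos (by positivity)]
    calc s ^ 2 * |(s ^ 2)⁻¹ * u y - quadPoly 0 b' m' B' (s⁻¹ • y)|
        ≤ s ^ 2 * (ρ ^ (2 + α) * (δ * s ^ α)) := by gcongr
      _ = _ := by ring
  choose! g hg using step
  let p : ℕ → ℝ × (E →L[ℝ] ℝ) × (E →L[ℝ] E →L[ℝ] ℝ) := fun j => Nat.rec (a, ℓ, A) (fun i q => g i q) j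
  have hp : ∀ j, ((∀ v w, (p j).2.2 v w = (p j).2.2 w v) ∧ ∀ y ∈ ball (0 : E) (ρ ^ j),
        |u y - quadPoly 0 (p j).1 (p j).2.1 (p j).2.2 y| ≤ δ * (ρ ^ j) ^ (2 + α)) := by
    intro j
    induction j with
    | zero => exact ⟨hA, by simpa [p] using hP⟩
    | succ i ih => exact hg i (p i) ih
  exact ⟨fun j => (p j).1, fun j => (p j).2.1, fun j => (p j).2.2, rfl, rfl, rfl,
    fun j => (hp j).1, fun j => (hp j).2⟩

set_option maxHeartbeats 1000000 in
theorem exists_taylor_of_near_quadPoly_unit [Nontrivial E] (O : ConcaveOperator F Adm l θ Θ Λ) {α : ℝ}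
    (hα : 0 < α) (hα1 : α < 1) : ∃ C : ℝ, 0 < C ∧ ∃ ε : ℝ, 0 < ε ∧
      ∀ (u φ : E → ℝ) (a : ℝ) (ℓ : E →L[ℝ] ℝ) (A : E →L[ℝ] E →L[ℝ] ℝ) (δ : ℝ),
        (∀ v w, A v w = A w v) → 0 < δ → δ ≤ ε → Sol F Adm Λ μ u φ 0 1 →
        (∀ y ∈ ball (0 : E) 1, |φ y - φ 0| ≤ ε * δ * ‖y‖ ^ α) →
        (∀ y ∈ ball (0 : E) 1, |u y - quadPoly 0 a ℓ A y| ≤ δ) →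
        ∃ (ℓ' : E →L[ℝ] ℝ) (A' : E →L[ℝ] E →L[ℝ] ℝ), (∀ v w, A' v w = A' w v) ∧
          ‖A' - A‖ ≤ C * δ ∧ ∀ y ∈ ball (0 : E) 1,
            |u y - quadPoly 0 (u 0) ℓ' A' y| ≤ C * δ * ‖y‖ ^ (2 + α) := by
  obtain ⟨ρ, hρ, hρ1, ε, hε, H⟩ := exists_improved_sequence μ O hα hα1
  have hρα1 : ρ ^ α < 1 := Real.rpow_lt_one hρ.le hρ1 hα
  have hρα0 : 0 < ρ ^ α := Real.rpow_pos_of_pos hρ α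
  set C₁ : ℝ := 32 / ρ ^ 2 / (1 - ρ ^ α) with hC₁
  have hC₁pos : 0 < C₁ := div_pos (by positivity) (by linarith)
  have hK : ∀ c : ℝ, c ≤ 32 / ρ ^ 2 → ∀ q : ℝ, q ≤ ρ ^ α → 0 ≤ q → c / (1 - q) ≤ C₁ := by
    intro c hc q hq hq0
    exact div_le_div₀ (by positivity) hc (by linarith) (by linarith)
  refine ⟨(1 + 3 * C₁) / ρ ^ (2 + α) + C₁, by positivity, ε, hε,
    fun u φ a ℓ A δ hA hδ hδε hu hφ hP => ?_⟩
  obtain ⟨as, ls, As, ha, hℓ, hAA, hsym, hj⟩ := H u φ a ℓ A δ hA hδ hδε hu hφ hP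
  have hpow : ∀ (j : ℕ) (t : ℝ), (ρ ^ j) ^ t = (ρ ^ t) ^ j := fun j t => by
    rw [← Real.rpow_natCast, ← Real.rpow_mul hρ.le, mul_comm, Real.rpow_mul hρ.le,
      Real.rpow_natCast]
  have hsplit : ∀ j : ℕ, (ρ ^ j) ^ (2 + α) = (ρ ^ j) ^ 2 * (ρ ^ j) ^ α := fun j => by
    rw [Real.rpow_add (by positivity)]; norm_num
  have hsplit1 : ∀ j : ℕ, (ρ ^ j) ^ (1 + α) = (ρ ^ j) * (ρ ^ j) ^ α := fun j => by
    rw [Real.rpow_add (by positivity)]; norm_num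
  have hdiff : ∀ j, |as j - as (j + 1)| ≤ 2 * δ * (ρ ^ j) ^ (2 + α) ∧
      ‖ls j - ls (j + 1)‖ ≤ 4 / ρ * δ * (ρ ^ j) ^ (1 + α) ∧
      ‖As j - As (j + 1)‖ ≤ 32 / ρ ^ 2 * δ * (ρ ^ j) ^ α := by
    intro j
    have hle : (ρ ^ (j + 1)) ^ (2 + α) ≤ (ρ ^ j) ^ (2 + α) :=
      Real.rpow_le_rpow (by positivity) (pow_le_pow_of_le_one hρ.le hρ1.le j.le_succ) (by linarith)
    have hr : 0 < ρ ^ (j + 1) / 2 := by positivity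
    have h := norm_le_of_quadPoly_le (a := as j - as (j + 1)) (ℓ := ls j - ls (j + 1))
      (A := As j - As (j + 1)) (fun v w => by simp only [sub_apply, hsym j v w, hsym (j + 1) v w])
      (κ := 2 * δ * (ρ ^ j) ^ (2 + α)) hr (fun y hy => by
        have hy1 : y ∈ ball (0 : E) (ρ ^ (j + 1)) :=
          closedBall_subset_ball (half_lt_self (by positivity)) hy
        have hy2 : y ∈ ball (0 : E) (ρ ^ j) :=
          ball_subset_ball (pow_le_pow_of_le_one hρ.le hρ1.le j.le_succ) hy1
        have h1 := abs_le.1 (hj (j + 1) y hy1)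
        have h2 := abs_le.1 (hj j y hy2)
        have h3 : δ * (ρ ^ (j + 1)) ^ (2 + α) ≤ δ * (ρ ^ j) ^ (2 + α) := by gcongr
        rw [quadPoly_sub, abs_le]
        constructor <;> linarith [h1.1, h1.2, h2.1, h2.2])
    have hs : (ρ ^ j) ≠ 0 := by positivity
    refine ⟨h.1, h.2.1.trans (le_of_eq ?_), h.2.2.trans (le_of_eq ?_)⟩
    · rw [hsplit, hsplit1, pow_succ]; field_simp; ring
    · rw [hsplit, pow_succ]; field_simp; ring
  have hq2 : ρ ^ (2 + α) ≤ ρ ^ α := Real.rpow_le_rpow_of_exponent_ge hρ hρ1.le (by linarith)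
  have hq1 : ρ ^ (1 + α) ≤ ρ ^ α := Real.rpow_le_rpow_of_exponent_ge hρ hρ1.le (by linarith)
  obtain ⟨a', ha'lim, ha'⟩ := exists_limit_of_geometric (x := as) (K := 2 * δ) (hq2.trans_lt hρα1)
    (fun j => by rw [← hpow]; exact (hdiff j).1)
  obtain ⟨ℓ', -, hℓ'⟩ := exists_limit_of_geometric (x := ls) (K := 4 / ρ * δ) (hq1.trans_lt hρα1)
    (fun j => by rw [← hpow]; exact (hdiff j).2.1)
  obtain ⟨A', hA'lim, hA'⟩ := exists_limit_of_geometric (G := E →L[ℝ] E →L[ℝ] ℝ) (x := As)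
    (K := 32 / ρ ^ 2 * δ) hρα1 (fun j => by rw [← hpow]; exact (hdiff j).2.2)
  have hinv : 1 ≤ 1 / ρ := (one_le_div hρ).2 hρ1.le
  have hinv2 : 1 / ρ ^ 2 = (1 / ρ) ^ 2 := by rw [div_pow, one_pow]
  have k1 : (2 : ℝ) ≤ 32 / ρ ^ 2 := by
    rw [show 32 / ρ ^ 2 = 32 * (1 / ρ) ^ 2 by rw [← hinv2]; ring]; nlinarith
  have k2 : 4 / ρ ≤ 32 / ρ ^ 2 := by
    rw [show 32 / ρ ^ 2 = 32 * (1 / ρ) ^ 2 by rw [← hinv2]; ring,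
      show 4 / ρ = 4 * (1 / ρ) by ring]; nlinarith
  have ba : ∀ j, |as j - a'| ≤ C₁ * δ * (ρ ^ j) ^ (2 + α) := fun j => by
    refine (ha' j).trans ?_
    rw [← hpow, show 2 * δ * (ρ ^ j) ^ (2 + α) / (1 - ρ ^ (2 + α)) =
      2 / (1 - ρ ^ (2 + α)) * δ * (ρ ^ j) ^ (2 + α) by ring]
    have := hK 2 k1 _ hq2 (by positivity)
    gcongr
  have bℓ : ∀ j, ‖ls j - ℓ'‖ ≤ C₁ * δ * (ρ ^ j) ^ (1 + α) := fun j => by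
    refine (hℓ' j).trans ?_
    rw [← hpow, show 4 / ρ * δ * (ρ ^ j) ^ (1 + α) / (1 - ρ ^ (1 + α)) =
      4 / ρ / (1 - ρ ^ (1 + α)) * δ * (ρ ^ j) ^ (1 + α) by ring]
    have := hK _ k2 _ hq1 (by positivity)
    gcongr
  have bA : ∀ j, ‖As j - A'‖ ≤ C₁ * δ * (ρ ^ j) ^ α := fun j => by
    refine (hA' j).trans (le_of_eq ?_)
    rw [← hpow, hC₁]; ring
  have hA'sym : ∀ v w, A' v w = A' w v := fun v w =>
    tendsto_nhds_unique (tendsto_bilin_apply hA'lim v w)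
      ((tendsto_bilin_apply hA'lim w v).congr fun j => hsym j w v)
  have ha'u : a' = u 0 := by
    refine tendsto_nhds_unique ha'lim (tendsto_iff_norm_sub_tendsto_zero.2 ?_)
    refine squeeze_zero (fun _ => norm_nonneg _) (g := fun j => δ * (ρ ^ (2 + α)) ^ j) (fun j => ?_) ?_
    · have := hj j 0 (mem_ball_self (by positivity))
      rw [← hpow, Real.norm_eq_abs, abs_sub_comm]
      simpa [quadPoly] using this
    · simpa using (tendsto_pow_atTop_nhds_zero_of_lt_one (by positivity)
        (hq2.trans_lt hρα1)).const_mul δ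
  refine ⟨ℓ', A', hA'sym, ?_, fun y hy => ?_⟩
  · have := bA 0
    rw [hAA, pow_zero, Real.one_rpow, mul_one] at this
    rw [show ‖A' - A‖ = ‖A - A'‖ from norm_sub_rev (E := E →L[ℝ] E →L[ℝ] ℝ) _ _]
    refine this.trans ?_
    gcongr
    have : 0 < (1 + 3 * C₁) / ρ ^ (2 + α) := by positivity
    linarith
  · rcases eq_or_ne y 0 with rfl | hy0
    · simp only [quadPoly, sub_self, map_zero, add_zero, mul_zero, abs_zero]
      positivity
    have hyn := norm_pos_iff.2 hy0
    rw [mem_ball, dist_zero_right] at hy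
    obtain ⟨j, hj1, hj2⟩ : ∃ j : ℕ, ρ ^ (j + 1) ≤ ‖y‖ ∧ ‖y‖ < ρ ^ j := by
      obtain ⟨j, hj1, hj2⟩ := exists_nat_pow_near_of_lt_one hyn hy.le hρ hρ1
      rcases hj2.lt_or_eq with hlt | heq
      · exact ⟨j, hj1.le, hlt⟩
      · rcases j with _ | i
        · rw [pow_zero] at heq; linarith
        · refine ⟨i, heq.ge, heq.trans_lt ?_⟩
          exact pow_lt_pow_right_of_lt_one₀ hρ hρ1 i.lt_succ_self
    have hs : 0 < ρ ^ j := by positivity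
    set s := ρ ^ j with hsdef
    have hm : y ∈ ball (0 : E) s := by rwa [mem_ball, dist_zero_right]
    have h0 := hj j y hm
    have h1 := bℓ j
    have h2 := bA j
    have h3 := ba j
    rw [← hsdef] at h0 h1 h2 h3
    have h1' : |(ls j - ℓ') y| ≤ C₁ * δ * s ^ (2 + α) := by
      refine ((ls j - ℓ').le_opNorm y).trans ?_
      calc ‖ls j - ℓ'‖ * ‖y‖ ≤ (C₁ * δ * s ^ (1 + α)) * s := by gcongr
        _ = C₁ * δ * s ^ (2 + α) := by
          rw [hsdef, hsplit1, hsplit]; ring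
    have h2' : |(As j - A') y y| ≤ C₁ * δ * s ^ (2 + α) := by
      refine (bilin_le_norm (As j - A') y).trans ?_
      calc ‖As j - A'‖ * ‖y‖ ^ 2 ≤ (C₁ * δ * s ^ α) * s ^ 2 := by gcongr
        _ = C₁ * δ * s ^ (2 + α) := by
          rw [hsdef, hsplit]; ring
    have h4 : |u y - quadPoly 0 (u 0) ℓ' A' y| ≤ (1 + 3 * C₁) * δ * s ^ (2 + α) := by
      have e : u y - quadPoly 0 (u 0) ℓ' A' y = (u y - quadPoly 0 (as j) (ls j) (As j) y) +
          ((as j - a') + (ls j - ℓ') y + 1 / 2 * (As j - A') y y) := by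
        rw [← ha'u]
        simp only [quadPoly, sub_apply, sub_zero]
        ring
      have hX : 0 ≤ C₁ * δ * s ^ (2 + α) := by positivity
      have e' : (1 + 3 * C₁) * δ * s ^ (2 + α) =
        δ * s ^ (2 + α) + 3 * (C₁ * δ * s ^ (2 + α)) := by ring
      rw [e, e', abs_le]
      have g0 := abs_le.1 h0
      have g1 := abs_le.1 h1'
      have g2 := abs_le.1 h2'
      have g3 := abs_le.1 h3
      constructor <;> linarith [g0.1, g0.2, g1.1, g1.2, g2.1, g2.2, g3.1, g3.2]
    refine h4.trans ?_
    have h5 : s ^ (2 + α) ≤ ‖y‖ ^ (2 + α) / ρ ^ (2 + α) := by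
      rw [le_div_iff₀ (by positivity), ← Real.mul_rpow hs.le hρ.le]
      exact Real.rpow_le_rpow (by positivity) (by rw [hsdef, ← pow_succ]; exact hj1) (by linarith)
    calc (1 + 3 * C₁) * δ * s ^ (2 + α)
        ≤ (1 + 3 * C₁) * δ * (‖y‖ ^ (2 + α) / ρ ^ (2 + α)) := by gcongr
      _ = (1 + 3 * C₁) / ρ ^ (2 + α) * δ * ‖y‖ ^ (2 + α) := by ring
      _ ≤ _ := by gcongr; linarith

/-- A solution that is close to a quadratic polynomial at some scale has a `C^{2,α}` expansion at
the center. -/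
theorem exists_taylor_of_near_quadPoly [Nontrivial E] (O : ConcaveOperator F Adm l θ Θ Λ) {α : ℝ}
    (hα : 0 < α) (hα1 : α < 1) : ∃ C : ℝ, 0 < C ∧ ∃ ε : ℝ, 0 < ε ∧
      ∀ (u φ : E → ℝ) (x : E) (r a : ℝ) (ℓ : E →L[ℝ] ℝ) (A : E →L[ℝ] E →L[ℝ] ℝ) (δ : ℝ),
        (∀ v w, A v w = A w v) → 0 < r → 0 < δ → δ ≤ ε → Sol F Adm Λ μ u φ x r →
        (∀ y ∈ ball x r, |φ y - φ x| ≤ ε * δ * (‖y - x‖ / r) ^ α) →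
        (∀ y ∈ ball x r, |u y - quadPoly x a ℓ A y| ≤ δ * r ^ 2) →
        ∃ (ℓ' : E →L[ℝ] ℝ) (A' : E →L[ℝ] E →L[ℝ] ℝ), (∀ v w, A' v w = A' w v) ∧
          ‖A' - A‖ ≤ C * δ ∧ ∀ y ∈ ball x r,
            |u y - quadPoly x (u x) ℓ' A' y| ≤ C * δ * r ^ 2 * (‖y - x‖ / r) ^ (2 + α) := by
  obtain ⟨C, hC, ε, hε, H⟩ := exists_taylor_of_near_quadPoly_unit μ O hα hα1
  refine ⟨C, hC, ε, hε, fun u φ x r a ℓ A δ hA hr hδ hδε hu hφ hP => ?_⟩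
  have hmem : ∀ z ∈ ball (0 : E) 1, x + r • z ∈ ball x r := fun z hz => by
    rw [mem_ball, dist_zero_right] at hz
    rw [mem_ball, dist_eq_norm, add_sub_cancel_left, norm_smul, Real.norm_eq_abs, abs_of_pos hr]
    exact (mul_lt_iff_lt_one_right hr).2 hz
  have hq : ∀ (c : ℝ) (m' : E →L[ℝ] ℝ) (B' : E →L[ℝ] E →L[ℝ] ℝ) (z : E),
      quadPoly x c m' B' (x + r • z) = r ^ 2 * quadPoly 0 ((r ^ 2)⁻¹ * c) (r⁻¹ • m') B' z := by
    intro c m' B' z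
    have := quadPoly_rescale x ((r ^ 2)⁻¹ * c) r (r⁻¹ • m') B' z
    rwa [mul_inv_cancel_left₀ (by positivity), smul_inv_smul₀ hr.ne'] at this
  have hsol := Sol.rescale (r := 1) hr (by rwa [mul_one])
  obtain ⟨ℓ', A', hA', hd, h⟩ := H _ _ ((r ^ 2)⁻¹ * a) (r⁻¹ • ℓ) A δ hA hδ hδε hsol
    (fun y hy => by
      have := hφ _ (hmem y hy)
      rwa [add_sub_cancel_left, norm_smul, Real.norm_eq_abs, abs_of_pos hr,
        mul_div_cancel_left₀ _ hr.ne', show φ x = φ (x + r • (0 : E)) by simp] at this)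
    (fun y hy => by
      have h1 := hP _ (hmem y hy)
      rw [hq] at h1
      have h2 : (r ^ 2)⁻¹ * u (x + r • y) - quadPoly 0 ((r ^ 2)⁻¹ * a) (r⁻¹ • ℓ) A y =
        (r ^ 2)⁻¹ * (u (x + r • y) - r ^ 2 * quadPoly 0 ((r ^ 2)⁻¹ * a) (r⁻¹ • ℓ) A y) := by
        field_simp
      rw [h2, abs_mul, abs_of_pos (by positivity), inv_mul_le_iff₀ (by positivity)]
      linarith)
  refine ⟨r • ℓ', A', hA', hd, fun y hy => ?_⟩
  have hy1 : r⁻¹ • (y - x) ∈ ball (0 : E) 1 := by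
    rw [mem_ball, dist_eq_norm] at hy
    rw [mem_ball, dist_zero_right, norm_smul, Real.norm_eq_abs, abs_of_pos (inv_pos.2 hr),
      inv_mul_lt_iff₀ hr, mul_one]
    exact hy
  have h1 := h _ hy1
  have h3 := hq (u x) (r • ℓ') A' (r⁻¹ • (y - x))
  simp only [smul_inv_smul₀ hr.ne', inv_smul_smul₀ hr.ne', smul_zero, add_zero,
    add_sub_cancel] at h1 h3
  rw [norm_smul, Real.norm_eq_abs, abs_of_pos (inv_pos.2 hr)] at h1
  have h2 : u y - r ^ 2 * quadPoly 0 ((r ^ 2)⁻¹ * u x) ℓ' A' (r⁻¹ • (y - x)) =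
      r ^ 2 * ((r ^ 2)⁻¹ * u y - quadPoly 0 ((r ^ 2)⁻¹ * u x) ℓ' A' (r⁻¹ • (y - x))) := by
    field_simp
  rw [h3, h2, abs_mul, abs_of_pos (by positivity), div_eq_inv_mul]
  calc _ ≤ r ^ 2 * (C * δ * (r⁻¹ * ‖y - x‖) ^ (2 + α)) := by gcongr
    _ = _ := by ring

end Iteration

section Limits

theorem exists_ultralimit_of_eventually_norm_le {ι G : Type*} [NormedAddCommGroup G]
    [NormedSpace ℝ G] [FiniteDimensional ℝ G] (𝒰 : Ultrafilter ι) {f : ι → G} {M : ℝ}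
    (hf : ∀ᶠ k in (𝒰 : Filter ι), ‖f k‖ ≤ M) : ∃ x, Tendsto f 𝒰 (𝓝 x) := by
  have : ProperSpace G := FiniteDimensional.proper ℝ G
  obtain ⟨x, -, h⟩ := (isCompact_closedBall (0 : G) M).ultrafilter_le_nhds (𝒰.map f) (by
    rw [le_principal_iff, Ultrafilter.mem_coe, Ultrafilter.mem_map]
    filter_upwards [hf] with k hk
    simpa using hk)
  exact ⟨x, h⟩

variable {E : Type*} [NormedAddCommGroup E] [InnerProductSpace ℝ E]

omit [InnerProductSpace ℝ E] in
theorem tendstoUniformly_of_eventually_lipschitz {ι : Type*} {𝓕 : Filter ι} {K : Set E}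
    (hK : IsCompact K) {w : ι → E → ℝ} {w' : E → ℝ} {L : ℝ} (hL : 0 ≤ L)
    (hw : ∀ᶠ k in 𝓕, ∀ x ∈ K, ∀ y ∈ K, |w k x - w k y| ≤ L * ‖x - y‖)
    (hw' : ∀ x ∈ K, ∀ y ∈ K, |w' x - w' y| ≤ L * ‖x - y‖)
    (h : ∀ x ∈ K, Tendsto (fun k => w k x) 𝓕 (𝓝 (w' x))) {η : ℝ} (hη : 0 < η) :
    ∀ᶠ k in 𝓕, ∀ x ∈ K, |w k x - w' x| < η := by
  classical
  let g : ι → E → ℝ := fun k =>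
    if ∀ x ∈ K, ∀ y ∈ K, |w k x - w k y| ≤ L * ‖x - y‖ then w k else w'
  have hg : ∀ k, ∀ x ∈ K, ∀ y ∈ K, |g k x - g k y| ≤ L * ‖x - y‖ := by
    intro k
    by_cases hk : ∀ x ∈ K, ∀ y ∈ K, |w k x - w k y| ≤ L * ‖x - y‖
    · simpa only [g, if_pos hk] using hk
    · simpa only [g, if_neg hk] using hw'
  have hgw : ∀ᶠ k in 𝓕, g k = w k := hw.mono fun k hk => by simp only [g, if_pos hk]
  have := tendstoUniformly_of_lipschitz hK hL hg hw' (fun x hx => (h x hx).congr' (by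
    filter_upwards [hgw] with k hk
    rw [hk])) hη
  filter_upwards [this, hgw] with k h1 h2
  rwa [h2] at h1

variable [FiniteDimensional ℝ E] [MeasurableSpace E] [BorelSpace E]
variable {F : (E →L[ℝ] E →L[ℝ] ℝ) → ℝ} {Adm : Set (E →L[ℝ] E →L[ℝ] ℝ)}
  {l : (E →L[ℝ] E →L[ℝ] ℝ) → (E →L[ℝ] E →L[ℝ] ℝ) →L[ℝ] ℝ} {θ Θ Λ : ℝ} {μ : Measure E}

omit [FiniteDimensional ℝ E] [BorelSpace E] in
theorem Sol.abs_sub_sub_fderiv_le {u φ : E → ℝ} {x₀ : E} {r : ℝ} (hΛ : 0 ≤ Λ)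
    (h : Sol F Adm Λ μ u φ x₀ r) {x y : E}
    (hx : x ∈ ball x₀ r) (hy : y ∈ ball x₀ r) :
    |u y - u x - fderiv ℝ u x (y - x)| ≤ Λ * ‖y - x‖ ^ 2 := by
  have hseg : segment ℝ x y ⊆ ball x₀ r := (convex_ball x₀ r).segment_subset hx hy
  have := (convex_segment x y).norm_image_sub_le_of_norm_hasFDerivWithin_le' (f := u)
    (f' := fderiv ℝ u) (φ := fderiv ℝ u x) (C := Λ * ‖y - x‖)
    (fun z hz => (h.diff z (hseg hz)).hasFDerivAt.hasFDerivWithinAt)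
    (fun z hz => (h.lip z (hseg hz) x hx).trans (by
      gcongr
      obtain ⟨t, ht, rfl⟩ := (segment_eq_image' ℝ x y).le hz
      rw [add_sub_cancel_left, norm_smul, Real.norm_eq_abs, abs_of_nonneg ht.1]
      exact mul_le_of_le_one_left (norm_nonneg _) ht.2))
    (left_mem_segment ℝ x y) (right_mem_segment ℝ x y)
  rw [Real.norm_eq_abs] at this
  linarith

omit [FiniteDimensional ℝ E] [MeasurableSpace E] [BorelSpace E] in
theorem ConcaveOperator.mem_of_near (O : ConcaveOperator F Adm l θ Θ Λ)
    {A : E →L[ℝ] E →L[ℝ] ℝ} (hA : ∀ v w, A v w = A w v) {c : ℝ}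
    (h : ∀ δ > 0, ∃ B ∈ Adm, ∃ B' ∈ Adm, |F B - c| ≤ δ ∧ |F B' - c| ≤ δ ∧
      (∀ v, B v v ≤ A v v + 18 * δ * ‖v‖ ^ 2) ∧ ∀ v, A v v - 18 * δ * ‖v‖ ^ 2 ≤ B' v v) :
    A ∈ Adm ∧ F A = c := by
  choose B hB B' hB' h1 h2 h3 h4 using fun k : ℕ => h (1 / ((k : ℝ) + 1)) (by positivity)
  have hlim : Tendsto (fun k : ℕ => 1 / ((k : ℝ) + 1)) (hyperfilter ℕ) (𝓝 0) :=
    tendsto_one_div_add_atTop_nhds_zero_nat.mono_left Nat.hyperfilter_le_atTop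
  obtain ⟨B₁, hB₁, hl₁⟩ := exists_ultralimit O.isCompact (hyperfilter ℕ) hB
  obtain ⟨B₂, hB₂, hl₂⟩ := exists_ultralimit O.isCompact (hyperfilter ℕ) hB'
  have key : ∀ {f : ℕ → E →L[ℝ] E →L[ℝ] ℝ} {X}, X ∈ Adm → Tendsto f (hyperfilter ℕ) (𝓝 X) →
      (∀ k : ℕ, |F (f k) - c| ≤ 1 / ((k : ℝ) + 1)) → F X = c := by
    intro f X hX hf hk
    have := squeeze_zero (fun k => abs_nonneg _) hk hlim
    have h' := (tendsto_zero_iff_abs_tendsto_zero _).2 this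
    have := (O.tendsto hX hf).sub_const c
    exact sub_eq_zero.1 (tendsto_nhds_unique this h')
  have e1 := key hB₁ hl₁ h1
  have e2 := key hB₂ hl₂ h2
  have hz : ∀ v : E, Tendsto (fun k : ℕ => 18 * (1 / ((k : ℝ) + 1)) * ‖v‖ ^ 2) (hyperfilter ℕ) (𝓝 0) :=
    fun v => by simpa using (hlim.const_mul 18).mul_const (‖v‖ ^ 2)
  have := O.mem_of_between B₁ hB₁ B₂ hB₂ (e1.trans e2.symm) A hA
    (fun v => le_of_tendsto_of_tendsto (tendsto_bilin_apply hl₁ v v)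
      (by simpa using (hz v).const_add (A v v)) (Eventually.of_forall fun k => h3 k v))
    (fun v => le_of_tendsto_of_tendsto (by simpa using (hz v).const_sub (A v v))
      (tendsto_bilin_apply hl₂ v v) (Eventually.of_forall fun k => h4 k v))
  exact ⟨this.1, this.2.trans e1⟩

theorem Sol.exists_global_limit [μ.IsAddHaarMeasure] (O : ConcaveOperator F Adm l θ Θ Λ) (𝒰 : Ultrafilter ℕ)
    {u φ : ℕ → E → ℝ} {R : ℕ → ℝ} {c : ℝ} (hu : ∀ k, Sol F Adm Λ μ (u k) (φ k) 0 (R k))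
    (hR : Tendsto R 𝒰 atTop) (h0 : ∀ k, u k 0 = 0) (h0' : ∀ k, fderiv ℝ (u k) 0 = 0)
    (hφ : ∀ r η : ℝ, 0 < η → ∀ᶠ k in (𝒰 : Filter ℕ), ∀ y ∈ ball (0 : E) r, |φ k y - c| ≤ η) :
    ∃ u' : E → ℝ, (∀ r, Sol F Adm Λ μ u' (fun _ => c) 0 r) ∧ u' 0 = 0 ∧ fderiv ℝ u' 0 = 0 ∧
      (∀ x, Tendsto (fun k => u k x) 𝒰 (𝓝 (u' x))) ∧
      ∀ r η : ℝ, 0 < η → ∀ᶠ k in (𝒰 : Filter ℕ), ∀ x ∈ closedBall (0 : E) r,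
        |u k x - u' x| < η := by
  have hΛ := O.Lambda_nonneg
  have hRr : ∀ r : ℝ, ∀ᶠ k in (𝒰 : Filter ℕ), ∀ x : E, ‖x‖ ≤ r → x ∈ ball (0 : E) (R k) := fun r => by
    filter_upwards [hR.eventually (eventually_gt_atTop r)] with k hk x hx
    rw [mem_ball, dist_zero_right]; linarith
  have hD : ∀ r : ℝ, ∀ᶠ k in (𝒰 : Filter ℕ), ∀ x : E, ‖x‖ ≤ r → ‖fderiv ℝ (u k) x‖ ≤ Λ * r := fun r => by
    filter_upwards [hRr r] with k hk x hx
    have := (hu k).lip x (hk x hx) 0 (hk 0 (by simpa using (norm_nonneg x).trans hx))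
    rw [h0' k, sub_zero, sub_zero] at this
    exact this.trans (by gcongr)
  have hT : ∀ x y : E, ∀ᶠ k in (𝒰 : Filter ℕ),
      |u k y - u k x - fderiv ℝ (u k) x (y - x)| ≤ Λ * ‖y - x‖ ^ 2 := fun x y => by
    filter_upwards [hRr ‖x‖, hRr ‖y‖] with k hx hy
    exact (hu k).abs_sub_sub_fderiv_le hΛ (hx x le_rfl) (hy y le_rfl)
  have hex : ∀ x, ∃ a, Tendsto (fun k => u k x) 𝒰 (𝓝 a) := fun x => by
    refine exists_ultralimit_of_eventually_norm_le 𝒰 (M := Λ * ‖x‖ ^ 2) ?_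
    filter_upwards [hT 0 x] with k hk
    simpa [h0, h0'] using hk
  choose u' hu' using hex
  have hexD : ∀ x, ∃ a, Tendsto (fun k => fderiv ℝ (u k) x) 𝒰 (𝓝 a) := fun x =>
    exists_ultralimit_of_eventually_norm_le 𝒰 (M := Λ * ‖x‖) ((hD ‖x‖).mono fun k hk => hk x le_rfl)
  choose D hDl using hexD
  have hDa : ∀ x v, Tendsto (fun k => fderiv ℝ (u k) x v) 𝒰 (𝓝 (D x v)) := fun x v =>
    ((ContinuousLinearMap.apply ℝ ℝ v).continuous.tendsto (D x)).comp (hDl x)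
  have hT' : ∀ x y, |u' y - u' x - D x (y - x)| ≤ Λ * ‖y - x‖ ^ 2 := fun x y =>
    le_of_tendsto (((hu' y).sub (hu' x)).sub (hDa x (y - x))).abs (hT x y)
  have hder : ∀ x, HasFDerivAt u' (D x) x := fun x => by
    rw [hasFDerivAt_iff_isLittleO_nhds_zero]
    have hb : (fun h => u' (x + h) - u' x - D x h) =O[𝓝 0] fun h : E => ‖h‖ ^ 2 :=
      IsBigO.of_bound Λ (Eventually.of_forall fun h => by
        simpa using hT' x (x + h))
    exact hb.trans_isLittleO (isLittleO_norm_pow_id one_lt_two)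
  have hfd : ∀ x, fderiv ℝ u' x = D x := fun x => (hder x).fderiv
  have hlip : ∀ x y, ‖fderiv ℝ u' x - fderiv ℝ u' y‖ ≤ Λ * ‖x - y‖ := fun x y => by
    rw [hfd, hfd]
    refine le_of_tendsto ((hDl x).sub (hDl y)).norm ?_
    filter_upwards [hRr ‖x‖, hRr ‖y‖] with k hx hy
    exact (hu k).lip x (hx x le_rfl) y (hy y le_rfl)
  have hunif : ∀ r η : ℝ, 0 < η → ∀ᶠ k in (𝒰 : Filter ℕ), ∀ x ∈ closedBall (0 : E) r,
      |u k x - u' x| < η := by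
    intro r η hη
    rcases lt_or_ge r 0 with hr | hr
    · simp [closedBall_eq_empty.2 hr]
    refine tendstoUniformly_of_eventually_lipschitz (isCompact_closedBall 0 r)
      (L := Λ * r) (by positivity) ?_ ?_ (fun x _ => hu' x) hη
    · filter_upwards [hD r, hRr r] with k hk hk' x hx y hy
      exact (convex_closedBall (0 : E) r).norm_image_sub_le_of_norm_fderiv_le (𝕜 := ℝ) (f := u k)
        (fun z hz => (hu k).diff z (hk' z (by simpa using hz))) (fun z hz => hk z (by simpa using hz))
        hy hx
    · intro x hx y hy
      refine (convex_closedBall (0 : E) r).norm_image_sub_le_of_norm_fderiv_le (𝕜 := ℝ) (f := u')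
        (fun z hz => (hder z).differentiableAt) (fun z hz => ?_) hy hx
      rw [hfd]
      exact le_of_tendsto (hDl z).norm ((hD r).mono fun k hk => hk z (by simpa using hz))
  refine ⟨u', fun r => ⟨fun y _ => (hder y).differentiableAt, fun y _ z _ => hlip y z, ?_⟩,
    tendsto_nhds_unique (hu' 0) (by simp [h0]), ?_, hu', hunif⟩
  · have hl : LipschitzOnWith Λ.toNNReal (fderiv ℝ u') univ :=
      LipschitzOnWith.of_dist_le_mul fun y _ z _ => by
        rw [dist_eq_norm, dist_eq_norm, Real.coe_toNNReal _ hΛ]; exact hlip y z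
    filter_upwards [C11At.ae_hasHessAt μ isOpen_univ (fun y _ => (hder y).differentiableAt) hl]
      with x hx _
    have hx := hx (mem_univ x)
    set A := fderiv ℝ (fderiv ℝ u') x with hAdef
    suffices A ∈ Adm ∧ F A = c from ⟨A, this.1, hx, this.2⟩
    obtain ⟨hA, ℓ, hℓ⟩ := hx
    refine O.mem_of_near hA fun δ hδ => ?_
    have hb := hℓ.def (half_pos hδ)
    obtain ⟨s, hs, hbs⟩ := Metric.eventually_nhds_iff_ball.1 hb
    obtain ⟨k, k1, k2, k3⟩ := ((hunif (‖x‖ + s) (δ / 2 * s ^ 2) (by positivity)).and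
      ((hRr (‖x‖ + s)).and (hφ (‖x‖ + s) δ hδ))).exists
    have hin : ∀ y ∈ ball x s, ‖y‖ < ‖x‖ + s := fun y hy => by
      rw [mem_ball, dist_eq_norm] at hy
      linarith [norm_le_norm_add_norm_sub' y x]
    have hsol : Sol F Adm Λ μ (u k) (φ k) x s := (hu k).mono fun y hy => k2 y (hin y hy).le
    obtain ⟨⟨y, hy, B, hB, hFB, h1⟩, y', hy', B', hB', hFB', h2⟩ :=
      hsol.exists_near_quadPoly hs (a := u' x) (ℓ := ℓ) hA hδ (fun y hy => by
        have e1 := k1 y (by simpa using (hin y hy).le)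
        have hys : ‖y - x‖ < s := by rwa [mem_ball, dist_eq_norm] at hy
        have e2 := hbs (y - x) (by simpa using hys)
        rw [add_sub_cancel, Real.norm_eq_abs, Real.norm_eq_abs, abs_of_nonneg (sq_nonneg ‖y - x‖)] at e2
        have e3 : δ / 2 * ‖y - x‖ ^ 2 ≤ δ / 2 * s ^ 2 := by gcongr
        have e4 := abs_lt.1 e1
        have e5 := abs_le.1 (e2.trans e3)
        simp only [quadPoly]
        rw [abs_le]
        constructor <;> linarith [e4.1, e4.2, e5.1, e5.2])
    refine ⟨B, hB, B', hB', ?_, ?_, h1, h2⟩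
    · rw [hFB]; exact k3 y (by simpa using hin y hy)
    · rw [hFB']; exact k3 y' (by simpa using hin y' hy')
  · rw [hfd]
    exact tendsto_nhds_unique (hDl 0) (by simp [h0'])

end Limits

section StrictDeficit

variable {E : Type*} [NormedAddCommGroup E] [InnerProductSpace ℝ E]

omit [InnerProductSpace ℝ E] in
theorem quadPoly_recenter [NormedSpace ℝ E] (x z : E) (a : ℝ) (ℓ : E →L[ℝ] ℝ) {B : E →L[ℝ] E →L[ℝ] ℝ}
    (hB : ∀ v w, B v w = B w v) (y : E) :
    quadPoly z (quadPoly x a ℓ B z) (ℓ + B (z - x)) B y = quadPoly x a ℓ B y := by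
  have e : y - x = (y - z) + (z - x) := by abel
  simp only [quadPoly, e, map_add, add_apply]
  rw [hB (z - x) (y - z)]
  ring

variable [FiniteDimensional ℝ E] [MeasurableSpace E] [BorelSpace E] (μ : Measure E)
  [μ.IsAddHaarMeasure]

/-- If a second difference of a `C^{1,1}` function is smaller than `t`, then so is the second
derivative at some generic point. -/
theorem exists_hessian_lt_of_secDiff_lt {u : E → ℝ} (hu : ∀ x, C11At u x) {Q : E → Prop}
    (hQ : ∀ᵐ x ∂μ, Q x) {x₀ ξ : E} (hξ : ξ ≠ 0) {t : ℝ} (h : secDiff u x₀ ξ < t) :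
    ∃ y, Q y ∧ ∀ X, HasHessAt u y X → X ξ ξ < t := by
  have hn : 0 < ‖ξ‖ ^ 2 := by have := norm_pos_iff.2 hξ; positivity
  set n := ‖ξ‖ ^ 2 with hndef
  let s : E →L[ℝ] ℝ := n⁻¹ • innerSL ℝ ξ
  have hsξ : s ξ = 1 := by
    simp [s, ← hndef, hn.ne']
  let N : E → ℝ := fun x => ‖x - x₀ - s (x - x₀) • ξ‖ ^ 2
  have hN : ∀ x, N x = ‖x - x₀‖ ^ 2 - n * s (x - x₀) ^ 2 := fun x => by
    have h1 : inner ℝ (x - x₀) ξ = n * s (x - x₀) := by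
      simp only [s, smul_apply, smul_eq_mul, innerSL_apply_apply]
      rw [mul_inv_cancel_left₀ hn.ne', real_inner_comm]
    simp only [N]
    rw [norm_sub_sq_real, inner_smul_right, h1, norm_smul, mul_pow, ← hndef, Real.norm_eq_abs,
      sq_abs]
    ring
  have hucont : Continuous u := continuous_iff_continuousAt.2 fun x => (hu x).continuousAt
  have hNcont : Continuous N := by fun_prop
  set m := (u (x₀ + ξ) - u (x₀ - ξ)) / 2 with hm
  set a := (u (x₀ + ξ) + u (x₀ - ξ)) / 2 - t / 2 with ha
  set γ := u x₀ - a with hγ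
  have hγ0 : 0 < γ := by
    simp only [secDiff] at h
    rw [hγ, ha]; linarith
  let ψ : E → ℝ := fun x => u x - (a + m * s (x - x₀) + t / 2 * s (x - x₀) ^ 2)
  have hψ : Continuous ψ := by fun_prop
  have hscont : Continuous fun x => |s (x - x₀)| := by fun_prop
  let K : Set E := {x | |s (x - x₀)| ≤ 1 ∧ N x ≤ 1}
  have hKclosed : IsClosed K :=
    (isClosed_le hscont continuous_const).inter (isClosed_le hNcont continuous_const)
  have hK : IsCompact K := by
    refine (isCompact_closedBall x₀ (1 + n)).of_isClosed_subset hKclosed fun x hx => ?_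
    rw [mem_closedBall, dist_eq_norm]
    have h1 : ‖x - x₀‖ ^ 2 ≤ 1 + n := by
      have := hN x
      have h2 : s (x - x₀) ^ 2 ≤ 1 := (sq_le_one_iff_abs_le_one _).2 hx.1
      nlinarith [hx.2]
    nlinarith [norm_nonneg (x - x₀)]
  have hKint : ∀ x ∈ K, x ∉ interior K → |s (x - x₀)| = 1 ∨ N x = 1 := by
    intro x hx hxi
    by_contra hcon
    push Not at hcon
    refine hxi (mem_interior.2 ⟨{x | |s (x - x₀)| < 1 ∧ N x < 1}, fun y hy => ⟨hy.1.le, hy.2.le⟩,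
      (isOpen_lt hscont continuous_const).inter (isOpen_lt hNcont continuous_const),
      lt_of_le_of_ne hx.1 hcon.1, lt_of_le_of_ne hx.2 hcon.2⟩)
  obtain ⟨Ψ, hΨ⟩ := hK.exists_bound_of_continuousOn hψ.continuousOn
  let Z : Set E := K ∩ {x | (|s (x - x₀)| = 1 ∨ N x = 1) ∧ γ / 2 ≤ ψ x}
  have hZ : IsCompact Z := hK.inter_right
    (((isClosed_eq hscont continuous_const).union
      (isClosed_eq hNcont continuous_const)).inter (isClosed_le continuous_const hψ))
  obtain ⟨δ, hδ, hδZ⟩ : ∃ δ > 0, ∀ x ∈ Z, δ ≤ N x := by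
    refine hZ.exists_forall_le' hNcont.continuousOn fun x hx => ?_
    have h0 : 0 ≤ N x := sq_nonneg _
    refine h0.lt_of_ne fun hNx => ?_
    have hx' : x - x₀ = s (x - x₀) • ξ := by
      have : ‖x - x₀ - s (x - x₀) • ξ‖ = 0 := by simpa [N] using hNx.symm
      exact sub_eq_zero.1 (norm_eq_zero.1 this)
    have hs1 : |s (x - x₀)| = 1 := hx.2.1.resolve_right (by rw [← hNx]; norm_num)
    have hx2 : x = x₀ + s (x - x₀) • ξ := by rw [← hx', add_sub_cancel]
    have hψx : ψ x = 0 := by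
      rcases (abs_eq zero_le_one).1 hs1 with h1 | h1
      · rw [h1, one_smul] at hx2
        simp only [ψ, h1, hm, ha]
        rw [show u x = u (x₀ + ξ) by rw [← hx2]]
        ring
      · rw [h1, neg_one_smul, ← sub_eq_add_neg] at hx2
        simp only [ψ, h1, hm, ha]
        rw [show u x = u (x₀ - ξ) by rw [← hx2]]
        ring
    have := hx.2.2
    linarith
  set M := (|Ψ| + 1) / δ with hM
  have hM0 : 0 < M := by positivity
  let B : E →L[ℝ] E →L[ℝ] ℝ :=
    (-(t - γ / 2) + 2 * M * n) • s.smulRight s + (-(2 * M)) • idForm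
  have hBapp : ∀ v w, B v w = (-(t - γ / 2) + 2 * M * n) * (s v * s w) - 2 * M * idForm v w := by
    intro v w
    simp only [B, add_apply, smul_apply, smul_eq_mul, ContinuousLinearMap.smulRight_apply]
    ring
  have hBsym : ∀ v w, B v w = B w v := fun v w => by
    rw [hBapp, hBapp, idForm_symm, mul_comm (s v)]
  set q := quadPoly x₀ (-a) (-(m • s)) B with hq
  have hΦ : ∀ x, u x + q x = ψ x + γ / 4 * s (x - x₀) ^ 2 - M * N x := fun x => by
    simp only [hq, quadPoly, hBapp, idForm_self, neg_apply, smul_apply, smul_eq_mul, ψ, hN]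
    ring
  have hx₀K : x₀ ∈ K := by simp [K, N]
  obtain ⟨y, hy, hQy, p, hmax⟩ := exists_isLocalMax_sub_linear μ hK (φ := fun x => u x + q x)
    (fun x _ => (hu x).add (contDiff_quadPoly x₀ _ _ _).contDiffAt.c11At) hx₀K (fun x hx hxi => by
      have hb := hKint x hx hxi
      have h2 : s (x - x₀) ^ 2 ≤ 1 := (sq_le_one_iff_abs_le_one _).2 hx.1
      have hN0 : 0 ≤ N x := sq_nonneg _
      have e0 : u x₀ + q x₀ = γ := by rw [hΦ]; simp [ψ, N, hγ]
      rw [e0, hΦ]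
      by_cases hZx : γ / 2 ≤ ψ x
      · have h3 := hδZ x ⟨hx, hb, hZx⟩
        have h4 : |Ψ| + 1 ≤ M * N x := by
          calc |Ψ| + 1 = M * δ := by rw [hM]; field_simp
            _ ≤ _ := by gcongr
        have h5 := (le_abs_self _).trans (hΨ x hx)
        have h6 := le_abs_self Ψ
        nlinarith
      · push Not at hZx
        have : 0 ≤ M * N x := by positivity
        nlinarith) (Q := Q) (hQ.mono fun x hx _ => hx)
  refine ⟨y, hQy, fun X hX => ?_⟩
  have := (hX.add (hasHessAt_quadPoly x₀ (-a) (-(m • s)) hBsym y)).nonpos_of_isLocalMax hmax ξ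
  rw [add_apply, add_apply, hBapp, hsξ, idForm_self, ← hndef] at this
  linarith

end StrictDeficit

section DeficitPropagation

variable {E : Type*} [NormedAddCommGroup E] [InnerProductSpace ℝ E]

theorem HasHessAt.comp_add_left {u : E → ℝ} {a x : E} {B : E →L[ℝ] E →L[ℝ] ℝ}
    (h : HasHessAt u (a + x) B) : HasHessAt (fun y => u (a + y)) x B := by
  have h1 : HasHessAt u (a + (1 : ℝ) • x) B := by rwa [one_smul]
  simpa using h1.comp_affine

theorem C11At.comp_add_left {u : E → ℝ} {a x : E} (h : C11At u (a + x)) :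
    C11At (fun y => u (a + y)) x := by
  have h1 : C11At u (a + ContinuousLinearMap.id ℝ E x) := h
  exact h1.comp_affine

theorem hasHessAt_exp_neg_norm_sq (K : ℝ) (y x : E) :
    HasHessAt (fun z => Real.exp (-(K * ‖z - y‖ ^ 2))) x
      (Real.exp (-(K * ‖x - y‖ ^ 2)) •
        ((4 * K ^ 2) • (innerSL ℝ (x - y)).smulRight (innerSL ℝ (x - y)) - (2 * K) • idForm)) := by
  have h1 : ∀ z, HasFDerivAt (fun z => Real.exp (-(K * ‖z - y‖ ^ 2)))
      (Real.exp (-(K * ‖z - y‖ ^ 2)) • -(K • (2 : ℝ) • innerSL ℝ (z - y))) z := fun z => by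
    have := (((hasFDerivAt_id z).sub_const y).norm_sq.const_mul K).neg.exp
    refine this.congr_fderiv ?_
    ext w
    simp
  have h3 : HasFDerivAt (fun z => -(K • (2 : ℝ) • innerSL ℝ (z - y)))
      (-(K • (2 : ℝ) • (innerSL ℝ : E →L[ℝ] E →L[ℝ] ℝ))) x :=
    ((((innerSL ℝ : E →L[ℝ] E →L[ℝ] ℝ).hasFDerivAt.comp x
      ((hasFDerivAt_id x).sub_const y)).const_smul (2 : ℝ)).const_smul K).neg
  have h4 := (h1 x).smul h3
  replace h4 := h4.congr_of_eventuallyEq (f₁ := fderiv ℝ (fun z => Real.exp (-(K * ‖z - y‖ ^ 2))))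
    (Eventually.of_forall fun z => (h1 z).fderiv)
  have h5 := hasHessAt_of_differentiableAt_fderiv
    (Eventually.of_forall fun z => (h1 z).differentiableAt) h4.differentiableAt
  rw [h4.fderiv] at h5
  convert h5 using 1
  ext v w
  simp only [smul_apply, sub_apply, add_apply, neg_apply, smul_eq_mul,
    ContinuousLinearMap.smulRight_apply, innerSL_apply_apply]
  have : idForm v w = inner ℝ v w := rfl
  have h6 : (innerSL ℝ : E →L[ℝ] E →L[ℝ] ℝ) v w = inner ℝ v w := rfl
  rw [this]
  rw [h6]
  ring

theorem barrier_hessian_pos {θ Θ K : ℝ} {l : (E →L[ℝ] E →L[ℝ] ℝ) →L[ℝ] ℝ} (hl : IsElliptic θ Θ l)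
    (hK : 0 < K) {p : E} (hp : Θ < 2 * K * θ * ‖p‖ ^ 2) :
    0 < l ((4 * K ^ 2) • (innerSL ℝ p).smulRight (innerSL ℝ p) - (2 * K) • idForm) := by
  have h1 : θ * ‖p‖ ^ 2 ≤ l ((innerSL ℝ p).smulRight (innerSL ℝ p)) := by
    have := hl.lower ((innerSL ℝ p).smulRight (innerSL ℝ p))
      (fun v w => by simp [mul_comm]) (fun v => by simp [mul_self_nonneg]) (‖p‖⁻¹ • p) (by
        rw [norm_smul, norm_inv, norm_norm]; exact inv_mul_le_one)
    refine le_trans (le_of_eq ?_) this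
    by_cases h0 : p = 0
    · simp [h0]
    have h0' := norm_ne_zero_iff.2 h0
    simp only [ContinuousLinearMap.smulRight_apply, innerSL_apply_apply, inner_smul_right,
      real_inner_self_eq_norm_sq, smul_apply, smul_eq_mul]
    field_simp
  rw [functional_sub, map_smul, map_smul, smul_eq_mul, smul_eq_mul]
  have h2 := hl.upper
  nlinarith [mul_le_mul_of_nonneg_left h1 (sq_nonneg K)]

variable [FiniteDimensional ℝ E] [MeasurableSpace E] [BorelSpace E] (μ : Measure E)
  [μ.IsAddHaarMeasure]
variable {F : (E →L[ℝ] E →L[ℝ] ℝ) → ℝ} {Adm : Set (E →L[ℝ] E →L[ℝ] ℝ)}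
  {l : (E →L[ℝ] E →L[ℝ] ℝ) → (E →L[ℝ] E →L[ℝ] ℝ) →L[ℝ] ℝ} {θ Θ Λ : ℝ}

/-- If the second derivative in direction `ξ` is smaller than `t` at some generic point, then all
small second differences in direction `ξ` near this point are uniformly smaller than `t`. -/
theorem Sol.exists_deficit [Nontrivial E] (O : ConcaveOperator F Adm l θ Θ Λ) {u : E → ℝ} {c : ℝ}
    (hu : ∀ x r, Sol F Adm Λ μ u (fun _ => c) x r) {y ξ : E} {t : ℝ} {B : E →L[ℝ] E →L[ℝ] ℝ}
    (hB : HasHessAt u y B) (ht : B ξ ξ < t) :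
    ∃ η > 0, ∃ r > 0, ∀ z ∈ ball y r, ∀ h : ℝ, |h| < r →
      secDiff u z (h • ξ) ≤ (t - η) * h ^ 2 := by
  obtain ⟨C, hC, ε, hε, H⟩ := exists_taylor_of_near_quadPoly μ O (α := 1 / 2) (by norm_num)
    (by norm_num)
  obtain ⟨hBs, ℓ, hℓ⟩ := hB
  set η := (t - B ξ ξ) / 2 with hη
  have hη0 : 0 < η := by linarith
  obtain ⟨δ, hδ, hδε, hδη⟩ : ∃ δ > 0, δ ≤ ε ∧ 3 * C * δ * ‖ξ‖ ^ 2 ≤ η := by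
    refine ⟨min ε (η / (3 * C * (‖ξ‖ ^ 2 + 1))), by positivity, min_le_left _ _, ?_⟩
    have h1 := min_le_right ε (η / (3 * C * (‖ξ‖ ^ 2 + 1)))
    rw [le_div_iff₀ (by positivity)] at h1
    have h2 : 0 ≤ min ε (η / (3 * C * (‖ξ‖ ^ 2 + 1))) * (3 * C) := by positivity
    linarith
  have h1 := hℓ.bound (show 0 < δ / 4 by positivity)
  obtain ⟨s, hs, h1⟩ := Metric.eventually_nhds_iff.1 h1
  set r := s / 2 with hr
  have hr0 : 0 < r := by positivity
  refine ⟨η, hη0, min r (r / (‖ξ‖ + 1)), by positivity, fun z hz h hh => ?_⟩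
  have hzr : ‖z - y‖ < r := by
    rw [← dist_eq_norm]; exact lt_of_lt_of_le hz (min_le_left _ _)
  obtain ⟨ℓ', A', hA', hAA, hT⟩ := H u (fun _ => c) z r (quadPoly y (u y) ℓ B z) (ℓ + B (z - y)) B δ
    hBs hr0 hδ hδε (hu z r) (fun w _ => by rw [sub_self, abs_zero]; positivity) (fun w hw => by
      rw [quadPoly_recenter _ _ _ _ hBs]
      have hw' : ‖w - y‖ < s := by
        rw [mem_ball, dist_eq_norm] at hw
        calc ‖w - y‖ = ‖(w - z) + (z - y)‖ := by congr 1; abel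
          _ ≤ ‖w - z‖ + ‖z - y‖ := norm_add_le _ _
          _ < s := by linarith
      have h2 := h1 (y := w - y) (by rwa [dist_zero_right])
      rw [add_sub_cancel, Real.norm_eq_abs, norm_pow, norm_norm] at h2
      have e : u w - quadPoly y (u y) ℓ B w = u w - u y - ℓ (w - y) - 1 / 2 * B (w - y) (w - y) := by
        simp only [quadPoly]; ring
      rw [e]
      refine h2.trans ?_
      have h3 : ‖w - y‖ ^ 2 ≤ (2 * r) ^ 2 := by
        apply pow_le_pow_left₀ (norm_nonneg _); linarith
      nlinarith)
  set v := h • ξ with hv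
  have hvr : ‖v‖ < r := by
    rw [hv, norm_smul, Real.norm_eq_abs]
    have h2 := lt_of_lt_of_le hh (min_le_right _ _)
    rw [lt_div_iff₀ (by positivity)] at h2
    nlinarith [abs_nonneg h]
  have hr' : ‖v‖ / r ≤ 1 := (div_le_one hr0).2 hvr.le
  have hb : C * δ * r ^ 2 * (‖v‖ / r) ^ (2 + 1 / 2 : ℝ) ≤ C * δ * ‖v‖ ^ 2 := by
    have h3 : (‖v‖ / r) ^ (2 + 1 / 2 : ℝ) ≤ (‖v‖ / r) ^ 2 := by
      rw [← Real.rpow_natCast]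
      refine Real.rpow_le_rpow_of_exponent_ge' (by positivity) hr' (by norm_num) (by norm_num)
    calc _ ≤ C * δ * r ^ 2 * (‖v‖ / r) ^ 2 := by gcongr
      _ = _ := by field_simp
  have hp := hT (z + v) (by rw [mem_ball, dist_eq_norm, add_sub_cancel_left]; exact hvr)
  have hm := hT (z - v) (by
    rw [mem_ball, dist_eq_norm, sub_sub_cancel_left, norm_neg]; exact hvr)
  rw [add_sub_cancel_left] at hp
  rw [sub_sub_cancel_left, norm_neg] at hm
  have hp' := (le_abs_self _).trans (hp.trans hb)
  have hm' := (le_abs_self _).trans (hm.trans hb)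
  simp only [quadPoly, add_sub_cancel_left, sub_sub_cancel_left, map_neg, neg_apply] at hp' hm'
  have hAv : A' v v ≤ B v v + C * δ * ‖v‖ ^ 2 := by
    have h3 := (le_abs_self _).trans (bilin_le_norm (A' - B) v)
    rw [sub_apply, sub_apply] at h3
    have h4 : ‖A' - B‖ * ‖v‖ ^ 2 ≤ C * δ * ‖v‖ ^ 2 := by gcongr
    linarith
  have hBv : B v v = h ^ 2 * B ξ ξ := by
    rw [hv, map_smul, map_smul, smul_apply, smul_eq_mul, smul_eq_mul]; ring
  have hnv : ‖v‖ ^ 2 = h ^ 2 * ‖ξ‖ ^ 2 := by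
    rw [hv, norm_smul, mul_pow, Real.norm_eq_abs, sq_abs]
  have h5 : 3 * C * δ * ‖v‖ ^ 2 ≤ η * h ^ 2 := by
    rw [hnv]; nlinarith [sq_nonneg h]
  have h6 : t - η = B ξ ξ + η := by rw [hη]; ring
  rw [secDiff, h6]
  linarith

omit μ [FiniteDimensional ℝ E] [BorelSpace E] [μ.IsAddHaarMeasure] in
omit [InnerProductSpace ℝ E] [MeasurableSpace E] in
theorem annulus_not_mem_interior {y x : E} {ρ R : ℝ} (hx : x ∈ closedBall y R \ ball y ρ)
    (hxi : x ∉ interior (closedBall y R \ ball y ρ)) : ‖x - y‖ = R ∨ ‖x - y‖ = ρ := by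
  by_contra hcon
  push Not at hcon
  rw [Set.mem_sdiff, mem_closedBall, mem_ball, dist_eq_norm, not_lt] at hx
  have hc : Continuous fun z : E => ‖z - y‖ := by fun_prop
  refine hxi (mem_interior.2 ⟨{z | ‖z - y‖ < R ∧ ρ < ‖z - y‖}, fun z hz => ?_,
    (isOpen_lt hc continuous_const).inter (isOpen_lt continuous_const hc),
    lt_of_le_of_ne hx.1 hcon.1, lt_of_le_of_ne hx.2 hcon.2.symm⟩)
  rw [Set.mem_sdiff, mem_closedBall, mem_ball, dist_eq_norm, not_lt]
  exact ⟨hz.1.le, hz.2.le⟩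

/-- Second differences of entire solutions are subsolutions of a linearized equation, so a
deficit on a small ball propagates. -/
theorem Sol.propagate_deficit (O : ConcaveOperator F Adm l θ Θ Λ) {u : E → ℝ} {c : ℝ}
    (hu : ∀ x r, Sol F Adm Λ μ u (fun _ => c) x r) {y ξ : E} {t η r : ℝ} (hη : 0 < η) (hr : 0 < r)
    (h1 : ∀ x (h : ℝ), secDiff u x (h • ξ) ≤ t * h ^ 2)
    (h2 : ∀ z ∈ ball y r, ∀ h : ℝ, |h| < r → secDiff u z (h • ξ) ≤ (t - η) * h ^ 2) :
    ∃ η' > 0, ∀ x ∈ closedBall (0 : E) 1, ∀ h : ℝ, |h| < r →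
      secDiff u x (h • ξ) ≤ (t - η') * h ^ 2 := by
  set ρ := r / 2 with hρ
  have hρ0 : 0 < ρ := by positivity
  set R := ‖y‖ + 2 with hR
  have hθ := O.theta_pos
  have hΘ := O.Theta_nonneg
  obtain ⟨K, hK, hKρ⟩ : ∃ K > 0, Θ < 2 * K * θ * ρ ^ 2 := by
    refine ⟨(Θ + 1) / (2 * θ * ρ ^ 2), by positivity, ?_⟩
    have : 2 * ((Θ + 1) / (2 * θ * ρ ^ 2)) * θ * ρ ^ 2 = Θ + 1 := by field_simp
    linarith
  set b := Real.exp (-(K * (R - 1) ^ 2)) - Real.exp (-(K * R ^ 2)) with hb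
  have hb0 : 0 < b := by
    rw [hb, sub_pos, Real.exp_lt_exp]
    have := norm_nonneg y
    nlinarith
  have hb1 : b ≤ 1 := by
    have h3 : Real.exp (-(K * (R - 1) ^ 2)) ≤ 1 := Real.exp_le_one_iff.2 (by
      have : 0 ≤ K * (R - 1) ^ 2 := by positivity
      linarith)
    have := Real.exp_pos (-(K * R ^ 2))
    linarith
  refine ⟨η * b, by positivity, fun x₀ hx₀ h hh => ?_⟩
  rcases eq_or_ne h 0 with rfl | h0
  · simp only [secDiff, zero_smul, add_zero, sub_zero]
    norm_num
    linarith
  have hh2 : 0 < h ^ 2 := by positivity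
  by_contra hcon
  push Not at hcon
  let β : E → ℝ := fun z => Real.exp (-(K * ‖z - y‖ ^ 2))
  let φ : E → ℝ := fun x => (h ^ 2)⁻¹ * ((u (h • ξ + x) + u (-(h • ξ) + x)) - 2 * u x) + η * β x
  have hφ : ∀ x, φ x = (h ^ 2)⁻¹ * secDiff u x (h • ξ) + η * β x := fun x => by
    simp only [φ, secDiff]
    rw [add_comm (h • ξ), sub_eq_neg_add x]
  have hle : ∀ x s, secDiff u x (h • ξ) ≤ s * h ^ 2 → φ x ≤ s + η * β x := fun x s hs => by
    rw [hφ]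
    have : (h ^ 2)⁻¹ * secDiff u x (h • ξ) ≤ s := by
      rw [inv_mul_le_iff₀ hh2]; linarith
    linarith
  have hx₀R : ‖x₀ - y‖ ≤ R - 1 := by
    rw [mem_closedBall, dist_zero_right] at hx₀
    have := norm_sub_le x₀ y
    linarith
  have hx₀φ : t + η * Real.exp (-(K * R ^ 2)) < φ x₀ := by
    have h3 : t - η * b < (h ^ 2)⁻¹ * secDiff u x₀ (h • ξ) := by
      rw [lt_inv_mul_iff₀ hh2]; linarith
    have h4 : Real.exp (-(K * (R - 1) ^ 2)) ≤ β x₀ := by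
      apply Real.exp_le_exp.2
      have : ‖x₀ - y‖ ^ 2 ≤ (R - 1) ^ 2 := pow_le_pow_left₀ (norm_nonneg _) hx₀R 2
      nlinarith
    rw [hφ]
    have h5 := mul_le_mul_of_nonneg_left h4 hη.le
    have h6 : η * b = η * Real.exp (-(K * (R - 1) ^ 2)) - η * Real.exp (-(K * R ^ 2)) := by
      rw [hb]; ring
    linarith
  have hx₀ρ : ¬ ‖x₀ - y‖ < ρ := fun hlt => by
    have h3 := h2 x₀ (by rw [mem_ball, dist_eq_norm]; linarith) h hh
    have h4 : η * b ≤ η := mul_le_of_le_one_right hη.le hb1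
    nlinarith
  have hc11 : ∀ x, C11At u x := fun x => (hu x 1).c11At (mem_ball_self one_pos)
  have hae : ∀ᵐ x ∂μ, ∃ B ∈ Adm, HasHessAt u x B ∧ F B = c := by
    have h3 : ∀ᵐ x ∂μ, ∀ k : ℕ, x ∈ ball (0 : E) k → ∃ B ∈ Adm, HasHessAt u x B ∧ F B = c :=
      ae_all_iff.2 fun k => (hu 0 k).ae
    filter_upwards [h3] with x hx
    obtain ⟨k, hk⟩ := exists_nat_gt ‖x‖
    exact hx k (by rwa [mem_ball, dist_zero_right])
  have hβ : ∀ x, C11At β x := fun x => by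
    have : ContDiff ℝ 2 β :=
      Real.contDiff_exp.comp ((contDiff_const_mul_norm_sq K y).neg.of_le le_top)
    exact this.contDiffAt.c11At
  obtain ⟨x, hx, ⟨⟨B₀, hB₀, hH₀, hF₀⟩, ⟨B₁, hB₁, hH₁, hF₁⟩, ⟨B₂, hB₂, hH₂, hF₂⟩⟩, p, hmax⟩ :=
    exists_isLocalMax_sub_linear μ (K := closedBall y R \ ball y ρ) (φ := φ) (x₀ := x₀)
      ((isCompact_closedBall y R).diff isOpen_ball)
      (fun x _ => (((hc11 _).comp_add_left.add (hc11 _).comp_add_left).sub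
        ((hc11 _).const_mul 2)).const_mul _ |>.add ((hβ x).const_mul η))
      ⟨by rw [mem_closedBall, dist_eq_norm]; linarith, by rwa [mem_ball, dist_eq_norm]⟩
      (fun x hx hxi => by
        refine lt_of_le_of_lt ?_ hx₀φ
        rcases annulus_not_mem_interior hx hxi with h3 | h3
        · have := hle x t (h1 x h)
          simpa only [β, h3] using this
        · have h4 := hle x (t - η) (h2 x (by rw [mem_ball, dist_eq_norm]; linarith) h hh)
          have h5 : β x ≤ 1 := Real.exp_le_one_iff.2 (by
            have : 0 ≤ K * ‖x - y‖ ^ 2 := by positivity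
            linarith)
          have h6 : η * β x ≤ η := mul_le_of_le_one_right hη.le h5
          have h7 : 0 ≤ η * Real.exp (-(K * R ^ 2)) := by positivity
          linarith)
      (Q := fun x => (∃ B ∈ Adm, HasHessAt u x B ∧ F B = c) ∧
        (∃ B ∈ Adm, HasHessAt u (h • ξ + x) B ∧ F B = c) ∧
        (∃ B ∈ Adm, HasHessAt u (-(h • ξ) + x) B ∧ F B = c))
      (by
        filter_upwards [hae, ae_comp_affine μ hae (h • ξ) (one_ne_zero (α := ℝ)),
          ae_comp_affine μ hae (-(h • ξ)) (one_ne_zero (α := ℝ))] with x a1 a2 a3 _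
        rw [one_smul] at a2 a3
        exact ⟨a1, a2, a3⟩)
  have hH := (((hH₁.comp_add_left.add hH₂.comp_add_left).sub (hH₀.const_mul 2)).const_mul
    (h ^ 2)⁻¹).add ((hasHessAt_exp_neg_norm_sq K y x).const_mul η)
  have hneg := hH.nonpos_of_isLocalMax hmax
  have hsym := hH.1
  have hel := O.elliptic B₀ hB₀
  set Y := (h ^ 2)⁻¹ • (B₁ + B₂ - (2 : ℝ) • B₀) with hY
  set X := (4 * K ^ 2) • (innerSL ℝ (x - y)).smulRight (innerSL ℝ (x - y)) - (2 * K) • idForm with hX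
  set e := Real.exp (-(K * ‖x - y‖ ^ 2))
  have hxρ : ρ ≤ ‖x - y‖ := by
    have := (interior_subset hx).2
    rwa [mem_ball, dist_eq_norm, not_lt] at this
  have hlX : 0 < l B₀ X := by
    refine barrier_hessian_pos hel hK (hKρ.trans_le ?_)
    gcongr
  have hlY : 0 ≤ l B₀ Y := by
    have c1 := O.concave B₀ hB₀ B₁ hB₁
    have c2 := O.concave B₀ hB₀ B₂ hB₂
    have eY : Y = (h ^ 2)⁻¹ • ((B₁ - B₀) + (B₂ - B₀)) := by
      ext v w
      simp only [hY, smul_apply, sub_apply, add_apply, smul_eq_mul]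
      ring
    rw [eY, map_smul, map_add, smul_eq_mul]
    have : 0 < (h ^ 2)⁻¹ := by positivity
    apply mul_nonneg this.le
    linarith
  have hnn := hel.nonneg (X := -(Y + η • e • X)) (fun v w => by
      rw [neg_apply, neg_apply, neg_apply, neg_apply, hsym v w])
    (fun v => by rw [neg_apply, neg_apply]; linarith [hneg v])
  rw [functional_neg, map_add, map_smul _ η, map_smul _ e, smul_eq_mul, smul_eq_mul] at hnn
  have he : 0 < e := Real.exp_pos _
  have : 0 < η * (e * l B₀ X) := by positivity
  linarith

end DeficitPropagation

section Liouville

variable {E : Type*} [NormedAddCommGroup E] [InnerProductSpace ℝ E]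

/-- `u` is within `δ r²` of a quadratic polynomial on the closed ball of radius `r`. -/
def Flat (δ : ℝ) (u : E → ℝ) (x : E) (r : ℝ) : Prop :=
  ∃ (a : ℝ) (ℓ : E →L[ℝ] ℝ) (A : E →L[ℝ] E →L[ℝ] ℝ), (∀ v w, A v w = A w v) ∧
    ∀ y ∈ closedBall x r, |u y - quadPoly x a ℓ A y| < δ * r ^ 2

theorem Flat.eventually [FiniteDimensional ℝ E] {δ r : ℝ} {u' : E → ℝ} {x : E}
    (h : Flat δ u' x r) (hu' : ContinuousOn u' (closedBall x r)) (hr : 0 ≤ r) {ι : Type*}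
    {L : Filter ι} {u : ι → E → ℝ}
    (hu : ∀ η : ℝ, 0 < η → ∀ᶠ k in L, ∀ y ∈ closedBall x r, |u k y - u' y| < η) :
    ∀ᶠ k in L, Flat δ (u k) x r := by
  obtain ⟨a, ℓ, A, hA, h⟩ := h
  have hc : ContinuousOn (fun y => |u' y - quadPoly x a ℓ A y|) (closedBall x r) :=
    (hu'.sub (contDiff_quadPoly (n := 2) x a ℓ A).continuous.continuousOn).abs
  obtain ⟨y₀, hy₀, hmax⟩ := (isCompact_closedBall x r).exists_isMaxOn
    (nonempty_closedBall.2 hr) hc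
  filter_upwards [hu _ (sub_pos.2 (h y₀ hy₀))] with k hk
  refine ⟨a, ℓ, A, hA, fun y hy => ?_⟩
  have h1 := hk y hy
  have h2 : |u' y - quadPoly x a ℓ A y| ≤ |u' y₀ - quadPoly x a ℓ A y₀| := hmax hy
  calc |u k y - quadPoly x a ℓ A y| = |(u k y - u' y) + (u' y - quadPoly x a ℓ A y)| := by
        congr 1; ring
    _ ≤ |u k y - u' y| + |u' y - quadPoly x a ℓ A y| := abs_add_le _ _
    _ < δ * r ^ 2 := by linarith

theorem secDiff_dilate (u : E → ℝ) (s : ℝ) (x v : E) :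
    secDiff (fun z => (s ^ 2)⁻¹ * u (s • z)) x v = (s ^ 2)⁻¹ * secDiff u (s • x) (s • v) := by
  simp only [secDiff, smul_add, smul_sub]
  ring

theorem fderiv_dilate (u : E → ℝ) {s : ℝ} (h : DifferentiableAt ℝ u 0) (h0 : fderiv ℝ u 0 = 0) :
    fderiv ℝ (fun z => (s ^ 2)⁻¹ * u (s • z)) 0 = 0 := by
  have h1 : HasFDerivAt u (0 : E →L[ℝ] ℝ) (s • (0 : E)) := by
    rw [smul_zero, ← h0]; exact h.hasFDerivAt
  have h2 := (h1.comp (0 : E) ((hasFDerivAt_id (𝕜 := ℝ) (0 : E)).const_smul s)).const_mul (s ^ 2)⁻¹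
  have h3 := h2.fderiv
  simp only [ContinuousLinearMap.zero_comp, smul_zero] at h3
  exact h3

theorem Flat.of_dilate {δ s r : ℝ} (hs : 0 < s) {u : E → ℝ}
    (h : Flat δ (fun z => (s ^ 2)⁻¹ * u (s • z)) 0 r) : Flat δ u 0 (s * r) := by
  obtain ⟨a, ℓ, A, hA, h⟩ := h
  refine ⟨s ^ 2 * a, s • ℓ, A, hA, fun y hy => ?_⟩
  have h1 := h (s⁻¹ • y) (by
    rw [mem_closedBall, dist_zero_right] at hy ⊢
    rw [norm_smul, norm_inv, Real.norm_eq_abs, abs_of_pos hs, inv_mul_le_iff₀ hs]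
    exact hy)
  simp only [smul_smul, mul_inv_cancel₀ hs.ne', one_smul] at h1
  have e : u y - quadPoly 0 (s ^ 2 * a) (s • ℓ) A y =
      s ^ 2 * ((s ^ 2)⁻¹ * u y - quadPoly 0 a ℓ A (s⁻¹ • y)) := by
    simp only [quadPoly, sub_zero, map_smul, smul_apply, smul_eq_mul]
    field_simp
  rw [e, abs_mul, abs_of_pos (by positivity : 0 < s ^ 2), mul_pow]
  have : 0 < s ^ 2 := by positivity
  nlinarith

theorem symm_ext_of_basis {ι : Type*} [Fintype ι] (b : OrthonormalBasis ι ℝ E)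
    {A B : E →L[ℝ] E →L[ℝ] ℝ} (hA : ∀ v w, A v w = A w v) (hB : ∀ v w, B v w = B w v)
    (h : ∀ i j, A (b i + b j) (b i + b j) = B (b i + b j) (b i + b j)) : A = B := by
  have hd : ∀ i, A (b i) (b i) = B (b i) (b i) := fun i => by
    have := h i i
    simp only [map_add, add_apply] at this
    linarith
  have hij : ∀ i j, A (b i) (b j) = B (b i) (b j) := fun i j => by
    have := h i j
    simp only [map_add, add_apply] at this
    rw [hA (b j) (b i), hB (b j) (b i), hd i, hd j] at this
    linarith
  have hl : ∀ i, (A (b i) : E →ₗ[ℝ] ℝ) = (B (b i) : E →ₗ[ℝ] ℝ) := fun i =>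
    b.toBasis.ext fun j => by simpa using hij i j
  have hl2 : ∀ i w, A (b i) w = B (b i) w := fun i w => LinearMap.congr_fun (hl i) w
  ext v w
  rw [hA v w, hB v w]
  have hl3 : (A w : E →ₗ[ℝ] ℝ) = (B w : E →ₗ[ℝ] ℝ) :=
    b.toBasis.ext fun j => by
      have := hl2 j w
      rw [hA, hB] at this
      simpa using this
  exact LinearMap.congr_fun hl3 v

/-- A function vanishing to second order with constant second differences is quadratic. -/
theorem eq_half_of_secDiff_eq {u : E → ℝ} {B : E →L[ℝ] E →L[ℝ] ℝ} {C : ℝ} (h0 : u 0 = 0)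
    (hC : ∀ x, |u x| ≤ C * ‖x‖ ^ 2) (h : ∀ x, secDiff u x x = B x x) (x : E) :
    u x = 1 / 2 * B x x := by
  set g : E → ℝ := fun x => u x - 1 / 2 * B x x with hg
  have h2 : ∀ x, g ((2 : ℝ) • x) = 2 * g x := fun x => by
    have := h x
    rw [secDiff, sub_self, h0, ← two_smul ℝ x] at this
    simp only [hg, map_smul, smul_apply, smul_eq_mul]
    linarith
  have hC' : ∀ x, |g x| ≤ (C + ‖B‖) * ‖x‖ ^ 2 := fun x => by
    have h3 := hC x
    have h4 := bilin_le_norm B x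
    have : |g x| ≤ |u x| + 1 / 2 * |B x x| := by
      refine (abs_sub _ _).trans (le_of_eq ?_)
      rw [abs_mul]; norm_num
    have h5 := abs_nonneg (B x x)
    linarith
  have hk : ∀ k : ℕ, ∀ x, |g x| ≤ (1 / 2) ^ k * ((C + ‖B‖) * ‖x‖ ^ 2) := by
    intro k
    induction k with
    | zero => intro x; simpa using hC' x
    | succ k ih =>
      intro x
      have h3 := ih ((1 / 2 : ℝ) • x)
      have h4 := h2 ((1 / 2 : ℝ) • x)
      rw [smul_smul, show (2 : ℝ) * (1 / 2) = 1 by norm_num, one_smul] at h4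
      rw [h4, abs_mul, abs_two]
      rw [norm_smul, mul_pow] at h3
      have e : ‖(1 / 2 : ℝ)‖ ^ 2 = 1 / 4 := by norm_num
      rw [e] at h3
      rw [pow_succ]
      linarith
  have hlim : Tendsto (fun k : ℕ => (1 / 2 : ℝ) ^ k * ((C + ‖B‖) * ‖x‖ ^ 2)) atTop (𝓝 0) := by
    have := (tendsto_pow_atTop_nhds_zero_of_lt_one (r := (1 / 2 : ℝ)) (by norm_num)
      (by norm_num)).mul_const ((C + ‖B‖) * ‖x‖ ^ 2)
    simpa using this
  have h3 : |g x| ≤ 0 := ge_of_tendsto hlim (Eventually.of_forall fun k => hk k x)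
  have h4 : g x = 0 := abs_nonpos_iff.1 h3
  simp only [hg] at h4
  linarith

variable [FiniteDimensional ℝ E] [MeasurableSpace E] [BorelSpace E] (μ : Measure E)
  [μ.IsAddHaarMeasure]
variable {F : (E →L[ℝ] E →L[ℝ] ℝ) → ℝ} {Adm : Set (E →L[ℝ] E →L[ℝ] ℝ)}
  {l : (E →L[ℝ] E →L[ℝ] ℝ) → (E →L[ℝ] E →L[ℝ] ℝ) →L[ℝ] ℝ} {θ Θ Λ : ℝ}

/-- A nonempty family of normalized entire solutions that are flat at no scale, closed under
pointwise limits and dilations. -/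
structure NonflatFamily (F : (E →L[ℝ] E →L[ℝ] ℝ) → ℝ) (Adm : Set (E →L[ℝ] E →L[ℝ] ℝ)) (Λ : ℝ)
    (μ : Measure E) (𝒰 : Ultrafilter ℕ) (c δ : ℝ) (T : Set (E → ℝ)) : Prop where
  nonempty : T.Nonempty
  sol : ∀ u ∈ T, ∀ x r, Sol F Adm Λ μ u (fun _ => c) x r
  zero : ∀ u ∈ T, u 0 = 0
  fderiv_zero : ∀ u ∈ T, fderiv ℝ u 0 = 0
  not_flat : ∀ u ∈ T, ∀ r, 0 < r → ¬ Flat δ u 0 r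
  limit_mem : ∀ U : ℕ → E → ℝ, (∀ k, U k ∈ T) → ∀ u' : E → ℝ,
    (∀ x, Tendsto (fun k => U k x) 𝒰 (𝓝 (u' x))) → u' ∈ T
  dilate_mem : ∀ u ∈ T, ∀ s : ℝ, 0 < s → (fun z => (s ^ 2)⁻¹ * u (s • z)) ∈ T

omit μ [FiniteDimensional ℝ E] [BorelSpace E] [μ.IsAddHaarMeasure] in
theorem Sol.of_forall_zero {μ : Measure E} {u φ : E → ℝ} (h : ∀ r, Sol F Adm Λ μ u φ 0 r) (x : E) (r : ℝ) :
    Sol F Adm Λ μ u φ x r :=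
  (h (‖x‖ + r)).mono fun y hy => by
    rw [mem_ball, dist_eq_norm] at hy
    rw [mem_ball, dist_zero_right]
    have := norm_le_norm_add_norm_sub' y x
    linarith

variable {μ} {𝒰 : Ultrafilter ℕ} {c δ : ℝ} {T : Set (E → ℝ)}

omit [FiniteDimensional ℝ E] [BorelSpace E] [μ.IsAddHaarMeasure] in
theorem Sol.abs_secDiff_le (hΛ : 0 ≤ Λ) {u φ : E → ℝ} (h : ∀ x r, Sol F Adm Λ μ u φ x r) (x v : E) :
    |secDiff u x v| ≤ 2 * Λ * ‖v‖ ^ 2 := by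
  have hx : x ∈ ball x (‖v‖ + 1) := mem_ball_self (by positivity)
  have h1 := Sol.abs_sub_sub_fderiv_le hΛ (h x (‖v‖ + 1)) hx (y := x + v) (by simp [dist_eq_norm])
  have h2 := Sol.abs_sub_sub_fderiv_le hΛ (h x (‖v‖ + 1)) hx (y := x - v) (by simp)
  rw [add_sub_cancel_left] at h1
  rw [sub_sub_cancel_left, norm_neg, map_neg] at h2
  have e : secDiff u x v = (u (x + v) - u x - fderiv ℝ u x v) +
      (u (x - v) - u x - -fderiv ℝ u x v) := by rw [secDiff]; ring
  rw [e]
  refine (abs_add_le _ _).trans ?_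
  linarith

omit μ [FiniteDimensional ℝ E] [MeasurableSpace E] [BorelSpace E] in
omit [InnerProductSpace ℝ E] in
theorem tendsto_secDiff_of_tendsto {U : ℕ → E → ℝ} {u' : E → ℝ}
    (h : ∀ x, Tendsto (fun k => U k x) 𝒰 (𝓝 (u' x))) (x v : E) :
    Tendsto (fun k => secDiff (U k) x v) 𝒰 (𝓝 (secDiff u' x v)) :=
  ((h _).add (h _)).sub ((h _).const_mul 2)

theorem NonflatFamily.exists_limit (O : ConcaveOperator F Adm l θ Θ Λ)
    (hT : NonflatFamily F Adm Λ μ 𝒰 c δ T) {U : ℕ → E → ℝ} (hU : ∀ k, U k ∈ T)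
    (h𝒰 : (𝒰 : Filter ℕ) ≤ atTop) :
    ∃ u' ∈ T, ∀ x, Tendsto (fun k => U k x) 𝒰 (𝓝 (u' x)) := by
  obtain ⟨u', -, -, -, h, -⟩ := Sol.exists_global_limit O 𝒰 (u := U) (φ := fun _ _ => c)
    (R := fun k => (k : ℝ)) (c := c) (μ := μ) (fun k => hT.sol _ (hU k) 0 k)
    (tendsto_natCast_atTop_atTop.mono_left h𝒰) (fun k => hT.zero _ (hU k))
    (fun k => hT.fderiv_zero _ (hU k)) (fun r η hη => Eventually.of_forall fun k y _ => by
      rw [sub_self, abs_zero]; exact hη.le)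
  exact ⟨u', hT.limit_mem U hU u' h, h⟩

/-- The second differences of some member of a nonflat family attain the smallest possible
upper bound in a given direction, and are then constant. -/
theorem NonflatFamily.exists_secDiff_eq [Nontrivial E] (O : ConcaveOperator F Adm l θ Θ Λ)
    (h𝒰 : (𝒰 : Filter ℕ) ≤ atTop) (hT : NonflatFamily F Adm Λ μ 𝒰 c δ T) {ξ : E} (hξ : ξ ≠ 0) :
    ∃ t : ℝ, ∃ u ∈ T, ∀ x (h : ℝ), secDiff u x (h • ξ) = t * h ^ 2 := by
  have hΛ := O.Lambda_nonneg
  set A : Set ℝ := {t | ∃ u ∈ T, ∀ x (h : ℝ), secDiff u x (h • ξ) ≤ t * h ^ 2} with hA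
  have hbd : ∀ u ∈ T, ∀ x (h : ℝ), |secDiff u x (h • ξ)| ≤ 2 * Λ * ‖ξ‖ ^ 2 * h ^ 2 := by
    intro u hu x h
    refine (Sol.abs_secDiff_le hΛ (hT.sol u hu) x (h • ξ)).trans (le_of_eq ?_)
    rw [norm_smul, mul_pow, Real.norm_eq_abs, sq_abs]; ring
  have hAne : A.Nonempty := by
    obtain ⟨u, hu⟩ := hT.nonempty
    exact ⟨2 * Λ * ‖ξ‖ ^ 2, u, hu, fun x h => (le_abs_self _).trans (hbd u hu x h)⟩
  have hAbd : BddBelow A := by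
    refine ⟨-(2 * Λ * ‖ξ‖ ^ 2), ?_⟩
    rintro t ⟨u, hu, h⟩
    have h1 := h 0 1
    have h2 := (neg_abs_le _).trans h1
    have h3 := hbd u hu 0 1
    linarith
  set t := sInf A with ht
  have hlt : ∀ k : ℕ, ∃ u ∈ T, ∀ x (h : ℝ), secDiff u x (h • ξ) ≤ (t + 1 / ((k : ℝ) + 1)) * h ^ 2 := by
    intro k
    obtain ⟨t', ⟨u, hu, h⟩, h2⟩ := exists_lt_of_csInf_lt hAne
      (show sInf A < t + 1 / ((k : ℝ) + 1) by
        have : (0 : ℝ) < 1 / ((k : ℝ) + 1) := by positivity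
        linarith)
    refine ⟨u, hu, fun x s => (h x s).trans ?_⟩
    nlinarith [sq_nonneg s]
  choose U hU hUle using hlt
  obtain ⟨u', hu', hlim⟩ := hT.exists_limit O hU h𝒰
  have hle : ∀ x (h : ℝ), secDiff u' x (h • ξ) ≤ t * h ^ 2 := by
    intro x h
    have h1 : Tendsto (fun k : ℕ => (t + 1 / ((k : ℝ) + 1)) * h ^ 2) 𝒰 (𝓝 ((t + 0) * h ^ 2)) :=
      ((tendsto_one_div_add_atTop_nhds_zero_nat.mono_left h𝒰).const_add t).mul_const _
    rw [add_zero] at h1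
    exact le_of_tendsto_of_tendsto' (tendsto_secDiff_of_tendsto hlim x (h • ξ)) h1
      fun k => hUle k x h
  refine ⟨t, u', hu', ?_⟩
  by_contra hcon
  push Not at hcon
  obtain ⟨x, h, hne⟩ := hcon
  have hlt := lt_of_le_of_ne (hle x h) hne
  have hh : h ≠ 0 := by
    rintro rfl
    apply hne
    simp only [secDiff, zero_smul, add_zero, sub_zero]
    ring
  have hsol := hT.sol u' hu'
  have hae : ∀ᵐ x ∂μ, ∃ B ∈ Adm, HasHessAt u' x B ∧ F B = c := by
    have h3 : ∀ᵐ x ∂μ, ∀ k : ℕ, x ∈ ball (0 : E) k → ∃ B ∈ Adm, HasHessAt u' x B ∧ F B = c :=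
      ae_all_iff.2 fun k => (hsol 0 k).ae
    filter_upwards [h3] with x hx
    obtain ⟨k, hk⟩ := exists_nat_gt ‖x‖
    exact hx k (by rwa [mem_ball, dist_zero_right])
  obtain ⟨y, ⟨B, -, hB, -⟩, hy⟩ := exists_hessian_lt_of_secDiff_lt μ
    (fun x => (hsol x 1).c11At (mem_ball_self one_pos)) hae (smul_ne_zero hh hξ) hlt
  have hBt : B ξ ξ < t := by
    have h1 := hy B hB
    rw [map_smul, map_smul, smul_apply, smul_eq_mul, smul_eq_mul] at h1
    have h2 : 0 < h ^ 2 := by positivity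
    nlinarith
  obtain ⟨η, hη, r, hr, hdef⟩ := Sol.exists_deficit μ O hsol hB hBt
  obtain ⟨η', hη', hdef'⟩ := Sol.propagate_deficit μ O hsol hη hr hle hdef
  have hpos : ∀ k : ℕ, (0 : ℝ) < 1 / ((k : ℝ) + 1) := fun k => by positivity
  have hV : ∀ k : ℕ, (fun z => ((1 / ((k : ℝ) + 1)) ^ 2)⁻¹ * u' ((1 / ((k : ℝ) + 1)) • z)) ∈ T :=
    fun k => hT.dilate_mem u' hu' _ (hpos k)
  obtain ⟨v, hv, hvlim⟩ := hT.exists_limit O hV h𝒰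
  have hmem : t - η' ∈ A := by
    refine ⟨v, hv, fun x h => ?_⟩
    refine le_of_tendsto (tendsto_secDiff_of_tendsto hvlim x (h • ξ)) ?_
    have ht0 := tendsto_one_div_add_atTop_nhds_zero_nat (𝕜 := ℝ) |>.mono_left h𝒰
    have e1 : ∀ᶠ k : ℕ in 𝒰, 1 / ((k : ℝ) + 1) * ‖x‖ < 1 := by
      have := ht0.mul_const ‖x‖
      rw [zero_mul] at this
      exact this.eventually_lt_const one_pos
    have e2 : ∀ᶠ k : ℕ in 𝒰, 1 / ((k : ℝ) + 1) * |h| < r := by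
      have := ht0.mul_const |h|
      rw [zero_mul] at this
      exact this.eventually_lt_const hr
    filter_upwards [e1, e2] with k k1 k2
    have hs := hpos k
    set s := 1 / ((k : ℝ) + 1)
    rw [secDiff_dilate, smul_smul, inv_mul_le_iff₀ (by positivity)]
    refine (hdef' (s • x) ?_ (s * h) ?_).trans (le_of_eq (by ring))
    · rw [mem_closedBall, dist_zero_right, norm_smul, Real.norm_eq_abs, abs_of_pos hs]
      exact k1.le
    · rwa [abs_mul, abs_of_pos hs]
  have := csInf_le hAbd hmem
  linarith

theorem NonflatFamily.exists_restrict [Nontrivial E] (O : ConcaveOperator F Adm l θ Θ Λ)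
    (h𝒰 : (𝒰 : Filter ℕ) ≤ atTop) (hT : NonflatFamily F Adm Λ μ 𝒰 c δ T) (ξ : E) :
    ∃ t : ℝ, NonflatFamily F Adm Λ μ 𝒰 c δ
      {u ∈ T | ∀ x (h : ℝ), secDiff u x (h • ξ) = t * h ^ 2} := by
  obtain ⟨t, u, hu, h⟩ : ∃ t : ℝ, ∃ u ∈ T, ∀ x (h : ℝ), secDiff u x (h • ξ) = t * h ^ 2 := by
    rcases eq_or_ne ξ 0 with rfl | hξ
    · obtain ⟨u, hu⟩ := hT.nonempty
      refine ⟨0, u, hu, fun x h => ?_⟩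
      simp only [secDiff, smul_zero, add_zero, sub_zero]
      ring
    · exact hT.exists_secDiff_eq O h𝒰 hξ
  refine ⟨t, ⟨u, hu, h⟩, fun u hu => hT.sol u hu.1, fun u hu => hT.zero u hu.1,
    fun u hu => hT.fderiv_zero u hu.1, fun u hu => hT.not_flat u hu.1,
    fun U hU u' hlim => ⟨hT.limit_mem U (fun k => (hU k).1) u' hlim, fun x h => ?_⟩,
    fun u hu s hs => ⟨hT.dilate_mem u hu.1 s hs, fun x h => ?_⟩⟩
  · refine tendsto_nhds_unique (tendsto_secDiff_of_tendsto hlim x (h • ξ)) ?_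
    exact tendsto_const_nhds.congr fun k => ((hU k).2 x h).symm
  · rw [secDiff_dilate, smul_smul, hu.2]
    field_simp

theorem NonflatFamily.exists_forall_secDiff_eq [Nontrivial E] (O : ConcaveOperator F Adm l θ Θ Λ)
    (h𝒰 : (𝒰 : Filter ℕ) ≤ atTop) (hT : NonflatFamily F Adm Λ μ 𝒰 c δ T) {ι : Type*}
    (ξ : ι → E) (S : Finset ι) :
    ∃ T', NonflatFamily F Adm Λ μ 𝒰 c δ T' ∧ ∀ i ∈ S, ∃ t : ℝ, ∀ u ∈ T', ∀ x (h : ℝ),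
      secDiff u x (h • ξ i) = t * h ^ 2 := by
  classical
  induction S using Finset.induction_on with
  | empty => exact ⟨T, hT, by simp⟩
  | insert i S _ ih =>
    obtain ⟨T', hT', h⟩ := ih
    obtain ⟨t, ht⟩ := hT'.exists_restrict O h𝒰 (ξ i)
    refine ⟨_, ht, fun j hj => ?_⟩
    rcases Finset.mem_insert.1 hj with rfl | hj
    · exact ⟨t, fun u hu => hu.2⟩
    · obtain ⟨t', ht'⟩ := h j hj
      exact ⟨t', fun u hu => ht' u hu.1⟩

theorem NonflatFamily.false [Nontrivial E] (O : ConcaveOperator F Adm l θ Θ Λ) (hδ : 0 < δ)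
    (h𝒰 : (𝒰 : Filter ℕ) ≤ atTop) (hT : NonflatFamily F Adm Λ μ 𝒰 c δ T) : False := by
  set b := stdOrthonormalBasis ℝ E
  obtain ⟨T', hT', h⟩ := hT.exists_forall_secDiff_eq O h𝒰
    (fun p : Fin (Module.finrank ℝ E) × Fin (Module.finrank ℝ E) => b p.1 + b p.2) Finset.univ
  obtain ⟨u, hu⟩ := hT'.nonempty
  have hsol := hT'.sol u hu
  have hae : ∀ᵐ x ∂μ, ∃ B ∈ Adm, HasHessAt u x B ∧ F B = c := by
    have h3 : ∀ᵐ x ∂μ, ∀ k : ℕ, x ∈ ball (0 : E) k → ∃ B ∈ Adm, HasHessAt u x B ∧ F B = c :=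
      ae_all_iff.2 fun k => (hsol 0 k).ae
    filter_upwards [h3] with x hx
    obtain ⟨k, hk⟩ := exists_nat_gt ‖x‖
    exact hx k (by rwa [mem_ball, dist_zero_right])
  have huniq : ∀ x y X Y, HasHessAt u x X → HasHessAt u y Y → X = Y := by
    intro x y X Y hX hY
    refine symm_ext_of_basis b hX.1 hY.1 fun i j => ?_
    obtain ⟨t, ht⟩ := h (i, j) (Finset.mem_univ _)
    rw [hX.eq_of_secDiff (ht u hu x), hY.eq_of_secDiff (ht u hu y)]
  obtain ⟨x₁, B, -, hB, -⟩ := hae.exists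
  have hc11 : ∀ x, C11At u x := fun x => (hsol x 1).c11At (mem_ball_self one_pos)
  have hsec : ∀ x v, secDiff u x v = B v v := by
    intro x v
    rcases eq_or_ne v 0 with rfl | hv
    · rw [map_zero, secDiff, add_zero, sub_zero]; ring
    refine le_antisymm ?_ ?_
    · by_contra hcon
      push Not at hcon
      have h1 : secDiff (fun z => -1 * u z) x v < -B v v := by
        have : secDiff (fun z => -1 * u z) x v = -secDiff u x v := by simp only [secDiff]; ring
        rw [this]; linarith
      obtain ⟨y, ⟨Y, -, hY, -⟩, hy⟩ := exists_hessian_lt_of_secDiff_lt μ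
        (fun x => (hc11 x).const_mul (-1)) hae hv h1
      have h2 := hy _ (hY.const_mul (-1))
      rw [huniq _ _ _ _ hY hB, smul_apply, smul_apply, smul_eq_mul] at h2
      linarith
    · by_contra hcon
      push Not at hcon
      obtain ⟨y, ⟨Y, -, hY, -⟩, hy⟩ := exists_hessian_lt_of_secDiff_lt μ hc11 hae hv hcon
      have h2 := hy _ hY
      rw [huniq _ _ _ _ hY hB] at h2
      exact lt_irrefl _ h2
  have hq := eq_half_of_secDiff_eq (C := Λ) (hT'.zero u hu) (fun x => by
    have := Sol.abs_sub_sub_fderiv_le O.Lambda_nonneg (hsol 0 (‖x‖ + 1))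
      (mem_ball_self (by positivity)) (y := x) (by simp)
    rw [hT'.zero u hu, hT'.fderiv_zero u hu] at this
    simpa using this) (fun x => hsec x x)
  refine hT'.not_flat u hu 1 one_pos ⟨0, 0, B, hB.1, fun y _ => ?_⟩
  have : u y - quadPoly 0 0 0 B y = 0 := by
    rw [quadPoly, hq y]; simp
  rw [this, abs_zero]
  positivity

/-- **Liouville theorem.** Every entire solution is flat at some scale. -/
theorem Sol.exists_flat [Nontrivial E] (O : ConcaveOperator F Adm l θ Θ Λ) (hδ : 0 < δ)
    {u : E → ℝ} (hu : ∀ r, Sol F Adm Λ μ u (fun _ => c) 0 r) (h0 : u 0 = 0)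
    (h0' : fderiv ℝ u 0 = 0) : ∃ r > 0, Flat δ u 0 r := by
  by_contra hcon
  push Not at hcon
  have h𝒰 : ((hyperfilter ℕ : Ultrafilter ℕ) : Filter ℕ) ≤ atTop := by
    rw [← Nat.cofinite_eq_atTop]; exact hyperfilter_le_cofinite
  refine NonflatFamily.false (μ := μ) (c := c) (δ := δ) O hδ h𝒰 (T := {u | (∀ r, Sol F Adm Λ μ u (fun _ => c) 0 r) ∧
    u 0 = 0 ∧ fderiv ℝ u 0 = 0 ∧ ∀ r, 0 < r → ¬ Flat δ u 0 r})
    ⟨⟨u, hu, h0, h0', hcon⟩, fun u hu => Sol.of_forall_zero hu.1, fun u hu => hu.2.1,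
      fun u hu => hu.2.2.1, fun u hu => hu.2.2.2, fun U hU u' hlim => ?_, fun u hu s hs => ?_⟩
  · obtain ⟨u'', h1, h2, h3, h4, h5⟩ := Sol.exists_global_limit O (hyperfilter ℕ) (u := U)
      (φ := fun _ _ => c) (R := fun k => (k : ℝ)) (c := c) (μ := μ) (fun k => (hU k).1 k)
      (tendsto_natCast_atTop_atTop.mono_left h𝒰) (fun k => (hU k).2.1)
      (fun k => (hU k).2.2.1) (fun r η hη => Eventually.of_forall fun k y _ => by
        rw [sub_self, abs_zero]; exact hη.le)
    have e : u'' = u' := funext fun x => tendsto_nhds_unique (h4 x) (hlim x)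
    subst e
    refine ⟨h1, h2, h3, fun r hr hf => ?_⟩
    have hcont : Continuous u'' := continuous_iff_continuousAt.2 fun x =>
      ((Sol.of_forall_zero h1 x 1).c11At (mem_ball_self one_pos)).continuousAt
    obtain ⟨k, hk⟩ := (hf.eventually hcont.continuousOn hr.le (fun η hη => h5 r η hη)).exists
    exact (hU k).2.2.2 r hr hk
  · refine ⟨fun r => ?_, by simp [hu.2.1], ?_, fun r hr hf => hu.2.2.2 _ (mul_pos hs hr)
      (hf.of_dilate hs)⟩
    · have := (hu.1 (s * r)).rescale hs
      simpa using this
    · exact fderiv_dilate u ((hu.1 1).diff 0 (mem_ball_self one_pos)) hu.2.2.1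

end Liouville

section UniformFlatness

theorem exists_pos_mul_rpow_le {α : ℝ} (hα : 0 < α) (M : ℝ) {η : ℝ} (hη : 0 < η) :
    ∃ R : ℝ, 0 < R ∧ R < 1 ∧ M * R ^ α < η := by
  have h1 : ContinuousAt (fun R : ℝ => M * R ^ α) 0 :=
    (continuousAt_id.rpow_const (Or.inr hα.le)).const_mul M
  have h2 : Tendsto (fun R : ℝ => M * R ^ α) (𝓝[>] 0) (𝓝 0) := by
    have := h1.tendsto.mono_left (nhdsWithin_le_nhds (s := Ioi 0))
    simpa [Real.zero_rpow hα.ne'] using this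
  have h3 : ∀ᶠ R : ℝ in 𝓝[>] 0, R < 1 := nhdsWithin_le_nhds (eventually_lt_nhds one_pos)
  obtain ⟨R, ⟨h4, h5⟩, h6⟩ :=
    ((h2.eventually (eventually_lt_nhds hη)).and h3 |>.and self_mem_nhdsWithin).exists
  exact ⟨R, h6, h5, h4⟩

variable {E : Type*} [NormedAddCommGroup E] [InnerProductSpace ℝ E]

theorem Flat.of_sub_affine {δ r p : ℝ} {ℓ : E →L[ℝ] ℝ} {u : E → ℝ}
    (h : Flat δ (fun z => u z - (p + ℓ z)) 0 r) : Flat δ u 0 r := by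
  obtain ⟨a, ℓ', A, hA, h⟩ := h
  refine ⟨a + p, ℓ' + ℓ, A, hA, fun y hy => ?_⟩
  have h1 := h y hy
  have e : u y - quadPoly 0 (a + p) (ℓ' + ℓ) A y = u y - (p + ℓ y) - quadPoly 0 a ℓ' A y := by
    simp only [quadPoly, add_apply, sub_zero]
    ring
  rwa [e]

variable [FiniteDimensional ℝ E] [MeasurableSpace E] [BorelSpace E] (μ : Measure E)
  [μ.IsAddHaarMeasure]
variable {F : (E →L[ℝ] E →L[ℝ] ℝ) → ℝ} {Adm : Set (E →L[ℝ] E →L[ℝ] ℝ)}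
  {l : (E →L[ℝ] E →L[ℝ] ℝ) → (E →L[ℝ] E →L[ℝ] ℝ) →L[ℝ] ℝ} {θ Θ Λ : ℝ}

/-- A single scale at which every solution with Hölder right-hand side is flat. -/
theorem Sol.exists_uniform_flat [Nontrivial E] (O : ConcaveOperator F Adm l θ Θ Λ) {α C ε N R₀ : ℝ}
    (hα : 0 < α) (hC : 0 < C) (hε : 0 < ε) (hN : 0 ≤ N) (hR₀ : 0 < R₀) (hR₀1 : R₀ < 1)
    (hNR : N * R₀ ^ α ≤ ε * ε)
    (H : ∀ (u φ : E → ℝ) (x : E) (r a : ℝ) (ℓ : E →L[ℝ] ℝ) (A : E →L[ℝ] E →L[ℝ] ℝ) (δ : ℝ),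
        (∀ v w, A v w = A w v) → 0 < r → 0 < δ → δ ≤ ε → Sol F Adm Λ μ u φ x r →
        (∀ y ∈ ball x r, |φ y - φ x| ≤ ε * δ * (‖y - x‖ / r) ^ α) →
        (∀ y ∈ ball x r, |u y - quadPoly x a ℓ A y| ≤ δ * r ^ 2) →
        ∃ (ℓ' : E →L[ℝ] ℝ) (A' : E →L[ℝ] E →L[ℝ] ℝ), (∀ v w, A' v w = A' w v) ∧
          ‖A' - A‖ ≤ C * δ ∧ ∀ y ∈ ball x r,
            |u y - quadPoly x (u x) ℓ' A' y| ≤ C * δ * r ^ 2 * (‖y - x‖ / r) ^ (2 + α)) :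
    ∃ r₀ : ℝ, 0 < r₀ ∧ r₀ ≤ R₀ ∧ ∀ u φ : E → ℝ, Sol F Adm Λ μ u φ 0 1 → |φ 0| ≤ N →
      (∀ y ∈ ball (0 : E) 1, |φ y - φ 0| ≤ N * ‖y‖ ^ α) → Flat ε u 0 r₀ := by
  by_contra hcon
  push Not at hcon
  have hpos : ∀ k : ℕ, (0 : ℝ) < 1 / ((k : ℝ) + 1) := fun k => by positivity
  have hle1 : ∀ k : ℕ, 1 / ((k : ℝ) + 1) ≤ 1 := fun k => by
    rw [div_le_one (by positivity)]; linarith [(Nat.cast_nonneg k : (0 : ℝ) ≤ k)]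
  have hk : ∀ k : ℕ, ∃ u φ : E → ℝ, Sol F Adm Λ μ u φ 0 1 ∧ |φ 0| ≤ N ∧
      (∀ y ∈ ball (0 : E) 1, |φ y - φ 0| ≤ N * ‖y‖ ^ α) ∧
      ¬ Flat ε u 0 (R₀ * (1 / ((k : ℝ) + 1)) ^ 2) := fun k => by
    obtain ⟨u, φ, h1, h2, h3, h4⟩ := hcon (R₀ * (1 / ((k : ℝ) + 1)) ^ 2)
      (mul_pos hR₀ (pow_pos (hpos k) 2))
      (mul_le_of_le_one_right hR₀.le (pow_le_one₀ (hpos k).le (hle1 k)))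
    exact ⟨u, φ, h1, h2, h3, h4⟩
  choose u φ hsol hφ0 hφ hnf using hk
  obtain ⟨κ, hκ, hκ1, hCκ⟩ := exists_pos_mul_rpow_le hα C one_pos
  have hnf' : ∀ (k : ℕ) (R : ℝ), R ≤ R₀ → R₀ * (1 / ((k : ℝ) + 1)) ^ 2 ≤ κ * R → ¬ Flat ε (u k) 0 R := by
    intro k R hR hrR hflat
    set r := R₀ * (1 / ((k : ℝ) + 1)) ^ 2 with hr
    have hr0 : 0 < r := mul_pos hR₀ (pow_pos (hpos k) 2)
    have hR0 : 0 < R := by nlinarith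
    have hball : ball (0 : E) R ⊆ ball 0 1 := ball_subset_ball (by linarith)
    obtain ⟨a, ℓ, A, hA, hP⟩ := hflat
    obtain ⟨ℓ', A', hA', -, hT⟩ := H (u k) (φ k) 0 R a ℓ A ε hA hR0 hε le_rfl
      ((hsol k).mono hball) (fun y hy => by
        refine (hφ k y (hball hy)).trans ?_
        rw [sub_zero, Real.div_rpow (norm_nonneg _) hR0.le, mul_div_assoc']
        rw [le_div_iff₀ (by positivity)]
        have h1 : N * R ^ α ≤ ε * ε :=
          (mul_le_mul_of_nonneg_left (Real.rpow_le_rpow hR0.le hR hα.le) hN).trans hNR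
        have h2 : 0 ≤ ‖y‖ ^ α := by positivity
        calc N * ‖y‖ ^ α * R ^ α = (N * R ^ α) * ‖y‖ ^ α := by ring
          _ ≤ _ := mul_le_mul_of_nonneg_right h1 h2)
      (fun y hy => (hP y (ball_subset_closedBall hy)).le)
    refine hnf k ⟨u k 0, ℓ', A', hA', fun y hy => ?_⟩
    rw [mem_closedBall, dist_zero_right] at hy
    have h1 := hT y (by rw [mem_ball, dist_zero_right]; nlinarith)
    rw [sub_zero] at h1
    refine h1.trans_lt ?_
    have h2 : (‖y‖ / R) ^ (2 + α) ≤ (r / R) ^ (2 + α) := by gcongr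
    have h3 : (r / R) ^ (2 + α) = (r / R) ^ 2 * (r / R) ^ α := by
      rw [Real.rpow_add (by positivity)]; norm_num
    have h4 : (r / R) ^ α ≤ κ ^ α := by
      gcongr
      rwa [div_le_iff₀ hR0]
    calc C * ε * R ^ 2 * (‖y‖ / R) ^ (2 + α) ≤ C * ε * R ^ 2 * ((r / R) ^ 2 * κ ^ α) := by
          rw [h3] at h2
          have h5 : (r / R) ^ 2 * (r / R) ^ α ≤ (r / R) ^ 2 * κ ^ α := by gcongr
          have : 0 ≤ C * ε * R ^ 2 := by positivity
          exact mul_le_mul_of_nonneg_left (h2.trans h5) this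
      _ = (ε * r ^ 2) * (C * κ ^ α) := by field_simp
      _ < ε * r ^ 2 := mul_lt_of_lt_one_right (by positivity) hCκ
  let w : ℕ → E → ℝ := fun k z => u k z - (u k 0 + fderiv ℝ (u k) 0 z)
  have hw : ∀ k, Sol F Adm Λ μ (w k) (φ k) 0 1 := fun k => (hsol k).sub_affine _ _
  have h01 : (0 : E) ∈ ball (0 : E) 1 := mem_ball_self one_pos
  have hw' : ∀ k, fderiv ℝ (w k) 0 = 0 := fun k => by
    have := ((hsol k).diff 0 h01).hasFDerivAt.sub
      ((fderiv ℝ (u k) 0).hasFDerivAt.const_add (x := (0 : E)) (u k 0))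
    rw [sub_self] at this
    exact this.fderiv
  let V : ℕ → E → ℝ := fun k z => ((1 / ((k : ℝ) + 1)) ^ 2)⁻¹ * w k ((1 / ((k : ℝ) + 1)) • z)
  have hV : ∀ k, Sol F Adm Λ μ (V k) (fun z => φ k ((1 / ((k : ℝ) + 1)) • z)) 0 ((k : ℝ) + 1) := by
    intro k
    have h1 : Sol F Adm Λ μ (w k) (φ k) 0 (1 / ((k : ℝ) + 1) * ((k : ℝ) + 1)) := by
      rw [one_div_mul_cancel (by positivity)]; exact hw k
    have := h1.rescale (hpos k)
    simpa only [zero_add] using this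
  have h𝒰 : ((hyperfilter ℕ : Ultrafilter ℕ) : Filter ℕ) ≤ atTop := by
    rw [← Nat.cofinite_eq_atTop]; exact hyperfilter_le_cofinite
  obtain ⟨c, -, hc⟩ := exists_ultralimit_of_norm_le (hyperfilter ℕ) (f := fun k => φ k 0)
    (M := N) hφ0
  have ht0 := tendsto_one_div_add_atTop_nhds_zero_nat (𝕜 := ℝ) |>.mono_left h𝒰
  obtain ⟨u', h1, h2, h3, h4, h5⟩ := Sol.exists_global_limit O (hyperfilter ℕ) (u := V)
    (φ := fun k z => φ k ((1 / ((k : ℝ) + 1)) • z)) (R := fun k => (k : ℝ) + 1) (c := c) (μ := μ) hV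
    ((tendsto_atTop_add_const_right _ _ tendsto_natCast_atTop_atTop).mono_left h𝒰)
    (fun k => by simp [V, w])
    (fun k => fderiv_dilate (w k) ((hw k).diff 0 h01) (hw' k)) (fun r η hη => by
      have e1 : ∀ᶠ k : ℕ in (hyperfilter ℕ : Filter ℕ), 1 / ((k : ℝ) + 1) * |r| < 1 := by
        have := ht0.mul_const |r|
        rw [zero_mul] at this
        exact this.eventually_lt_const one_pos
      have e2 : ∀ᶠ k : ℕ in (hyperfilter ℕ : Filter ℕ), N * (1 / ((k : ℝ) + 1) * |r|) ^ α < η / 2 := by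
        have := ht0.mul_const |r|
        rw [zero_mul] at this
        have := (this.rpow_const (p := α) (Or.inr hα.le)).const_mul N
        rw [Real.zero_rpow hα.ne', mul_zero] at this
        exact this.eventually_lt_const (by positivity)
      have e3 : ∀ᶠ k : ℕ in (hyperfilter ℕ : Filter ℕ), |φ k 0 - c| < η / 2 := by
        have := (hc.sub_const c).abs
        rw [sub_self, abs_zero] at this
        exact this.eventually_lt_const (by positivity)
      filter_upwards [e1, e2, e3] with k k1 k2 k3 y hy
      have hs := hpos k
      set s := 1 / ((k : ℝ) + 1)
      rw [mem_ball, dist_zero_right] at hy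
      have hny : ‖s • y‖ ≤ s * |r| := by
        rw [norm_smul, Real.norm_eq_abs, abs_of_pos hs]
        exact mul_le_mul_of_nonneg_left (hy.le.trans (le_abs_self r)) hs.le
      have k4 := hφ k (s • y) (by rw [mem_ball, dist_zero_right]; linarith)
      have k5 : N * ‖s • y‖ ^ α ≤ N * (s * |r|) ^ α := by gcongr
      calc |φ k (s • y) - c| = |(φ k (s • y) - φ k 0) + (φ k 0 - c)| := by congr 1; ring
        _ ≤ |φ k (s • y) - φ k 0| + |φ k 0 - c| := abs_add_le _ _
        _ ≤ η := by linarith)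
  obtain ⟨r, hr, hflat⟩ := Sol.exists_flat O hε h1 h2 h3
  have hcont : Continuous u' := continuous_iff_continuousAt.2 fun x =>
    ((Sol.of_forall_zero h1 x 1).c11At (mem_ball_self one_pos)).continuousAt
  have f1 : ∀ᶠ k : ℕ in (hyperfilter ℕ : Filter ℕ), 1 / ((k : ℝ) + 1) * r < R₀ := by
    have := ht0.mul_const r
    rw [zero_mul] at this
    exact this.eventually_lt_const hR₀
  have f2 : ∀ᶠ k : ℕ in (hyperfilter ℕ : Filter ℕ), 1 / ((k : ℝ) + 1) * R₀ < κ * r := by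
    have := ht0.mul_const R₀
    rw [zero_mul] at this
    exact this.eventually_lt_const (by positivity)
  obtain ⟨k, ⟨hk, k1⟩, k2⟩ := ((hflat.eventually hcont.continuousOn hr.le
    (fun η hη => h5 r η hη)).and f1 |>.and f2).exists
  have hs := hpos k
  refine hnf' k _ k1.le ?_ (hk.of_dilate hs).of_sub_affine
  nlinarith

/-- Interior `C^{2,α}` regularity for the equation `F (D² u) = φ`, in pointwise Taylor form, on
the unit ball. -/
theorem Sol.exists_taylor_unit [Nontrivial E] (O : ConcaveOperator F Adm l θ Θ Λ) {α N : ℝ}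
    (hα : 0 < α) (hα1 : α < 1) (hN : 0 ≤ N) :
    ∃ C : ℝ, 0 < C ∧ ∃ r₀ : ℝ, 0 < r₀ ∧ r₀ < 1 ∧ ∀ u φ : E → ℝ, Sol F Adm Λ μ u φ 0 1 → |φ 0| ≤ N →
      (∀ y ∈ ball (0 : E) 1, |φ y - φ 0| ≤ N * ‖y‖ ^ α) →
      ∃ (ℓ : E →L[ℝ] ℝ) (B : E →L[ℝ] E →L[ℝ] ℝ), (∀ v w, B v w = B w v) ∧
        ∀ y ∈ ball (0 : E) r₀, |u y - quadPoly 0 (u 0) ℓ B y| ≤ C * ‖y‖ ^ (2 + α) := by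
  obtain ⟨C, hC, ε, hε, H⟩ := exists_taylor_of_near_quadPoly μ O hα hα1
  obtain ⟨R₀, hR₀, hR₀1, hNR⟩ := exists_pos_mul_rpow_le hα N (mul_pos hε hε)
  obtain ⟨r, hr, hrR, h⟩ := Sol.exists_uniform_flat μ O hα hC hε hN hR₀ hR₀1 hNR.le H
  refine ⟨C * ε * r ^ 2 * (r ^ (2 + α))⁻¹, by positivity, r, hr, by linarith,
    fun u φ hu hφ0 hφ => ?_⟩
  obtain ⟨a, ℓ, A, hA, hP⟩ := h u φ hu hφ0 hφ
  have hball : ball (0 : E) r ⊆ ball 0 1 := ball_subset_ball (by linarith)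
  obtain ⟨ℓ', A', hA', -, hT⟩ := H u φ 0 r a ℓ A ε hA hr hε le_rfl
    (hu.mono hball) (fun y hy => by
      refine (hφ y (hball hy)).trans ?_
      rw [sub_zero, Real.div_rpow (norm_nonneg _) hr.le, mul_div_assoc']
      rw [le_div_iff₀ (by positivity)]
      have h1 : N * r ^ α ≤ ε * ε :=
        (mul_le_mul_of_nonneg_left (Real.rpow_le_rpow hr.le hrR hα.le) hN).trans hNR.le
      have h2 : 0 ≤ ‖y‖ ^ α := by positivity
      calc N * ‖y‖ ^ α * r ^ α = (N * r ^ α) * ‖y‖ ^ α := by ring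
        _ ≤ _ := mul_le_mul_of_nonneg_right h1 h2)
    (fun y hy => (hP y (ball_subset_closedBall hy)).le)
  refine ⟨ℓ', A', hA', fun y hy => (hT y hy).trans (le_of_eq ?_)⟩
  rw [sub_zero, Real.div_rpow (norm_nonneg _) hr.le]
  ring

/-- Interior `C^{2,α}` regularity for the equation `F (D² u) = φ`, in pointwise Taylor form. -/
theorem Sol.exists_taylor [Nontrivial E] (O : ConcaveOperator F Adm l θ Θ Λ) {α N ρ : ℝ}
    (hα : 0 < α) (hα1 : α < 1) (hN : 0 ≤ N) (hρ : 0 < ρ) :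
    ∃ C : ℝ, 0 < C ∧ ∃ r₀ : ℝ, 0 < r₀ ∧ r₀ < ρ ∧ ∀ (u φ : E → ℝ) (x : E), Sol F Adm Λ μ u φ x ρ →
      |φ x| ≤ N → (∀ y ∈ ball x ρ, |φ y - φ x| ≤ N * ‖y - x‖ ^ α) →
      ∃ (ℓ : E →L[ℝ] ℝ) (B : E →L[ℝ] E →L[ℝ] ℝ), (∀ v w, B v w = B w v) ∧
        ∀ y ∈ ball x r₀, |u y - quadPoly x (u x) ℓ B y| ≤ C * ‖y - x‖ ^ (2 + α) := by
  obtain ⟨C, hC, r, hr, hr1, h⟩ := Sol.exists_taylor_unit μ O (N := N * (1 + ρ ^ α)) hα hα1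
    (by positivity)
  refine ⟨ρ ^ 2 * (C * (ρ⁻¹) ^ (2 + α)), by positivity, ρ * r, by positivity,
    mul_lt_of_lt_one_right hρ hr1, fun u φ x hu hφ0 hφ => ?_⟩
  have hρα : 0 < ρ ^ α := by positivity
  have hsol := Sol.rescale (r := 1) hρ (by rwa [mul_one])
  obtain ⟨ℓ, B, hB, hT⟩ := h _ _ hsol (by
      rw [smul_zero, add_zero]
      nlinarith) (fun y hy => by
      rw [mem_ball, dist_zero_right] at hy
      have := hφ (x + ρ • y) (by
        rw [mem_ball, dist_eq_norm, add_sub_cancel_left, norm_smul, Real.norm_eq_abs,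
          abs_of_pos hρ]
        exact mul_lt_of_lt_one_right hρ hy)
      rw [add_sub_cancel_left, norm_smul, Real.norm_eq_abs, abs_of_pos hρ,
        Real.mul_rpow hρ.le (norm_nonneg _)] at this
      rw [smul_zero, add_zero]
      have h2 : 0 ≤ N * ‖y‖ ^ α := by positivity
      calc _ ≤ _ := this
        _ = (N * ‖y‖ ^ α) * ρ ^ α := by ring
        _ ≤ (N * ‖y‖ ^ α) * (1 + ρ ^ α) := by gcongr; linarith
        _ = _ := by ring)
  refine ⟨ρ • ℓ, B, hB, fun y hy => ?_⟩
  have hy1 : ρ⁻¹ • (y - x) ∈ ball (0 : E) r := by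
    rw [mem_ball, dist_eq_norm] at hy
    rw [mem_ball, dist_zero_right, norm_smul, Real.norm_eq_abs, abs_of_pos (inv_pos.2 hρ),
      inv_mul_lt_iff₀ hρ]
    exact hy
  have h1 := hT _ hy1
  have h3 := quadPoly_rescale x ((ρ ^ 2)⁻¹ * u x) ρ ℓ B (ρ⁻¹ • (y - x))
  rw [mul_inv_cancel_left₀ (by positivity)] at h3
  simp only [smul_inv_smul₀ hρ.ne', smul_zero, add_zero, add_sub_cancel] at h1 h3
  rw [norm_smul, Real.norm_eq_abs, abs_of_pos (inv_pos.2 hρ),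
    Real.mul_rpow (inv_pos.2 hρ).le (norm_nonneg _)] at h1
  have h2 : u y - ρ ^ 2 * quadPoly 0 ((ρ ^ 2)⁻¹ * u x) ℓ B (ρ⁻¹ • (y - x)) =
      ρ ^ 2 * ((ρ ^ 2)⁻¹ * u y - quadPoly 0 ((ρ ^ 2)⁻¹ * u x) ℓ B (ρ⁻¹ • (y - x))) := by
    field_simp
  rw [h3, h2, abs_mul, abs_of_pos (by positivity)]
  calc _ ≤ ρ ^ 2 * (C * (ρ⁻¹ ^ (2 + α) * ‖y - x‖ ^ (2 + α))) := by gcongr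
    _ = _ := by ring

end UniformFlatness

section LogDet

open Matrix
open scoped MatrixOrder

variable {m : Type*} [Fintype m] [DecidableEq m]

theorem Matrix.PosSemidef.exists_eq_conjTranspose_mul_self {A : Matrix m m ℂ}
    (hA : A.PosSemidef) : ∃ B : Matrix m m ℂ, A = Bᴴ * B := by
  obtain ⟨B, hB⟩ := CStarAlgebra.nonneg_iff_eq_star_mul_self.mp hA.nonneg
  exact ⟨B, hB⟩

theorem Matrix.PosSemidef.re_trace_mul_nonneg {A B : Matrix m m ℂ} (hA : A.PosSemidef)
    (hB : B.PosSemidef) : 0 ≤ (A * B).trace.re := by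
  obtain ⟨C, rfl⟩ := hA.exists_eq_conjTranspose_mul_self
  have h : (Cᴴ * C * B).trace = (C * B * Cᴴ).trace := by
    rw [mul_assoc, trace_mul_comm]
  rw [h]
  exact (Complex.nonneg_iff.1 (hB.mul_mul_conjTranspose_same C).trace_nonneg).1

theorem Matrix.PosDef.re_det_pos {A : Matrix m m ℂ} (hA : A.PosDef) : 0 < A.det.re :=
  (Complex.pos_iff.1 hA.det_pos).1

theorem Matrix.PosSemidef.posDef_of_re_det_pos {A : Matrix m m ℂ} (hA : A.PosSemidef)
    (h : 0 < A.det.re) : A.PosDef :=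
  hA.posDef_iff_det_ne_zero.2 fun h0 => by simp [h0] at h

theorem Matrix.PosDef.ofReal_re_det {A : Matrix m m ℂ} (hA : A.PosDef) :
    ((A.det.re : ℝ) : ℂ) = A.det := by
  have := (Complex.pos_iff.1 hA.det_pos).2
  exact Complex.ext rfl (by simpa using this)

theorem Matrix.PosDef.log_det_le {A : Matrix m m ℂ} (hA : A.PosDef) :
    Real.log A.det.re ≤ A.trace.re - (1 : Matrix m m ℂ).trace.re := by
  have h1 : A.det.re = ∏ i, hA.1.eigenvalues i := by
    rw [hA.1.det_eq_prod_eigenvalues]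
    have : ∏ i, (hA.1.eigenvalues i : ℂ) = ((∏ i, hA.1.eigenvalues i : ℝ) : ℂ) := by push_cast; rfl
    exact (congrArg Complex.re this).trans (Complex.ofReal_re _)
  have h2 : A.trace.re = ∑ i, hA.1.eigenvalues i := by
    rw [hA.1.trace_eq_sum_eigenvalues]
    have : ∑ i, (hA.1.eigenvalues i : ℂ) = ((∑ i, hA.1.eigenvalues i : ℝ) : ℂ) := by push_cast; rfl
    exact (congrArg Complex.re this).trans (Complex.ofReal_re _)
  have h3 : (1 : Matrix m m ℂ).trace.re = ∑ _i : m, (1 : ℝ) := by simp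
  rw [h1, h2, h3, Real.log_prod fun i _ => (hA.eigenvalues_pos i).ne', ← Finset.sum_sub_distrib]
  exact Finset.sum_le_sum fun i _ => Real.log_le_sub_one_of_pos (hA.eigenvalues_pos i)

/-- Concavity of `log det` on positive definite matrices. -/
theorem Matrix.PosDef.log_det_sub_le {A B : Matrix m m ℂ} (hA : A.PosDef) (hB : B.PosDef) :
    Real.log B.det.re - Real.log A.det.re ≤ (A⁻¹ * (B - A)).trace.re := by
  obtain ⟨C, hC⟩ := hA.posSemidef.exists_eq_conjTranspose_mul_self
  have hCu : IsUnit C.det := by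
    have h : A.det ≠ 0 := hA.det_pos.ne'
    rw [hC, det_mul] at h
    exact isUnit_iff_ne_zero.2 (right_ne_zero_of_mul h)
  have hCu' : IsUnit Cᴴ.det := by rw [det_conjTranspose]; exact hCu.star
  have hAu : IsUnit A.det := isUnit_iff_ne_zero.2 hA.det_pos.ne'
  have hZ : ((C⁻¹)ᴴ * B * C⁻¹).PosDef := by
    refine hB.conjTranspose_mul_mul_same (mulVec_injective_of_isUnit ?_)
    exact (isUnit_nonsing_inv_iff.2 ((isUnit_iff_isUnit_det C).2 hCu))
  have hAi : A⁻¹ = C⁻¹ * (C⁻¹)ᴴ := by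
    rw [hC, mul_inv_rev, conjTranspose_nonsing_inv]
  have htr : ((C⁻¹)ᴴ * B * C⁻¹).trace = (A⁻¹ * B).trace := by
    rw [trace_mul_comm, ← mul_assoc, hAi]
  have hdet : A.det * ((C⁻¹)ᴴ * B * C⁻¹).det = B.det := by
    have e : Cᴴ * ((C⁻¹)ᴴ * B * C⁻¹) * C = B := by
      rw [conjTranspose_nonsing_inv]
      calc Cᴴ * ((Cᴴ)⁻¹ * B * C⁻¹) * C = (Cᴴ * (Cᴴ)⁻¹) * B * (C⁻¹ * C) := by
            simp only [mul_assoc]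
        _ = B := by rw [mul_nonsing_inv _ hCu', nonsing_inv_mul _ hCu, one_mul, mul_one]
    conv_rhs => rw [← e]
    rw [hC]
    simp only [det_mul]
    ring
  have hdet' : A.det.re * ((C⁻¹)ᴴ * B * C⁻¹).det.re = B.det.re := by
    rw [← hA.ofReal_re_det, ← hZ.ofReal_re_det, ← hB.ofReal_re_det] at hdet
    exact_mod_cast hdet
  have h := hZ.log_det_le
  rw [← hdet', Real.log_mul hA.re_det_pos.ne' hZ.re_det_pos.ne', mul_sub, nonsing_inv_mul _ hAu,
    trace_sub, Complex.sub_re, ← htr]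
  linarith

theorem Matrix.PosDef.re_det_le {A B : Matrix m m ℂ} (hA : A.PosDef) (h : (B - A).PosSemidef) :
    A.det.re ≤ B.det.re := by
  have hB : B.PosDef := by simpa using hA.add_posSemidef h
  have h1 := hB.log_det_sub_le hA
  have h2 := hB.inv.posSemidef.re_trace_mul_nonneg h
  have h3 : (B⁻¹ * (A - B)).trace.re = -(B⁻¹ * (B - A)).trace.re := by
    rw [← Complex.neg_re, ← trace_neg, ← mul_neg, neg_sub]
  have h4 : Real.log A.det.re ≤ Real.log B.det.re := by linarith
  exact (Real.log_le_log_iff hA.re_det_pos hB.re_det_pos).1 h4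

theorem Matrix.PosDef.re_trace_inv_mul_ge {A Q : Matrix m m ℂ} (hA : A.PosDef) (hQ : Q.PosSemidef)
    {c : ℝ} (hc : 0 < c) (h : ((c : ℂ) • 1 - A).PosSemidef) :
    c⁻¹ * Q.trace.re ≤ (A⁻¹ * Q).trace.re := by
  have hAu : IsUnit A.det := isUnit_iff_ne_zero.2 hA.det_pos.ne'
  set s : ℂ := ((c⁻¹ : ℝ) : ℂ) with hs
  have hss : star s = s := Complex.conj_ofReal _
  have h1 := (hA.inv.posSemidef.mul_mul_conjTranspose_same (1 - s • A)).re_trace_mul_nonneg hQ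
  have h2 := h.re_trace_mul_nonneg hQ
  have e : (1 - s • A) * A⁻¹ * (1 - s • A)ᴴ = A⁻¹ - (2 * s) • 1 + (s ^ 2) • A := by
    rw [conjTranspose_sub, conjTranspose_smul, conjTranspose_one, hA.1.eq, hss, sub_mul, one_mul,
      smul_mul_assoc, mul_nonsing_inv _ hAu, mul_sub, mul_one, sub_mul, smul_mul_smul_comm,
      mul_smul_comm, nonsing_inv_mul _ hAu, one_mul]
    module
  rw [e, add_mul, sub_mul, smul_mul_assoc, smul_mul_assoc, one_mul, trace_add, trace_sub,
    trace_smul, trace_smul] at h1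
  rw [sub_mul, smul_mul_assoc, one_mul, trace_sub, trace_smul] at h2
  have h3 : (2 * s : ℂ) = ((2 * c⁻¹ : ℝ) : ℂ) := by rw [hs]; push_cast; rfl
  have h4 : (s ^ 2 : ℂ) = (((c⁻¹) ^ 2 : ℝ) : ℂ) := by rw [hs]; push_cast; rfl
  rw [h3, h4] at h1
  simp only [smul_eq_mul, Complex.add_re, Complex.sub_re, Complex.re_ofReal_mul] at h1 h2
  have h5 : 0 ≤ (c⁻¹) ^ 2 * (c * Q.trace.re - (A * Q).trace.re) := mul_nonneg (by positivity) h2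
  have h6 : (c⁻¹) ^ 2 * (c * Q.trace.re) = c⁻¹ * Q.trace.re := by field_simp
  rw [mul_sub, h6] at h5
  linarith

theorem Matrix.PosSemidef.re_dotProduct_le {Q : Matrix m m ℂ} (hQ : Q.PosSemidef) (x : m → ℂ)
    (hx : ∑ i, ‖x i‖ ^ 2 ≤ 1) : (star x ⬝ᵥ Q *ᵥ x).re ≤ Q.trace.re := by
  have h1 : (1 - vecMulVec x (star x)).PosSemidef := by
    refine .of_dotProduct_mulVec_nonneg
      (isHermitian_one.sub (posSemidef_vecMulVec_self_star x).1) fun y => ?_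
    have e : star y ⬝ᵥ (1 - vecMulVec x (star x)) *ᵥ y =
        ((∑ i, ‖y i‖ ^ 2 - ‖star x ⬝ᵥ y‖ ^ 2 : ℝ) : ℂ) := by
      have e1 : star y ⬝ᵥ y = ((∑ i, ‖y i‖ ^ 2 : ℝ) : ℂ) := by
        simp only [dotProduct, Pi.star_apply]
        push_cast
        exact Finset.sum_congr rfl fun i _ => Complex.conj_mul' _
      have e2 : star y ⬝ᵥ x = star (star x ⬝ᵥ y) := star_dotProduct _ _
      rw [sub_mulVec, one_mulVec, vecMulVec_mulVec, dotProduct_sub, e1, Complex.ofReal_sub]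
      congr 1
      rw [op_smul_eq_smul, dotProduct_smul, e2, smul_eq_mul, mul_comm]
      push_cast
      exact Complex.conj_mul' _
    rw [e]
    refine Complex.zero_le_real.2 (sub_nonneg.2 ?_)
    have h2 : ‖star x ⬝ᵥ y‖ ≤ ∑ i, ‖x i‖ * ‖y i‖ := by
      refine (norm_sum_le _ _).trans (le_of_eq (Finset.sum_congr rfl fun i _ => ?_))
      rw [norm_mul, Pi.star_apply, norm_star]
    have h3 := Finset.sum_mul_sq_le_sq_mul_sq Finset.univ (fun i => ‖x i‖) (fun i => ‖y i‖)
    calc ‖star x ⬝ᵥ y‖ ^ 2 ≤ (∑ i, ‖x i‖ * ‖y i‖) ^ 2 := by gcongr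
      _ ≤ _ := h3
      _ ≤ 1 * ∑ i, ‖y i‖ ^ 2 := by gcongr
      _ = _ := one_mul _
  have h2 := h1.re_trace_mul_nonneg hQ
  rw [sub_mul, one_mul, trace_sub, vecMulVec_mul, trace_vecMulVec,
    Complex.sub_re, dotProduct_comm, ← dotProduct_mulVec] at h2
  linarith

end LogDet

section ComplexMongeAmpere

open scoped Matrix

variable {n : ℕ}

/-- The complex Hessian matrix associated with a real bilinear form. -/
def leviMatrix (B : Cn n →L[ℝ] Cn n →L[ℝ] ℝ) : Matrix (Fin n) (Fin n) ℂ := fun i j =>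
  (1/4 : ℂ) * ( ((B (EuclideanSpace.single i 1) (EuclideanSpace.single j 1)
      + B (EuclideanSpace.single i Complex.I) (EuclideanSpace.single j Complex.I) : ℝ) : ℂ)
    + Complex.I * ((B (EuclideanSpace.single i 1) (EuclideanSpace.single j Complex.I)
      - B (EuclideanSpace.single i Complex.I) (EuclideanSpace.single j 1) : ℝ) : ℂ) )

theorem complexHessian_eq (u : Cn n → ℝ) (z : Cn n) :
    complexHessian u z = leviMatrix (fderiv ℝ (fderiv ℝ u) z) := rfl

theorem leviMatrix_add (A B : Cn n →L[ℝ] Cn n →L[ℝ] ℝ) :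
    leviMatrix (A + B) = leviMatrix A + leviMatrix B := by
  ext i j
  simp only [leviMatrix, add_apply, Matrix.add_apply]
  push_cast
  ring

theorem leviMatrix_smul (c : ℝ) (B : Cn n →L[ℝ] Cn n →L[ℝ] ℝ) :
    leviMatrix (c • B) = (c : ℂ) • leviMatrix B := by
  ext i j
  simp only [leviMatrix, smul_apply, Matrix.smul_apply, smul_eq_mul]
  push_cast
  ring

theorem leviMatrix_sub (A B : Cn n →L[ℝ] Cn n →L[ℝ] ℝ) :
    leviMatrix (A - B) = leviMatrix A - leviMatrix B := by
  ext i j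
  simp only [leviMatrix, sub_apply, Matrix.sub_apply]
  push_cast
  ring

theorem leviMatrix_isHermitian {B : Cn n →L[ℝ] Cn n →L[ℝ] ℝ} (hB : ∀ v w, B v w = B w v) :
    (leviMatrix B).IsHermitian := by
  ext i j
  simp only [Matrix.conjTranspose_apply, leviMatrix]
  rw [hB (EuclideanSpace.single j 1), hB (EuclideanSpace.single j Complex.I),
    hB (EuclideanSpace.single j 1), hB (EuclideanSpace.single j Complex.I)]
  simp only [star_mul', star_add, RCLike.star_def, Complex.conj_ofReal, Complex.conj_I, map_div₀,
    map_one, map_ofNat]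
  push_cast
  ring

/-- The sesquilinear form associated with a real bilinear form. -/
def leviForm (B : Cn n →L[ℝ] Cn n →L[ℝ] ℝ) : Cn n →ₗ[ℂ] Cn n →ₗ⋆[ℂ] ℂ :=
  LinearMap.mk₂'ₛₗ (RingHom.id ℂ) (starRingEnd ℂ)
    (fun v w => ((B v w + B (Complex.I • v) (Complex.I • w) : ℝ) : ℂ) +
      Complex.I * ((B v (Complex.I • w) - B (Complex.I • v) w : ℝ) : ℂ))
    (fun v v' w => by
      simp only [smul_add, map_add, add_apply]; push_cast; ring)
    (fun c v w => by
      have h : ∀ v : Cn n, c • v = c.re • v + c.im • (Complex.I • v) := fun v => by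
        conv_lhs => rw [← Complex.re_add_im c, add_smul, mul_smul]
        rfl
      have h' : Complex.I • Complex.I • v = -v := by
        rw [smul_smul, Complex.I_mul_I, neg_one_smul]
      rw [smul_comm Complex.I c v, h v, h (Complex.I • v), h']
      simp only [map_add, map_smul, map_neg, add_apply, smul_apply, neg_apply, smul_eq_mul,
        RingHom.id_apply]
      conv_rhs => rw [← Complex.re_add_im c]
      push_cast
      linear_combination
        (c.im * (B (Complex.I • v) w) - (c.im : ℂ) * (B v (Complex.I • w))) * Complex.I_sq)
    (fun v w w' => by
      simp only [smul_add, map_add]; push_cast; ring)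
    (fun c v w => by
      have h : ∀ v : Cn n, c • v = c.re • v + c.im • (Complex.I • v) := fun v => by
        conv_lhs => rw [← Complex.re_add_im c, add_smul, mul_smul]
        rfl
      have h' : Complex.I • Complex.I • w = -w := by
        rw [smul_smul, Complex.I_mul_I, neg_one_smul]
      rw [smul_comm Complex.I c w, h w, h (Complex.I • w), h']
      simp only [map_add, map_smul, map_neg, smul_eq_mul]
      have hc : starRingEnd ℂ c = c.re - c.im * Complex.I := by
        apply Complex.ext <;> simp
      rw [hc]
      push_cast
      linear_combination
        ((c.im : ℂ) * (B v (Complex.I • w)) - c.im * (B (Complex.I • v) w)) * Complex.I_sq)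

theorem leviForm_apply (B : Cn n →L[ℝ] Cn n →L[ℝ] ℝ) (v w : Cn n) : leviForm B v w =
    ((B v w + B (Complex.I • v) (Complex.I • w) : ℝ) : ℂ) +
      Complex.I * ((B v (Complex.I • w) - B (Complex.I • v) w : ℝ) : ℂ) := rfl

/-- Coordinatewise conjugation. -/
def conjVec (x : Fin n → ℂ) : Cn n := WithLp.toLp 2 (star x)

theorem norm_conjVec_sq (x : Fin n → ℂ) : ‖conjVec x‖ ^ 2 = ∑ i, ‖x i‖ ^ 2 := by
  rw [EuclideanSpace.norm_sq_eq]
  simp [conjVec]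

theorem conjVec_ne_zero {x : Fin n → ℂ} (hx : x ≠ 0) : conjVec x ≠ 0 := by
  intro h
  apply hx
  have : star x = 0 := by simpa [conjVec] using h
  simpa using this

theorem conjVec_star (e : Cn n) : conjVec (star (e : Fin n → ℂ)) = e := by
  simp [conjVec]

theorem dotProduct_leviMatrix {B : Cn n →L[ℝ] Cn n →L[ℝ] ℝ} (hB : ∀ v w, B v w = B w v)
    (x : Fin n → ℂ) : star x ⬝ᵥ leviMatrix B *ᵥ x =
      ((1 / 4 * (B (conjVec x) (conjVec x) +
        B (Complex.I • conjVec x) (Complex.I • conjVec x)) : ℝ) : ℂ) := by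
  have hI : ∀ i : Fin n, (EuclideanSpace.single i Complex.I : Cn n) =
      Complex.I • EuclideanSpace.single i 1 := fun i => by
    ext k
    simp
  have hij : ∀ i j, leviMatrix B i j =
      1 / 4 * leviForm B (EuclideanSpace.single i 1) (EuclideanSpace.single j 1) := fun i j => by
    rw [leviForm_apply, ← hI, ← hI]; rfl
  have hx : conjVec x = ∑ i, star (x i) • (EuclideanSpace.single i 1 : Cn n) := by
    ext k
    simp [conjVec, Pi.single_apply]
  have h1 : leviForm B (conjVec x) (conjVec x) = ((B (conjVec x) (conjVec x) +
        B (Complex.I • conjVec x) (Complex.I • conjVec x) : ℝ) : ℂ) := by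
    rw [leviForm_apply, hB (conjVec x) (Complex.I • conjVec x)]; simp
  have h2 : leviForm B (conjVec x) (conjVec x) = ∑ i, ∑ j, star (x i) * (x j *
      leviForm B (EuclideanSpace.single i 1) (EuclideanSpace.single j 1)) := by
    rw [hx]
    simp only [map_sum, LinearMap.sum_apply, map_smul, LinearMap.smul_apply, map_smulₛₗ, smul_eq_mul,
      RCLike.star_def, Complex.conj_conj]
    simp only [Finset.mul_sum]
    rw [Finset.sum_comm]
    exact Finset.sum_congr rfl fun i _ => Finset.sum_congr rfl fun j _ => by ring
  rw [Complex.ofReal_mul, ← h1, h2, dotProduct, Finset.mul_sum]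
  refine Finset.sum_congr rfl fun i _ => ?_
  rw [Matrix.mulVec, dotProduct, Finset.mul_sum, Finset.mul_sum]
  refine Finset.sum_congr rfl fun j _ => ?_
  rw [hij, Pi.star_apply]
  push_cast
  ring

end ComplexMongeAmpere

section NormedSpaceFacts

variable {G : Type*} [NormedAddCommGroup G] [NormedSpace ℝ G]

theorem contDiff_bilin_apply (v w : G) :
    ContDiff ℝ 1 fun B : G →L[ℝ] G →L[ℝ] ℝ => ((B v w : ℝ) : ℂ) := by
  have : ContDiff ℝ 1 fun B : G →L[ℝ] G →L[ℝ] ℝ => B v w :=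
    (contDiff_id.clm_apply contDiff_const).clm_apply contDiff_const
  exact Complex.ofRealCLM.contDiff.comp this

theorem HasFDerivAt.hasDerivAt_line {f : G → ℝ} {f' : G →L[ℝ] ℝ} {A : G} (h : HasFDerivAt f f' A)
    (X : G) : HasDerivAt (fun t : ℝ => f (A + t • X)) (f' X) 0 := by
  have hline : HasDerivAt (fun t : ℝ => A + t • X) X 0 := by
    simpa using ((hasDerivAt_id (0 : ℝ)).smul_const X).const_add A
  have : HasFDerivAt f f' (A + (0 : ℝ) • X) := by simpa using h
  exact this.comp_hasDerivAt (0 : ℝ) hline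

theorem tendsto_line (A X : G) : Tendsto (fun t : ℝ => A + t • X) (𝓝 0) (𝓝 A) := by
  have : Continuous fun t : ℝ => A + t • X := by fun_prop
  simpa using this.tendsto 0

theorem isCompact_of_isClosed_of_norm_le [FiniteDimensional ℝ G] {s : Set G} {c : ℝ}
    (h : ∃ t : Set G, IsClosed t ∧ s = {B | ‖B‖ ≤ c} ∩ t) : IsCompact s := by
  obtain ⟨t, ht, rfl⟩ := h
  have := FiniteDimensional.proper ℝ G
  refine Metric.isCompact_of_isClosed_isBounded
    ((isClosed_le continuous_norm continuous_const).inter ht)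
    ((isBounded_closedBall (x := 0) (r := c)).subset fun B hB => ?_)
  rw [mem_closedBall, dist_zero_right]
  exact hB.1

theorem ContDiffAt.continuousAt_fderiv_apply {f : G → ℝ} {A : G} (h : ContDiffAt ℝ 1 f A) (X : G) :
    ContinuousAt (fun B => fderiv ℝ f B X) A :=
  (h.continuousAt_fderiv one_ne_zero).clm_apply continuousAt_const

end NormedSpaceFacts

section ComplexMongeAmpere

open scoped Matrix

variable {n : ℕ}

theorem leviMatrix_posSemidef_iff {B : Cn n →L[ℝ] Cn n →L[ℝ] ℝ} (hB : ∀ v w, B v w = B w v) :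
    (leviMatrix B).PosSemidef ↔ ∀ v, 0 ≤ B v v + B (Complex.I • v) (Complex.I • v) := by
  constructor
  · intro h v
    have h1 := h.dotProduct_mulVec_nonneg (star (v : Fin n → ℂ))
    rw [dotProduct_leviMatrix hB, conjVec_star] at h1
    have := Complex.zero_le_real.1 h1
    linarith
  · intro h
    refine .of_dotProduct_mulVec_nonneg (leviMatrix_isHermitian hB) fun x => ?_
    rw [dotProduct_leviMatrix hB]
    have := h (conjVec x)
    exact Complex.zero_le_real.2 (by linarith)

theorem leviMatrix_posSemidef {B : Cn n →L[ℝ] Cn n →L[ℝ] ℝ} (hB : ∀ v w, B v w = B w v)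
    (h : ∀ v, 0 ≤ B v v) : (leviMatrix B).PosSemidef :=
  (leviMatrix_posSemidef_iff hB).2 fun v => add_nonneg (h v) (h _)

theorem leviMatrix_sub_posSemidef {A B : Cn n →L[ℝ] Cn n →L[ℝ] ℝ} (hA : ∀ v w, A v w = A w v)
    (hB : ∀ v w, B v w = B w v) (h : ∀ v, A v v ≤ B v v) :
    (leviMatrix B - leviMatrix A).PosSemidef := by
  rw [← leviMatrix_sub]
  refine leviMatrix_posSemidef (fun v w => ?_) fun v => ?_
  · rw [sub_apply, sub_apply, sub_apply, sub_apply, hA v w, hB v w]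
  · rw [sub_apply, sub_apply]; linarith [h v]

theorem eventually_posDef_leviMatrix {A : Cn n →L[ℝ] Cn n →L[ℝ] ℝ} (hA : ∀ v w, A v w = A w v)
    (h : (leviMatrix A).PosDef) :
    ∀ᶠ B in 𝓝 A, (∀ v w, B v w = B w v) → (leviMatrix B).PosDef := by
  have hq : Continuous fun v : Cn n => A v v + A (Complex.I • v) (Complex.I • v) := by fun_prop
  have hpos : ∀ v : Cn n, v ≠ 0 → 0 < A v v + A (Complex.I • v) (Complex.I • v) := by
    intro v hv
    have h1 := h.dotProduct_mulVec_pos (x := star (v : Fin n → ℂ)) (by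
      intro h0
      apply hv
      have : (v : Fin n → ℂ) = 0 := by simpa using h0
      ext i
      exact congrFun this i)
    rw [dotProduct_leviMatrix hA, conjVec_star] at h1
    have := Complex.zero_lt_real.1 h1
    linarith
  obtain ⟨m, hm, hm'⟩ : ∃ m : ℝ, 0 < m ∧ ∀ v : Cn n, ‖v‖ = 1 →
      m ≤ A v v + A (Complex.I • v) (Complex.I • v) := by
    rcases (sphere (0 : Cn n) 1).eq_empty_or_nonempty with he | hne
    · refine ⟨1, one_pos, fun v hv => ?_⟩
      have : v ∈ sphere (0 : Cn n) 1 := by simpa using hv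
      rw [he] at this
      exact this.elim
    · obtain ⟨v, hv, hmin⟩ := (isCompact_sphere (0 : Cn n) 1).exists_isMinOn hne hq.continuousOn
      refine ⟨_, hpos v (fun h0 => by simp [h0] at hv), fun w hw => hmin (by simpa using hw)⟩
  filter_upwards [eventually_norm_sub_lt (E := Cn n →L[ℝ] Cn n →L[ℝ] ℝ) A
    (by positivity : 0 < m / 4)] with B hB hBs
  refine .of_dotProduct_mulVec_pos (leviMatrix_isHermitian hBs) fun x hx => ?_
  rw [dotProduct_leviMatrix hBs]
  refine Complex.zero_lt_real.2 ?_
  set v := conjVec x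
  have hv : v ≠ 0 := conjVec_ne_zero hx
  have hv' : 0 < ‖v‖ := norm_pos_iff.2 hv
  have hd : ∀ w : Cn n, |B w w - A w w| ≤ m / 4 * ‖w‖ ^ 2 := by
    intro w
    have h1 := (B - A).le_opNorm₂ w w
    rw [Real.norm_eq_abs, sub_apply, sub_apply] at h1
    calc _ ≤ _ := h1
      _ = ‖B - A‖ * ‖w‖ ^ 2 := by ring
      _ ≤ _ := by gcongr
  have h1 := hm' ((‖v‖⁻¹ : ℝ) • v) (by
    rw [norm_smul, norm_inv, norm_norm, inv_mul_cancel₀ hv'.ne'])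
  rw [smul_comm Complex.I] at h1
  simp only [map_smul, smul_apply, smul_eq_mul] at h1
  have h2 : m * ‖v‖ ^ 2 ≤ A v v + A (Complex.I • v) (Complex.I • v) := by
    have h3 := mul_le_mul_of_nonneg_right h1 (by positivity : 0 ≤ ‖v‖ ^ 2)
    refine h3.trans (le_of_eq ?_)
    field_simp
  have h3 := abs_le.1 (hd v)
  have h4 := abs_le.1 (hd (Complex.I • v))
  have h5 : ‖Complex.I • v‖ = ‖v‖ := by rw [norm_smul, Complex.norm_I, one_mul]
  rw [h5] at h4
  have h6 : 0 < m * ‖v‖ ^ 2 := by positivity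
  linarith [h3.1, h4.1]

theorem contDiff_leviMatrix_apply (i j : Fin n) :
    ContDiff ℝ 1 fun B : Cn n →L[ℝ] Cn n →L[ℝ] ℝ => leviMatrix B i j := by
  have h : ∀ v w : Cn n, ContDiff ℝ 1 fun B : Cn n →L[ℝ] Cn n →L[ℝ] ℝ => ((B v w : ℝ) : ℂ) :=
    contDiff_bilin_apply (G := Cn n)
  simp only [leviMatrix, Complex.ofReal_add, Complex.ofReal_sub]
  exact contDiff_const.mul (((h _ _).add (h _ _)).add (contDiff_const.mul ((h _ _).sub (h _ _))))

theorem contDiff_re_det_leviMatrix :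
    ContDiff ℝ 1 fun B : Cn n →L[ℝ] Cn n →L[ℝ] ℝ => (leviMatrix B).det.re := by
  refine Complex.reCLM.contDiff.comp (g := fun z : ℂ => z.re) ?_
  simp only [Matrix.det_apply']
  exact ContDiff.sum fun σ _ => contDiff_const.mul
    (contDiff_prod fun i _ => contDiff_leviMatrix_apply _ _)

/-- The operator `log det` of the complex Monge–Ampère equation. -/
def maLog (B : Cn n →L[ℝ] Cn n →L[ℝ] ℝ) : ℝ := Real.log (leviMatrix B).det.re

theorem contDiffAt_maLog {A : Cn n →L[ℝ] Cn n →L[ℝ] ℝ} (h : 0 < (leviMatrix A).det.re) :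
    ContDiffAt ℝ 1 maLog A :=
  contDiff_re_det_leviMatrix.contDiffAt.log h.ne'

theorem fderiv_maLog_apply {A X : Cn n →L[ℝ] Cn n →L[ℝ] ℝ} (hA : ∀ v w, A v w = A w v)
    (h : (leviMatrix A).PosDef) (hX : ∀ v w, X v w = X w v) :
    fderiv ℝ maLog A X = ((leviMatrix A)⁻¹ * leviMatrix X).trace.re := by
  have hd := ((contDiffAt_maLog h.re_det_pos).differentiableAt one_ne_zero).hasFDerivAt
  have h1 : HasDerivAt (fun t : ℝ => maLog (A + t • X)) (fderiv ℝ maLog A X) 0 :=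
    HasFDerivAt.hasDerivAt_line (G := Cn n →L[ℝ] Cn n →L[ℝ] ℝ) hd X
  set c := ((leviMatrix A)⁻¹ * leviMatrix X).trace.re with hc
  have h2 : HasDerivAt (fun t : ℝ => maLog (A + t • X) - t * c) (fderiv ℝ maLog A X - 1 * c) 0 :=
    h1.sub ((hasDerivAt_id (0 : ℝ)).mul_const c)
  have hmax : IsLocalMax (fun t : ℝ => maLog (A + t • X) - t * c) 0 := by
    have ht : Tendsto (fun t : ℝ => A + t • X) (𝓝 0) (𝓝 A) :=
      tendsto_line (G := Cn n →L[ℝ] Cn n →L[ℝ] ℝ) A X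
    filter_upwards [ht.eventually (eventually_posDef_leviMatrix hA h)] with t ht
    have hB := ht fun v w => by
      simp only [add_apply, smul_apply, hA v w, hX v w]
    have h3 := h.log_det_sub_le hB
    have h4 : ((leviMatrix A)⁻¹ * (leviMatrix (A + t • X) - leviMatrix A)).trace.re = t * c := by
      rw [leviMatrix_add, leviMatrix_smul, add_sub_cancel_left, mul_smul_comm, Matrix.trace_smul,
        smul_eq_mul, Complex.re_ofReal_mul]
    rw [h4] at h3
    have h5 : A + (0 : ℝ) • X = A := by
      ext v w
      simp only [add_apply, smul_apply, zero_smul, add_zero]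
    show maLog (A + t • X) - t * c ≤ maLog (A + (0 : ℝ) • X) - 0 * c
    rw [h5, zero_mul, sub_zero]
    unfold maLog
    linarith
  have := hmax.hasDerivAt_eq_zero h2
  linarith

/-- Real Hessians of plurisubharmonic functions with bounds on the Hessian and on the
Monge–Ampère density. -/
def maAdm (n : ℕ) (Λ lam M : ℝ) : Set (Cn n →L[ℝ] Cn n →L[ℝ] ℝ) :=
  {B | (∀ v w, B v w = B w v) ∧ ‖B‖ ≤ Λ ∧ (leviMatrix B).PosSemidef ∧
    lam ≤ (leviMatrix B).det.re ∧ (leviMatrix B).det.re ≤ M}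

theorem isCompact_maAdm (Λ lam M : ℝ) : IsCompact (maAdm n Λ lam M) := by
  have happ : ∀ v w : Cn n, Continuous fun B : Cn n →L[ℝ] Cn n →L[ℝ] ℝ => B v w := fun v w => by
    fun_prop
  have hdet : Continuous fun B : Cn n →L[ℝ] Cn n →L[ℝ] ℝ => (leviMatrix B).det.re :=
    contDiff_re_det_leviMatrix.continuous
  refine isCompact_of_isClosed_of_norm_le (G := Cn n →L[ℝ] Cn n →L[ℝ] ℝ) (c := Λ)
    ⟨{B | ∀ v w, B v w = B w v} ∩
      ({B | ∀ v, 0 ≤ B v v + B (Complex.I • v) (Complex.I • v)} ∩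
      ({B | lam ≤ (leviMatrix B).det.re} ∩ {B | (leviMatrix B).det.re ≤ M})), ?_, ?_⟩
  · refine IsClosed.inter ?_ (IsClosed.inter ?_ (IsClosed.inter ?_ ?_))
    · simp only [ofPred_forall]
      exact isClosed_iInter fun v => isClosed_iInter fun w => isClosed_eq (happ v w) (happ w v)
    · simp only [ofPred_forall]
      exact isClosed_iInter fun v => isClosed_le continuous_const ((happ _ _).add (happ _ _))
    · exact isClosed_le continuous_const hdet
    · exact isClosed_le hdet continuous_const
  · ext B
    constructor
    · rintro ⟨h1, h2, h3, h4, h5⟩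
      exact ⟨h2, h1, (leviMatrix_posSemidef_iff h1).1 h3, h4, h5⟩
    · rintro ⟨h2, h1, h3, h4, h5⟩
      exact ⟨h1, h2, (leviMatrix_posSemidef_iff h1).2 h3, h4, h5⟩

theorem maAdm_posDef {Λ lam M : ℝ} (hlam : 0 < lam) {B : Cn n →L[ℝ] Cn n →L[ℝ] ℝ}
    (hB : B ∈ maAdm n Λ lam M) : (leviMatrix B).PosDef :=
  hB.2.2.1.posDef_of_re_det_pos (hlam.trans_le hB.2.2.2.1)

theorem isElliptic_lower_maLog {Λ lam M : ℝ} (hΛ : 0 ≤ Λ) (hlam : 0 < lam)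
    {A X : Cn n →L[ℝ] Cn n →L[ℝ] ℝ} (hA : A ∈ maAdm n Λ lam M) (hX : ∀ v w, X v w = X w v)
    (hX' : ∀ v, 0 ≤ X v v) (e : Cn n) (he : ‖e‖ ≤ 1) :
    (4 * (Λ + 1))⁻¹ * X e e ≤ fderiv ℝ maLog A X := by
  have hP := maAdm_posDef hlam hA
  have hQ := leviMatrix_posSemidef hX hX'
  rw [fderiv_maLog_apply hA.1 hP hX]
  have hc : (((Λ + 1 : ℝ) : ℂ) • 1 - leviMatrix A).PosSemidef := by
    refine .of_dotProduct_mulVec_nonneg ?_ fun x => ?_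
    · refine Matrix.IsHermitian.sub ?_ hP.1
      have : star ((Λ + 1 : ℝ) : ℂ) = ((Λ + 1 : ℝ) : ℂ) := Complex.conj_ofReal _
      rw [Matrix.IsHermitian, Matrix.conjTranspose_smul, Matrix.conjTranspose_one, this]
    · have e1 : star x ⬝ᵥ x = ((‖conjVec x‖ ^ 2 : ℝ) : ℂ) := by
        rw [norm_conjVec_sq]
        simp only [dotProduct, Pi.star_apply]
        push_cast
        exact Finset.sum_congr rfl fun i _ => Complex.conj_mul' _
      rw [Matrix.sub_mulVec, Matrix.smul_mulVec, Matrix.one_mulVec, dotProduct_sub,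
        dotProduct_smul, e1, dotProduct_leviMatrix hA.1, smul_eq_mul, ← Complex.ofReal_mul,
        ← Complex.ofReal_sub]
      refine Complex.zero_le_real.2 ?_
      have h1 : ∀ w : Cn n, A w w ≤ Λ * ‖w‖ ^ 2 := fun w => by
        have h1 := A.le_opNorm₂ w w
        calc A w w ≤ ‖A w w‖ := le_abs_self _
          _ ≤ _ := h1
          _ = ‖A‖ * ‖w‖ ^ 2 := by ring
          _ ≤ _ := by gcongr; exact hA.2.1
      have h2 := h1 (conjVec x)
      have h3 := h1 (Complex.I • conjVec x)
      rw [norm_smul, Complex.norm_I, one_mul] at h3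
      have h4 : 0 ≤ Λ * ‖conjVec x‖ ^ 2 := by positivity
      have h5 : 0 ≤ ‖conjVec x‖ ^ 2 := by positivity
      linarith
  have h1 := hP.re_trace_inv_mul_ge hQ (by positivity : 0 < Λ + 1) hc
  have h2 := hQ.re_dotProduct_le (star (e : Fin n → ℂ)) (by
    rw [← norm_conjVec_sq, conjVec_star]
    exact pow_le_one₀ (norm_nonneg _) he)
  rw [dotProduct_leviMatrix hX, conjVec_star, Complex.ofReal_re] at h2
  have h3 : 1 / 4 * X e e ≤ (leviMatrix X).trace.re := by linarith [hX' (Complex.I • e)]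
  calc (4 * (Λ + 1))⁻¹ * X e e = (Λ + 1)⁻¹ * (1 / 4 * X e e) := by field_simp
    _ ≤ (Λ + 1)⁻¹ * (leviMatrix X).trace.re := by gcongr
    _ ≤ _ := h1

theorem exists_concaveOperator_maLog (n : ℕ) {Λ lam M : ℝ} (hΛ : 0 ≤ Λ) (hlam : 0 < lam) :
    ∃ θ Θ : ℝ, ConcaveOperator (E := Cn n) maLog (maAdm n Λ lam M) (fderiv ℝ maLog) θ Θ Λ := by
  have hpos : ∀ A ∈ maAdm n Λ lam M, 0 < (leviMatrix A).det.re := fun A hA =>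
    hlam.trans_le hA.2.2.2.1
  have hcont : ContinuousOn (fun A => fderiv ℝ maLog A idForm) (maAdm n Λ lam M) := by
    exact fun A hA => (ContDiffAt.continuousAt_fderiv_apply (G := Cn n →L[ℝ] Cn n →L[ℝ] ℝ)
      (contDiffAt_maLog (hpos A hA)) idForm).continuousWithinAt
  obtain ⟨Θ, hΘ⟩ := (isCompact_maAdm Λ lam M).exists_bound_of_continuousOn hcont
  have hmono : ∀ A B : Cn n →L[ℝ] Cn n →L[ℝ] ℝ, (∀ v w, A v w = A w v) → (∀ v w, B v w = B w v) →
      (leviMatrix A).PosDef → (∀ v, A v v ≤ B v v) →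
      (leviMatrix A).det.re ≤ (leviMatrix B).det.re := fun A B hA hB hP h =>
    hP.re_det_le (leviMatrix_sub_posSemidef hA hB h)
  refine ⟨(4 * (Λ + 1))⁻¹, max Θ 0, ?_⟩
  constructor
  · positivity
  · exact le_max_right _ _
  · exact hΛ
  · exact isCompact_maAdm Λ lam M
  · exact fun A hA => hA.1
  · exact fun A hA => hA.2.1
  · exact fun A hA => (contDiffAt_maLog (hpos A hA)).hasStrictFDerivAt one_ne_zero
  · intro A hA B hB
    rw [fderiv_maLog_apply hA.1 (maAdm_posDef hlam hA) (fun v w => by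
      rw [sub_apply, sub_apply, sub_apply, sub_apply, hA.1 v w, hB.1 v w]), leviMatrix_sub]
    exact (maAdm_posDef hlam hA).log_det_sub_le (maAdm_posDef hlam hB)
  · intro A hA
    exact ⟨fun X hX hX' e he => isElliptic_lower_maLog hΛ hlam hA hX hX' e he,
      (le_abs_self _).trans ((hΘ A hA).trans (le_max_left _ _))⟩
  · intro A hA
    filter_upwards [eventually_posDef_leviMatrix hA.1 (maAdm_posDef hlam hA)] with B hB hBs C hC
    exact ⟨fun h => Real.log_le_log (hpos C hC) (hmono C B hC.1 hBs (maAdm_posDef hlam hC) h),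
      fun h => Real.log_le_log (hB hBs).re_det_pos (hmono B C hBs hC.1 (hB hBs) h)⟩
  · intro B₁ h₁ B₂ h₂ hF B hB hB₁ hB₂
    have hP₁ := maAdm_posDef hlam h₁
    have h := hP₁.add_posSemidef (leviMatrix_sub_posSemidef h₁.1 hB hB₁)
    rw [add_sub_cancel] at h
    have e1 := hmono B₁ B h₁.1 hB hP₁ hB₁
    have e2 := hmono B B₂ hB h₂.1 h hB₂
    have e3 : (leviMatrix B₁).det.re = (leviMatrix B₂).det.re :=
      Real.log_injOn_pos (hpos B₁ h₁) (hpos B₂ h₂) hF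
    have e4 : (leviMatrix B).det.re = (leviMatrix B₁).det.re := by linarith
    refine ⟨⟨hB, ?_, h.posSemidef, ?_, ?_⟩, ?_⟩
    · refine norm_le_of_diag hB hΛ fun v => ?_
      have b1 := (abs_le.1 (bilin_le_norm B₁ v)).1
      have b2 := (abs_le.1 (bilin_le_norm B₂ v)).2
      have c1 : ‖B₁‖ * ‖v‖ ^ 2 ≤ Λ * ‖v‖ ^ 2 := by gcongr; exact h₁.2.1
      have c2 : ‖B₂‖ * ‖v‖ ^ 2 ≤ Λ * ‖v‖ ^ 2 := by gcongr; exact h₂.2.1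
      rw [abs_le]
      exact ⟨by linarith [hB₁ v], by linarith [hB₂ v]⟩
    · rw [e4]; exact h₁.2.2.2.1
    · rw [e4]; exact h₁.2.2.2.2
    · unfold maLog; rw [e4]

end ComplexMongeAmpere

section UniformTaylor

variable {E : Type*} [NormedAddCommGroup E] [InnerProductSpace ℝ E]

theorem hasFDerivAt_of_taylor {u : E → ℝ} {x : E} {r C α : ℝ} {ℓ : E →L[ℝ] ℝ}
    {B : E →L[ℝ] E →L[ℝ] ℝ} (hr : 0 < r) (hC : 0 ≤ C) (hα : 0 < α)
    (h : ∀ y ∈ ball x r, |u y - quadPoly x (u x) ℓ B y| ≤ C * ‖y - x‖ ^ (2 + α)) :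
    HasFDerivAt u ℓ x := by
  have hO : (fun y => u y - u x - ℓ (y - x)) =O[𝓝 x] fun y => ‖y - x‖ ^ 2 := by
    refine IsBigO.of_bound (C + ‖B‖) ?_
    filter_upwards [ball_mem_nhds x hr, ball_mem_nhds x one_pos] with y hy hy1
    have h1 := abs_le.1 (h y hy)
    have hd : ‖y - x‖ ≤ 1 := by rw [← dist_eq_norm]; exact (mem_ball.1 hy1).le
    have h2 : ‖y - x‖ ^ (2 + α) ≤ ‖y - x‖ ^ 2 := by
      rw [← Real.rpow_two]
      exact Real.rpow_le_rpow_of_exponent_ge' (norm_nonneg _) hd (by norm_num) (by linarith)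
    have h3 := abs_le.1 (bilin_le_norm B (y - x))
    have h4 := mul_le_mul_of_nonneg_left h2 hC
    have h5 : 0 ≤ ‖B‖ * ‖y - x‖ ^ 2 := by positivity
    rw [Real.norm_eq_abs, norm_pow, norm_norm, abs_le]
    simp only [quadPoly] at h1
    constructor <;> linarith
  have := hO.trans_isLittleO (isLittleO_pow_sub_sub x one_lt_two)
  rw [hasFDerivAt_iff_isLittleO]
  exact this

theorem taylor_compare {u : E → ℝ} {x z : E} {r C α : ℝ} {ℓx ℓz : E →L[ℝ] ℝ}
    {Bx Bz : E →L[ℝ] E →L[ℝ] ℝ} (hBx : ∀ v w, Bx v w = Bx w v) (hBz : ∀ v w, Bz v w = Bz w v)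
    (hC : 0 ≤ C) (hα : 0 < α) (hα1 : α < 1)
    (hx : ∀ y ∈ ball x r, |u y - quadPoly x (u x) ℓx Bx y| ≤ C * ‖y - x‖ ^ (2 + α))
    (hz : ∀ y ∈ ball z r, |u y - quadPoly z (u z) ℓz Bz y| ≤ C * ‖y - z‖ ^ (2 + α))
    (hne : z ≠ x) (hr : 2 * ‖z - x‖ < r) :
    ‖ℓz - ℓx - Bx (z - x)‖ ≤ 9 * C * ‖z - x‖ ^ (1 + α) ∧
      ‖Bz - Bx‖ ≤ 36 * C * ‖z - x‖ ^ α := by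
  set h : ℝ := ‖z - x‖ with hh
  have h0 : 0 < h := norm_pos_iff.2 (sub_ne_zero.2 hne)
  have key : ∀ y ∈ closedBall (0 : E) h,
      |quadPoly 0 (u z - quadPoly x (u x) ℓx Bx z) (ℓz - ℓx - Bx (z - x)) (Bz - Bx) y| ≤
        9 * C * h ^ (2 + α) := by
    intro y hy
    rw [mem_closedBall, dist_zero_right] at hy
    have e1 : ‖z + y - x‖ ≤ 2 * h := by
      have : z + y - x = (z - x) + y := by abel
      rw [this]
      linarith [norm_add_le (z - x) y]
    have e2 : ‖z + y - z‖ ≤ h := by rwa [add_sub_cancel_left]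
    have b1 := hx (z + y) (by rw [mem_ball, dist_eq_norm]; linarith)
    have b2 := hz (z + y) (by rw [mem_ball, dist_eq_norm]; linarith)
    rw [← quadPoly_recenter x z (u x) ℓx hBx (z + y)] at b1
    have c1 : ‖z + y - x‖ ^ (2 + α) ≤ 8 * h ^ (2 + α) := by
      calc _ ≤ (2 * h) ^ (2 + α) :=
            Real.rpow_le_rpow (norm_nonneg _) e1 (by linarith)
        _ = 2 ^ (2 + α) * h ^ (2 + α) := Real.mul_rpow (by norm_num) h0.le
        _ ≤ 2 ^ (3 : ℝ) * h ^ (2 + α) := by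
            gcongr
            · norm_num
            · linarith
        _ = _ := by norm_num
    have c2 : ‖z + y - z‖ ^ (2 + α) ≤ h ^ (2 + α) :=
      Real.rpow_le_rpow (norm_nonneg _) e2 (by linarith)
    have d1 := abs_le.1 (b1.trans (mul_le_mul_of_nonneg_left c1 hC))
    have d2 := abs_le.1 (b2.trans (mul_le_mul_of_nonneg_left c2 hC))
    have e : quadPoly 0 (u z - quadPoly x (u x) ℓx Bx z) (ℓz - ℓx - Bx (z - x)) (Bz - Bx) y =
        quadPoly z (u z) ℓz Bz (z + y) -
          quadPoly z (quadPoly x (u x) ℓx Bx z) (ℓx + Bx (z - x)) Bx (z + y) := by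
      generalize quadPoly x (u x) ℓx Bx z = a
      simp only [quadPoly, add_sub_cancel_left, sub_zero, sub_apply, add_apply]
      ring
    rw [e, abs_le]
    constructor <;> linarith [d1.1, d1.2, d2.1, d2.2]
  have hB : ∀ v w, (Bz - Bx) v w = (Bz - Bx) w v := fun v w => by
    rw [sub_apply, sub_apply, sub_apply, sub_apply, hBz v w, hBx v w]
  obtain ⟨-, k2, k3⟩ := norm_le_of_quadPoly_le hB h0 key
  refine ⟨k2.trans (le_of_eq ?_), k3.trans (le_of_eq ?_)⟩
  · rw [show (2 + α) = (1 + α) + 1 by ring, Real.rpow_add_one h0.ne']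
    field_simp
  · rw [show (2 + α) = α + (2 : ℕ) by push_cast; ring, Real.rpow_add_natCast h0.ne']
    field_simp
    ring

/-- A function with uniform second order Taylor expansions near `x` is twice differentiable at `x`. -/
theorem hasFDerivAt_fderiv_of_taylor {u : E → ℝ} {x : E} {r C α : ℝ}
    {B : E → E →L[ℝ] E →L[ℝ] ℝ} {ℓ : E → E →L[ℝ] ℝ} (hr : 0 < r) (hC : 0 ≤ C) (hα : 0 < α)
    (hα1 : α < 1) (hB : ∀ z ∈ ball x r, ∀ v w, B z v w = B z w v)
    (h : ∀ z ∈ ball x r, ∀ y ∈ ball z r,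
      |u y - quadPoly z (u z) (ℓ z) (B z) y| ≤ C * ‖y - z‖ ^ (2 + α)) :
    HasFDerivAt (fderiv ℝ u) (B x) x := by
  have hx := mem_ball_self (x := x) hr
  have hfd : ∀ z ∈ ball x r, fderiv ℝ u z = ℓ z := fun z hz =>
    (hasFDerivAt_of_taylor hr hC hα (h z hz)).fderiv
  rw [hasFDerivAt_iff_isLittleO, isLittleO_iff]
  intro c hc
  have hlim : Tendsto (fun z : E => 9 * C * ‖z - x‖ ^ α) (𝓝 x) (𝓝 0) := by
    have h1 : ContinuousAt (fun z : E => 9 * C * ‖z - x‖ ^ α) x :=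
      (((continuous_id.sub continuous_const).norm.continuousAt).rpow_const
        (Or.inr hα.le)).const_mul _
    simpa [ContinuousAt, Real.zero_rpow hα.ne'] using h1
  filter_upwards [hlim.eventually (gt_mem_nhds hc), ball_mem_nhds x (half_pos hr)] with z hz hzr
  have hzr' : z ∈ ball x r := ball_subset_ball (by linarith) hzr
  rw [hfd z hzr', hfd x hx]
  rcases eq_or_ne z x with rfl | hne
  · simp
  · rw [mem_ball, dist_eq_norm] at hzr
    have k := (taylor_compare (hB x hx) (hB z hzr') hC hα hα1 (h x hx) (h z hzr') hne
      (by linarith)).1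
    have h0 : 0 < ‖z - x‖ := norm_pos_iff.2 (sub_ne_zero.2 hne)
    refine k.trans ?_
    rw [Real.rpow_add h0, Real.rpow_one]
    calc _ = (9 * C * ‖z - x‖ ^ α) * ‖z - x‖ := by ring
      _ ≤ _ := mul_le_mul_of_nonneg_right hz.le h0.le

/-- Uniform second order Taylor expansions give a Hölder bound on the second derivative. -/
theorem norm_fderiv_fderiv_sub_le_of_taylor {u : E → ℝ} {S : Set E} {r C α M : ℝ} (hr : 0 < r)
    (hC : 0 ≤ C) (hα : 0 < α) (hα1 : α < 1)
    (h : ∀ x ∈ S, ∀ z ∈ ball x r, ∃ (ℓ : E →L[ℝ] ℝ) (B : E →L[ℝ] E →L[ℝ] ℝ),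
      (∀ v w, B v w = B w v) ∧
        ∀ y ∈ ball z r, |u y - quadPoly z (u z) ℓ B y| ≤ C * ‖y - z‖ ^ (2 + α))
    (hM : ∀ x ∈ S, ‖fderiv ℝ (fderiv ℝ u) x‖ ≤ M) {x y : E} (hx : x ∈ S) (hy : y ∈ S) :
    ‖fderiv ℝ (fderiv ℝ u) x - fderiv ℝ (fderiv ℝ u) y‖ ≤
      (36 * C + 2 * M / (r / 2) ^ α) * dist x y ^ α := by
  have hM0 : 0 ≤ M := (ContinuousLinearMap.opNorm_nonneg _).trans (hM x hx)
  have hrα : 0 < (r / 2) ^ α := by positivity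
  have hd0 : 0 ≤ dist x y ^ α := by positivity
  rcases lt_or_ge (dist x y) (r / 2) with hlt | hge
  · rcases eq_or_ne x y with rfl | hne
    · rw [sub_self]
      refine (norm_zero (E := E →L[ℝ] E →L[ℝ] ℝ)).le.trans ?_
      positivity
    have h' : ∀ z, ∃ (ℓ : E →L[ℝ] ℝ) (B : E →L[ℝ] E →L[ℝ] ℝ),
        (z ∈ ball x r ∪ ball y r → (∀ v w, B v w = B w v) ∧
          ∀ y ∈ ball z r, |u y - quadPoly z (u z) ℓ B y| ≤ C * ‖y - z‖ ^ (2 + α)) := fun z => by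
      by_cases hz : z ∈ ball x r ∪ ball y r
      · obtain ⟨ℓ, B, hB⟩ := hz.elim (h x hx z) (h y hy z)
        exact ⟨ℓ, B, fun _ => hB⟩
      · exact ⟨0, 0, fun h => absurd h hz⟩
    choose ℓ B hB using h'
    have d1 := (hasFDerivAt_fderiv_of_taylor hr hC hα hα1 (fun z hz => (hB z (Or.inl hz)).1)
      (fun z hz => (hB z (Or.inl hz)).2)).fderiv
    have d2 := (hasFDerivAt_fderiv_of_taylor hr hC hα hα1 (fun z hz => (hB z (Or.inr hz)).1)
      (fun z hz => (hB z (Or.inr hz)).2)).fderiv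
    rw [d1, d2]
    have hbx := hB x (Or.inl (mem_ball_self hr))
    have hby := hB y (Or.inr (mem_ball_self hr))
    rw [dist_eq_norm] at hlt hd0 ⊢
    have k := (taylor_compare hby.1 hbx.1 hC hα hα1 hby.2 hbx.2 hne (by linarith)).2
    have : 0 ≤ 2 * M / (r / 2) ^ α * ‖x - y‖ ^ α := by positivity
    linarith
  · have k : ‖fderiv ℝ (fderiv ℝ u) x - fderiv ℝ (fderiv ℝ u) y‖ ≤ 2 * M :=
      (norm_sub_le (E := E →L[ℝ] E →L[ℝ] ℝ) _ _).trans (by linarith [hM x hx, hM y hy])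
    have k2 : (r / 2) ^ α ≤ dist x y ^ α := Real.rpow_le_rpow (by positivity) hge hα.le
    have k3 : 2 * M ≤ 2 * M / (r / 2) ^ α * dist x y ^ α := by
      rw [div_mul_eq_mul_div, le_div_iff₀ hrα]
      gcongr
    have : 0 ≤ 36 * C * dist x y ^ α := by positivity
    linarith

end UniformTaylor

end EvansKrylov

section ComplexMongeAmpere

theorem abs_log_sub_log_le {lam a b : ℝ} (hlam : 0 < lam) (ha : lam ≤ a) (hb : lam ≤ b) :
    |Real.log a - Real.log b| ≤ |a - b| / lam := by
  have key : ∀ a b : ℝ, lam ≤ a → lam ≤ b → Real.log a - Real.log b ≤ |a - b| / lam := by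
    intro a b ha hb
    have hb0 : 0 < b := hlam.trans_le hb
    rw [← Real.log_div (hlam.trans_le ha).ne' hb0.ne']
    calc Real.log (a / b) ≤ a / b - 1 := Real.log_le_sub_one_of_pos (by
          have := hlam.trans_le ha
          positivity)
      _ = (a - b) / b := by field_simp
      _ ≤ |a - b| / b := by gcongr; exact le_abs_self _
      _ ≤ |a - b| / lam := by gcongr
  rw [abs_le]
  have h1 := key a b ha hb
  have h2 := key b a hb ha
  rw [abs_sub_comm] at h2
  constructor <;> linarith

theorem abs_log_le {lam M a : ℝ} (hlam : 0 < lam) (ha : lam ≤ a) (haM : a ≤ M) :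
    |Real.log a| ≤ |Real.log lam| + |Real.log M| := by
  have h1 := Real.log_le_log hlam ha
  have h2 := Real.log_le_log (hlam.trans_le ha) haM
  rw [abs_le]
  constructor
  · linarith [neg_abs_le (Real.log lam), abs_nonneg (Real.log M)]
  · linarith [le_abs_self (Real.log M), abs_nonneg (Real.log lam)]

theorem norm_fderiv_fderiv_le {E : Type*} [NormedAddCommGroup E] [NormedSpace ℝ E] {u : E → ℝ}
    {Ω : Set E} {M : NNReal} (hΩ : IsOpen Ω) (h : LipschitzOnWith M (fderiv ℝ u) Ω) {x : E}
    (hx : x ∈ Ω) : ‖fderiv ℝ (fderiv ℝ u) x‖ ≤ M :=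
  norm_fderiv_le_of_lipschitzOn ℝ (hΩ.mem_nhds hx) h

theorem sol_of_complexMongeAmpere {n : ℕ} {lam : ℝ} {Mf Mu : NNReal} {Ω : Set (Cn n)}
    {u f : Cn n → ℝ} (hΩ : IsOpen Ω) (hu : C11On u Ω) (hdiff : AESecondDiff u Ω)
    (hpsh : PshAE u Ω) (hdet : ∀ᵐ z, z ∈ Ω → (complexHessian u z).det = (f z : ℂ))
    (hf : ∀ z ∈ Ω, lam ≤ f z) (hfM : ∀ z ∈ Ω, |f z| ≤ Mf)
    (hlip : LipschitzOnWith Mu (fderiv ℝ u) Ω) {x : Cn n} {r : ℝ} (hx : ball x r ⊆ Ω) :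
    Sol maLog (maAdm n Mu lam Mf) Mu volume u (fun z => Real.log (f z)) x r := by
  have hd : ∀ z ∈ Ω, DifferentiableAt ℝ u z := fun z hz =>
    (hu.1.differentiableOn one_ne_zero).differentiableAt (hΩ.mem_nhds hz)
  refine ⟨fun y hy => hd y (hx hy), fun y hy z hz => ?_, ?_⟩
  · have := hlip.dist_le_mul y (hx hy) z (hx hz)
    rwa [dist_eq_norm, dist_eq_norm] at this
  · filter_upwards [hdiff, hpsh, hdet] with z h1 h2 h3 hz
    have hz' := hx hz
    have hH := hasHessAt_of_differentiableAt_fderiv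
      (Filter.eventually_of_mem (hΩ.mem_nhds hz') hd) (h1 hz')
    have hre : (leviMatrix (fderiv ℝ (fderiv ℝ u) z)).det.re = f z := by
      rw [← complexHessian_eq, h3 hz', Complex.ofReal_re]
    refine ⟨fderiv ℝ (fderiv ℝ u) z, ⟨hH.1, norm_fderiv_fderiv_le hΩ hlip hz', ?_, ?_, ?_⟩, hH, ?_⟩
    · rw [← complexHessian_eq]; exact h2 hz'
    · rw [hre]; exact hf z hz'
    · rw [hre]; exact (le_abs_self _).trans (hfM z hz')
    · unfold maLog; rw [hre]

end ComplexMongeAmpere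

/-- **Interior `C^{2,α}` estimate for the complex Monge–Ampère equation.**
For every dimension `n`, exponent `α ∈ (0,1)`, lower bound `λ > 0`, bound `Mf` for the
`α`-Hölder norm of `f` on `Ω`, bound `Mu` for the `C^{1,1}` norm of `u` on `Ω` and
distance `d > 0`, there is a constant `C` (depending only on these quantities) such
that: whenever `u` is a plurisubharmonic `C^{1,1}` solution of `det(u_{i j̄}) = f` a.e.
in a domain `Ω ⊆ ℂⁿ` with `f ≥ λ` and the above norm bounds, and `K ⊆ Ω` is a compact
set at distance at least `d` from `∂Ω`, then the `C^{2,α}` norm of `u` on `K` (sup of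
`u`, its first and second derivatives, and the `α`-Hölder seminorm of the second
derivatives) is at most `C`. -/
theorem interior_C2alpha_estimate_complex_MongeAmpere
    (n : ℕ) (α : NNReal) (hα : 0 < α) (hα1 : α < 1)
    (lam : ℝ) (hlam : 0 < lam) (Mf Mu : NNReal) (d : ℝ) (hd : 0 < d) :
    ∃ C : ℝ, 0 < C ∧
      ∀ (Ω K : Set (Cn n)) (u f : Cn n → ℝ),
        IsOpen Ω → IsConnected Ω → IsCompact K → K ⊆ Ω →
        (∀ x ∈ K, ball x d ⊆ Ω) →
        C11On u Ω → AESecondDiff u Ω → PshAE u Ω →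
        (∀ᵐ z, z ∈ Ω → (complexHessian u z).det = (f z : ℂ)) →
        (∀ z ∈ Ω, lam ≤ f z) →
        (∀ z ∈ Ω, |f z| ≤ Mf) → HolderOnWith Mf α f Ω →
        (∀ z ∈ Ω, |u z| ≤ Mu ∧ ‖fderiv ℝ u z‖ ≤ Mu) →
        LipschitzOnWith Mu (fderiv ℝ u) Ω →
        (∀ x ∈ K, |u x| ≤ C ∧ ‖fderiv ℝ u x‖ ≤ C ∧ ‖fderiv ℝ (fderiv ℝ u) x‖ ≤ C) ∧
          ∀ x ∈ K, ∀ y ∈ K,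
            ‖fderiv ℝ (fderiv ℝ u) x - fderiv ℝ (fderiv ℝ u) y‖ ≤ C * dist x y ^ (α : ℝ) := by
  have hαr : (0 : ℝ) < α := hα
  have hα1r : (α : ℝ) < 1 := hα1
  rcases Nat.eq_zero_or_pos n with rfl | hn
  · refine ⟨Mu + 1, by positivity, ?_⟩
    intro Ω K u f hΩ _ _ hKΩ _ _ _ _ _ _ _ _ hu hlip
    refine ⟨fun x hx => ⟨(hu x (hKΩ hx)).1.trans (by linarith), (hu x (hKΩ hx)).2.trans
      (by linarith), (norm_fderiv_fderiv_le hΩ hlip (hKΩ hx)).trans (by linarith)⟩,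
      fun x _ y _ => ?_⟩
    rw [Subsingleton.elim x y, sub_self]
    refine (norm_zero (E := Cn 0 →L[ℝ] Cn 0 →L[ℝ] ℝ)).le.trans ?_
    positivity
  have : Nonempty (Fin n) := ⟨⟨0, hn⟩⟩
  have : Nontrivial (Cn n) := inferInstance
  have : (volume : Measure (Cn n)).IsAddHaarMeasure :=
    inferInstanceAs (Measure.addHaar : Measure (Cn n)).IsAddHaarMeasure
  set N : ℝ := |Real.log lam| + |Real.log Mf| + Mf / lam with hN
  have hN1 : (Mf : ℝ) / lam ≤ N := by
    linarith [abs_nonneg (Real.log lam), abs_nonneg (Real.log Mf)]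
  have hN2 : |Real.log lam| + |Real.log Mf| ≤ N := by
    have : 0 ≤ (Mf : ℝ) / lam := by positivity
    linarith
  obtain ⟨θ, Θ, O⟩ := exists_concaveOperator_maLog n (M := Mf) Mu.coe_nonneg hlam
  obtain ⟨C, hC, r, hr, hrd, hT⟩ := Sol.exists_taylor (volume : Measure (Cn n)) O hαr hα1r
    (N := N) (by positivity) (half_pos hd)
  have hr2 : 0 < (r / 2) ^ (α : ℝ) := by positivity
  refine ⟨Mu + (36 * C + 2 * Mu / (r / 2) ^ (α : ℝ)), by positivity, ?_⟩
  intro Ω K u f hΩ _ _ hKΩ hKd hu hdiff hpsh hdet hf hfM hfα hub hlip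
  have hM : ∀ x ∈ K, ‖fderiv ℝ (fderiv ℝ u) x‖ ≤ Mu := fun x hx =>
    norm_fderiv_fderiv_le hΩ hlip (hKΩ hx)
  have hC' : (Mu : ℝ) ≤ Mu + (36 * C + 2 * Mu / (r / 2) ^ (α : ℝ)) :=
    le_add_of_nonneg_right (by positivity)
  refine ⟨fun x hx => ⟨(hub x (hKΩ hx)).1.trans hC', (hub x (hKΩ hx)).2.trans hC',
    (hM x hx).trans hC'⟩, fun x hx y hy => ?_⟩
  refine (norm_fderiv_fderiv_sub_le_of_taylor hr hC.le hαr hα1r (fun x hx z hz => ?_) hM hx hy).trans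
    (mul_le_mul_of_nonneg_right (le_add_of_nonneg_left Mu.coe_nonneg) (by positivity))
  have hzΩ : ball z (d / 2) ⊆ Ω := (ball_subset_ball' (by
    rw [mem_ball] at hz; linarith)).trans (hKd x hx)
  have hz0 : z ∈ Ω := hzΩ (mem_ball_self (half_pos hd))
  refine hT u (fun z => Real.log (f z)) z
    (sol_of_complexMongeAmpere hΩ hu hdiff hpsh hdet hf hfM hlip hzΩ)
    ((abs_log_le hlam (hf z hz0) ((le_abs_self _).trans (hfM z hz0))).trans hN2) fun y hy => ?_
  have hfy := hfα.dist_le (hzΩ hy) hz0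
  rw [Real.dist_eq, dist_eq_norm] at hfy
  calc _ ≤ |f y - f z| / lam := abs_log_sub_log_le hlam (hf y (hzΩ hy)) (hf z hz0)
    _ ≤ (Mf * ‖y - z‖ ^ (α : ℝ)) / lam := by gcongr
    _ = Mf / lam * ‖y - z‖ ^ (α : ℝ) := by ring
    _ ≤ N * ‖y - z‖ ^ (α : ℝ) := by gcongr
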